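/- arXiv:2505.11105 — 2 statements merged into one kernel-verified Lean document; each statement's English description precedes it below -/
import Mathlib

section
/- For every integer t > 1 there exists N such that for all n ≥ N, the Turán number of the 3-expansion of the t-fan satisfies ex_3(n, F_t^3) = C(n,3) − C(n−t,3). -/
/-- `H` contains a copy of `F_t^3`, the 3-expansion of the `t`-fan.
The center is `f (Sum.inl ())`; for each `i : Fin t`, the two far-edge endpoints are
`f (Sum.inr (0, i))` and `f (Sum.inr (1, i))`, and the three new expansion vertices are
`f (Sum.inr (2, i))`, `f (Sum.inr (3, i))`, `f (Sum.inr (4, i))`. -/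
def ContainsFanExp {V : Type*} [DecidableEq V] (t : ℕ) (H : Finset (Finset V)) : Prop :=
  ∃ f : Unit ⊕ Fin 5 × Fin t → V, Function.Injective f ∧
    ∀ i : Fin t,
      ({f (Sum.inl ()), f (Sum.inr (0, i)), f (Sum.inr (2, i))} : Finset V) ∈ H ∧
      ({f (Sum.inl ()), f (Sum.inr (1, i)), f (Sum.inr (3, i))} : Finset V) ∈ H ∧
      ({f (Sum.inr (0, i)), f (Sum.inr (1, i)), f (Sum.inr (4, i))} : Finset V) ∈ H

/-- The Turán number `ex_3(n, F_t^3)`: the maximum number of hyperedges in an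
`n`-vertex 3-uniform hypergraph containing no copy of `F_t^3`. -/
noncomputable def exFan3 (t n : ℕ) : ℕ :=
  sSup {m | ∃ H : Finset (Finset (Fin n)),
    (∀ e ∈ H, e.card = 3) ∧ ¬ ContainsFanExp t H ∧ H.card = m}

theorem exists_disjoint_or_hitting {V : Type*} [DecidableEq V] (F : Finset V → Prop) (t : ℕ) :
    (∃ f : Fin t → Finset V, (∀ i, F (f i)) ∧ ∀ i j, i ≠ j → Disjoint (f i) (f j)) ∨
    ∃ s : Finset (Finset V), s.card < t ∧ (∀ A ∈ s, F A) ∧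
      ∀ A, F A → ¬ Disjoint A (s.biUnion id) := by
  induction t generalizing F with
  | zero => exact Or.inl ⟨fun i => i.elim0, fun i => i.elim0, fun i => i.elim0⟩
  | succ t ih =>
    by_cases hne : ∃ A, F A
    · obtain ⟨A, hA⟩ := hne
      rcases ih (fun X => F X ∧ Disjoint X A) with ⟨f, hf, hd⟩ | ⟨s, hs, hsF, hhit⟩
      · left
        refine ⟨Fin.cons A f, ?_, ?_⟩
        · intro i
          refine Fin.cases hA (fun j => (hf j).1) i
        · intro i j
          refine Fin.cases ?_ (fun i' => ?_) i <;> refine Fin.cases ?_ (fun j' => ?_) j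
          · simp
          · intro _; simpa using (hf j').2.symm
          · intro _; simpa using (hf i').2
          · intro h
            simpa using hd i' j' (by simpa using h)
      · right
        refine ⟨insert A s, ?_, ?_, ?_⟩
        · exact lt_of_le_of_lt (Finset.card_insert_le _ _) (by omega)
        · intro X hX
          rcases Finset.mem_insert.1 hX with rfl | hX
          · exact hA
          · exact (hsF X hX).1
        · intro X hX hdis
          rw [Finset.biUnion_insert, Finset.disjoint_union_right] at hdis
          exact hhit X ⟨hX, hdis.1⟩ hdis.2
    · right
      exact ⟨∅, by simp, by simp, fun A hA => (hne ⟨A, hA⟩).elim⟩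

/-- A digraph on `J` with out-degrees at most `l` has a large independent set. -/
theorem exists_independent_of_outdegree {ι : Type*} [DecidableEq ι] (r : ι → ι → Prop)
    [DecidableRel r] (l k : ℕ) (J : Finset ι)
    (hout : ∀ i ∈ J, (J.filter fun j => r i j).card ≤ l) (hJ : (2 * l + 1) * k ≤ J.card) :
    ∃ I ⊆ J, I.card = k ∧ ∀ i ∈ I, ∀ j ∈ I, i ≠ j → ¬ r i j := by
  induction k generalizing J with
  | zero => exact ⟨∅, by simp, by simp, by simp⟩
  | succ k ih =>
    have hne : J.Nonempty := by
      rw [← Finset.card_pos]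
      have : 0 < (2 * l + 1) * (k + 1) := by positivity
      omega
    obtain ⟨j, hj, hjin⟩ : ∃ j ∈ J, (J.filter fun i => r i j).card ≤ l := by
      by_contra! hcon
      have h1 := Finset.sum_card_bipartiteAbove_eq_sum_card_bipartiteBelow (s := J) (t := J) r
      have h2 : ∑ i ∈ J, (J.bipartiteAbove r i).card ≤ J.card * l := by
        rw [← smul_eq_mul]
        exact Finset.sum_le_card_nsmul _ _ _ (fun i hi => hout i hi)
      have h3 : J.card * (l + 1) ≤ ∑ j ∈ J, (J.bipartiteBelow r j).card := by
        rw [← smul_eq_mul]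
        exact Finset.card_nsmul_le_sum _ _ _ (fun i hi => hcon i hi)
      have := Finset.card_pos.2 hne
      nlinarith
    set J' := J.filter fun i => i ≠ j ∧ ¬ r i j ∧ ¬ r j i with hJ'
    have hsub : J ⊆ J' ∪ ({j} ∪ (J.filter (fun i => r i j) ∪ J.filter fun i => r j i)) := by
      intro i hi
      simp only [hJ', Finset.mem_union, Finset.mem_filter, Finset.mem_singleton]
      tauto
    have hcard : J.card ≤ J'.card + (1 + (l + l)) := by
      refine (Finset.card_le_card hsub).trans ((Finset.card_union_le _ _).trans ?_)
      gcongr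
      refine (Finset.card_union_le _ _).trans ?_
      gcongr
      · simp
      refine (Finset.card_union_le _ _).trans ?_
      gcongr
      exact hout j hj
    obtain ⟨I, hI, hIc, hind⟩ := ih J'
      (fun i hi => (Finset.card_le_card (Finset.filter_subset_filter _
        (Finset.filter_subset _ _))).trans (hout i (Finset.filter_subset _ _ hi)))
      (by rw [mul_add] at hJ; omega)
    have hjI : j ∉ I := fun h => by simpa [hJ'] using hI h
    refine ⟨insert j I, ?_, by simp [hjI, hIc], ?_⟩
    · intro i hi
      rcases Finset.mem_insert.1 hi with rfl | hi
      · exact hj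
      · exact Finset.filter_subset _ _ (hI hi)
    · intro a ha b hb hab
      rcases Finset.mem_insert.1 ha with h1 | h1 <;> rcases Finset.mem_insert.1 hb with h2 | h2
      · exact (hab (h1.trans h2.symm)).elim
      · exact h1 ▸ (Finset.mem_filter.1 (hI h2)).2.2.2
      · exact h2 ▸ (Finset.mem_filter.1 (hI h1)).2.2.1
      · exact hind a h1 b h2 hab

theorem exists_independent {ι V : Type*} [DecidableEq ι] [DecidableEq V] (core L : ι → Finset V)
    (l k : ℕ) (J : Finset ι) (hcore : ∀ i ∈ J, ∀ j ∈ J, i ≠ j → Disjoint (core i) (core j))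
    (hL : ∀ i ∈ J, (L i).card ≤ l) (hJ : (2 * l + 1) * k ≤ J.card) :
    ∃ I ⊆ J, I.card = k ∧ ∀ i ∈ I, ∀ j ∈ I, i ≠ j → Disjoint (L i) (core j) := by
  obtain ⟨I, hI, hk, h⟩ := exists_independent_of_outdegree
    (fun i j => ¬ Disjoint (L i) (core j)) l k J (by
      intro i hi
      refine le_trans ?_ (hL i hi)
      rcases isEmpty_or_nonempty V with hV | hV
      · rw [Finset.filter_false_of_mem]
        · simp
        · intro j _
          simp [Finset.eq_empty_of_isEmpty]
      have : ∀ j ∈ J.filter (fun j => ¬ Disjoint (L i) (core j)), ∃ x, x ∈ L i ∧ x ∈ core j := by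
        intro j hj
        exact Finset.not_disjoint_iff.1 (Finset.mem_filter.1 hj).2
      choose! g hg using this
      refine Finset.card_le_card_of_injOn g (fun j hj => (hg j hj).1) ?_
      intro a ha b hb hab
      by_contra hne
      have h1 := (hg a ha).2
      have h2 := (hg b hb).2
      rw [hab] at h1
      exact Finset.disjoint_left.1 (hcore a (Finset.mem_filter.1 ha).1 b
        (Finset.mem_filter.1 hb).1 hne) h1 h2) hJ
  exact ⟨I, hI, hk, fun i hi j hj hij => not_not.1 (h i hi j hj hij)⟩

theorem exists_independent_sdr {ι V : Type*} [DecidableEq ι] [DecidableEq V]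
    (core L : ι → Finset V) (t : ℕ) (J : Finset ι)
    (hcore : ∀ i ∈ J, ∀ j ∈ J, i ≠ j → Disjoint (core i) (core j))
    (hL : ∀ i ∈ J, t ≤ (L i).card) (hJ : (2 * t + 1) * t ≤ J.card) :
    ∃ (g : Fin t → ι) (u : Fin t → V), Function.Injective g ∧ Function.Injective u ∧
      (∀ i, g i ∈ J) ∧ (∀ i, u i ∈ L (g i)) ∧ ∀ i j, i ≠ j → u i ∉ core (g j) := by
  have hex : ∀ i, ∃ L' : Finset V, i ∈ J → L' ⊆ L i ∧ L'.card = t := by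
    intro i
    by_cases hi : i ∈ J
    · obtain ⟨L', h1, h2⟩ := Finset.exists_subset_card_eq (hL i hi)
      exact ⟨L', fun _ => ⟨h1, h2⟩⟩
    · exact ⟨∅, fun h => (hi h).elim⟩
  choose L' hL' using hex
  obtain ⟨I, hI, hk, hind⟩ := exists_independent core L' t t J hcore
    (fun i hi => (hL' i hi).2.le) hJ
  let e := (Finset.equivFinOfCardEq hk).symm
  obtain ⟨u, hu, huL⟩ := (Finset.all_card_le_biUnion_card_iff_exists_injective
    (fun i : Fin t => L' (e i))).1 (by
      intro s
      rcases s.eq_empty_or_nonempty with rfl | ⟨i, hi⟩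
      · simp
      · calc s.card ≤ t := by simpa using Finset.card_le_univ s
          _ = (L' (e i)).card := ((hL' _ (hI (e i).2)).2).symm
          _ ≤ _ := Finset.card_le_card (Finset.subset_biUnion_of_mem
              (fun i : Fin t => L' (e i)) hi))
  refine ⟨fun i => e i, u, fun a b h => e.injective (Subtype.ext h), hu,
    fun i => hI (e i).2, fun i => (hL' _ (hI (e i).2)).1 (huL i), fun i j hij => ?_⟩
  refine Finset.disjoint_left.1 (hind _ (e i).2 _ (e j).2 ?_) (huL i)
  exact fun h => hij (e.injective (Subtype.ext h))

/-- The vertices completing the pair `x, y` to a hyperedge. -/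
def cod {V : Type*} [Fintype V] [DecidableEq V] (H : Finset (Finset V)) (x y : V) : Finset V :=
  Finset.univ.filter fun w => ({x, y, w} : Finset V) ∈ H

/-- A pair of vertices of codegree large enough to be completed greedily. -/
def Thick {V : Type*} [Fintype V] [DecidableEq V] (t : ℕ) (H : Finset (Finset V)) (x y : V) :
    Prop :=
  5 * t + 7 ≤ (cod H x y).card

/-- `P` is the set of non-central vertices of a copy of the expanded triangle centred at `v`. -/
def Petal {V : Type*} [DecidableEq V] (H : Finset (Finset V)) (v : V) (P : Finset V) : Prop :=
  ∃ a b p q r : V, [v, a, b, p, q, r].Nodup ∧ P = {a, b, p, q, r} ∧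
    ({v, a, p} : Finset V) ∈ H ∧ ({v, b, q} : Finset V) ∈ H ∧ ({a, b, r} : Finset V) ∈ H

/-- `Q` extends to a petal centred at `v` whose new vertices avoid any given small set. -/
def Flex {V : Type*} [DecidableEq V] (t : ℕ) (H : Finset (Finset V)) (v : V) (Q : Finset V) :
    Prop :=
  ∀ U : Finset V, U.card ≤ 5 * t → ∃ P, Petal H v P ∧ Q ⊆ P ∧ Disjoint (P \ Q) U

theorem triple_swap_left {V : Type*} [DecidableEq V] (a b c : V) :
    ({a, b, c} : Finset V) = {b, a, c} := Finset.insert_comm _ _ _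

theorem triple_swap_right {V : Type*} [DecidableEq V] (a b c : V) :
    ({a, b, c} : Finset V) = {a, c, b} := by rw [Finset.pair_comm]

theorem triple_rotate {V : Type*} [DecidableEq V] (a b c : V) :
    ({a, b, c} : Finset V) = {b, c, a} := by
  rw [triple_swap_left, triple_swap_right]

theorem triple_reverse {V : Type*} [DecidableEq V] (a b c : V) :
    ({a, b, c} : Finset V) = {c, b, a} := by
  rw [triple_rotate, triple_swap_left]

theorem ne_of_triple {V : Type*} [DecidableEq V] {H : Finset (Finset V)}
    (hH : ∀ e ∈ H, e.card = 3) {a b c : V} (h : ({a, b, c} : Finset V) ∈ H) :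
    a ≠ b ∧ a ≠ c ∧ b ≠ c := by
  have := hH _ h
  refine ⟨?_, ?_, ?_⟩ <;> rintro rfl
  · have h2 : ({a, a, c} : Finset V).card ≤ 2 := by simpa using Finset.card_le_two
    omega
  · have h2 : ({a, b, a} : Finset V).card ≤ 2 := by
      rw [triple_swap_right, Finset.insert_idem]; simpa using Finset.card_le_two
    omega
  · have h2 : ({a, b, b} : Finset V).card ≤ 2 := by simpa using Finset.card_le_two
    omega

section Basic

variable {V : Type*} [Fintype V] [DecidableEq V] {H : Finset (Finset V)} {t : ℕ}

theorem mem_cod {x y w : V} : w ∈ cod H x y ↔ ({x, y, w} : Finset V) ∈ H := by simp [cod]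

theorem cod_comm (x y : V) : cod H x y = cod H y x := by
  ext w; rw [mem_cod, mem_cod, triple_swap_left]

theorem Thick.symm {x y : V} (h : Thick t H x y) : Thick t H y x := by
  rwa [Thick, cod_comm]

theorem thick_comm {x y : V} : Thick t H x y ↔ Thick t H y x := ⟨Thick.symm, Thick.symm⟩

theorem Thick.ne (hH : ∀ e ∈ H, e.card = 3) {x y : V} (h : Thick t H x y) : x ≠ y := by
  have : (cod H x y).Nonempty := Finset.card_pos.1 (by unfold Thick at h; omega)
  obtain ⟨w, hw⟩ := this
  exact (ne_of_triple hH (mem_cod.1 hw)).1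

end Basic

section Flexible

variable {V : Type*} [DecidableEq V] {H : Finset (Finset V)} {t : ℕ}

theorem containsFanExp_of_petals {v : V} (f : Fin t → Finset V) (hf : ∀ i, Petal H v (f i))
    (hd : ∀ i j, i ≠ j → Disjoint (f i) (f j)) : ContainsFanExp t H := by
  choose a b p q r hn hP h1 h2 h3 using hf
  have hmem : ∀ i (k : Fin 5), (![a i, b i, p i, q i, r i] : Fin 5 → V) k ∈ f i := by
    intro i k
    rw [hP]
    fin_cases k <;> simp
  have hv : ∀ i (k : Fin 5), v ≠ (![a i, b i, p i, q i, r i] : Fin 5 → V) k := by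
    intro i k
    have := hn i
    simp only [List.nodup_cons, List.mem_cons, not_or] at this
    fin_cases k <;> simp <;> tauto
  have hinj : ∀ i, Function.Injective (![a i, b i, p i, q i, r i] : Fin 5 → V) := by
    intro i
    have := (List.nodup_cons.1 (hn i)).2
    rw [← List.nodup_ofFn]
    simpa [List.ofFn_succ] using this
  refine ⟨Sum.elim (fun _ => v) fun x =>
    (![a x.2, b x.2, p x.2, q x.2, r x.2] : Fin 5 → V) x.1, ?_, ?_⟩
  · rintro (⟨⟩ | ⟨k, i⟩) (⟨⟩ | ⟨l, j⟩) h
    · rfl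
    · exact (hv _ _ h).elim
    · exact (hv _ _ h.symm).elim
    · by_cases hij : i = j
      · subst hij
        simp only [Sum.elim_inr] at h
        rw [hinj i h]
      · refine (Finset.disjoint_left.1 (hd i j hij) (hmem i k) ?_).elim
        have := hmem j l
        simp only [Sum.elim_inr] at h
        rwa [h]
  · intro i
    exact ⟨h1 i, h2 i, h3 i⟩

theorem Petal.card_le {v : V} {P : Finset V} (h : Petal H v P) : P.card ≤ 5 := by
  obtain ⟨a, b, p, q, r, -, rfl, -⟩ := h
  exact Finset.card_le_five

theorem Petal.flex {v : V} {P : Finset V} (h : Petal H v P) : Flex t H v P :=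
  fun U _ => ⟨P, h, subset_rfl, by simp⟩

theorem Flex.card_le {v : V} {Q : Finset V} (h : Flex t H v Q) : Q.card ≤ 5 := by
  obtain ⟨P, hP, hQ, -⟩ := h ∅ (by simp)
  exact (Finset.card_le_card hQ).trans hP.card_le

theorem containsFanExp_of_flex {v : V} (f : Fin t → Finset V) (hf : ∀ i, Flex t H v (f i))
    (hd : ∀ i j, i ≠ j → Disjoint (f i) (f j)) : ContainsFanExp t H := by
  have key : ∀ S : Finset (Fin t), ∃ g : Fin t → Finset V, (∀ i, Flex t H v (g i)) ∧
      (∀ i j, i ≠ j → Disjoint (g i) (g j)) ∧ ∀ i ∈ S, Petal H v (g i) := by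
    intro S
    induction S using Finset.induction_on with
    | empty => exact ⟨f, hf, hd, by simp⟩
    | insert k S hk ih =>
      obtain ⟨g, hg, hgd, hgS⟩ := ih
      obtain ⟨P, hP, hgP, hPd⟩ := hg k ((Finset.univ.erase k).biUnion g) (by
        refine Finset.card_biUnion_le.trans ?_
        refine (Finset.sum_le_card_nsmul _ _ 5 fun i _ => (hg i).card_le).trans ?_
        have := Finset.card_le_univ (Finset.univ.erase k)
        rw [Fintype.card_fin] at this
        rw [smul_eq_mul]
        omega)
      have hPg : ∀ j, j ≠ k → Disjoint P (g j) := by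
        intro j hj
        rw [← Finset.sdiff_union_of_subset hgP, Finset.disjoint_union_left]
        refine ⟨hPd.mono_right ?_, hgd k j hj.symm⟩
        exact Finset.subset_biUnion_of_mem g (by simp [hj])
      refine ⟨Function.update g k P, ?_, ?_, ?_⟩
      · intro i
        by_cases h : i = k
        · subst h; simpa using hP.flex
        · simpa [h] using hg i
      · intro i j hij
        by_cases h : i = k
        · subst h; simpa [hij.symm] using hPg j hij.symm
        · by_cases h' : j = k
          · subst h'; simpa [hij] using (hPg i hij).symm
          · simpa [h, h'] using hgd i j hij
      · intro i hi
        by_cases h : i = k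
        · subst h; simpa using hP
        · simpa [h] using hgS i (by simpa [h] using hi)
  obtain ⟨g, -, hgd, hg⟩ := key Finset.univ
  exact containsFanExp_of_petals g (fun i => hg i (Finset.mem_univ i)) hgd

theorem Flex.of_pool {v : V} {Q W : Finset V} (hQ : Q.card ≤ 5) (hW : 5 * t + 7 ≤ W.card)
    (h : ∀ w ∈ W, w ∉ Q → w ≠ v → Flex t H v (insert w Q)) : Flex t H v Q := by
  intro U hU
  obtain ⟨w, hwW, hw⟩ : ∃ w ∈ W, w ∉ insert v (Q ∪ U) := by
    by_contra! hcon
    have := Finset.card_le_card (show W ⊆ insert v (Q ∪ U) from hcon)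
    have h1 := Finset.card_insert_le v (Q ∪ U)
    have h2 := Finset.card_union_le Q U
    omega
  simp only [Finset.mem_insert, Finset.mem_union, not_or] at hw
  obtain ⟨P, hP, hsub, hdis⟩ := h w hwW hw.2.1 hw.1 U hU
  refine ⟨P, hP, (Finset.subset_insert _ _).trans hsub, ?_⟩
  rw [Finset.disjoint_left] at hdis ⊢
  intro x hx
  by_cases hxw : x = w
  · subst hxw; exact hw.2.2
  · refine hdis ?_
    simp only [Finset.mem_sdiff, Finset.mem_insert] at hx ⊢
    tauto

end Flexible

section FlexibleThick

variable {V : Type*} [Fintype V] [DecidableEq V] {H : Finset (Finset V)} {t : ℕ}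

theorem flex_thick_far (hH : ∀ e ∈ H, e.card = 3) {v a b p q : V}
    (hap : ({v, a, p} : Finset V) ∈ H) (hbq : ({v, b, q} : Finset V) ∈ H)
    (hab : Thick t H a b) (h1 : a ≠ q) (h2 : b ≠ p) (h3 : p ≠ q) :
    Flex t H v {a, b, p, q} := by
  obtain ⟨e1, e2, e3⟩ := ne_of_triple hH hap
  obtain ⟨f1, f2, f3⟩ := ne_of_triple hH hbq
  refine Flex.of_pool (Finset.card_le_four.trans (by norm_num)) hab fun r hr hrQ hrv => ?_
  simp only [Finset.mem_insert, Finset.mem_singleton, not_or] at hrQ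
  refine Petal.flex ⟨a, b, p, q, r, ?_, ?_, hap, hbq, mem_cod.1 hr⟩
  · have := hab.ne hH
    simp only [List.nodup_cons, List.mem_cons, List.not_mem_nil, or_false, not_or,
      List.nodup_nil, and_true, not_false_eq_true]
    grind
  · ext x; simp; tauto

theorem flex_thick_near (hH : ∀ e ∈ H, e.card = 3) {v a b p r : V}
    (hap : ({v, a, p} : Finset V) ∈ H) (habr : ({a, b, r} : Finset V) ∈ H)
    (hvb : Thick t H v b) (h1 : v ≠ r) (h2 : b ≠ p) (h3 : p ≠ r) :
    Flex t H v {a, b, p, r} := by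
  obtain ⟨e1, e2, e3⟩ := ne_of_triple hH hap
  obtain ⟨f1, f2, f3⟩ := ne_of_triple hH habr
  refine Flex.of_pool (Finset.card_le_four.trans (by norm_num)) hvb fun q hq hqQ hqv => ?_
  simp only [Finset.mem_insert, Finset.mem_singleton, not_or] at hqQ
  refine Petal.flex ⟨a, b, p, q, r, ?_, ?_, hap, mem_cod.1 hq, habr⟩
  · have := hvb.ne hH
    simp only [List.nodup_cons, List.mem_cons, List.not_mem_nil, or_false, not_or,
      List.nodup_nil, and_true, not_false_eq_true]
    grind
  · ext x; simp; tauto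

theorem flex_near (hH : ∀ e ∈ H, e.card = 3) {v a b p : V}
    (hap : ({v, a, p} : Finset V) ∈ H) (hvb : Thick t H v b) (hab : Thick t H a b)
    (hbp : b ≠ p) : Flex t H v {a, b, p} := by
  refine Flex.of_pool (Finset.card_le_three.trans (by norm_num)) hab fun r hr hrQ hrv => ?_
  simp only [Finset.mem_insert, Finset.mem_singleton, not_or] at hrQ
  convert flex_thick_near hH hap (mem_cod.1 hr) hvb (Ne.symm hrv) hbp (Ne.symm hrQ.2.2) using 1
  ext x; simp; tauto

theorem flex_far (hH : ∀ e ∈ H, e.card = 3) {v a b r : V}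
    (habr : ({a, b, r} : Finset V) ∈ H) (hva : Thick t H v a) (hvb : Thick t H v b)
    (hvr : v ≠ r) : Flex t H v {a, b, r} := by
  refine Flex.of_pool (Finset.card_le_three.trans (by norm_num)) hva fun p hp hpQ hpv => ?_
  simp only [Finset.mem_insert, Finset.mem_singleton, not_or] at hpQ
  convert flex_thick_near hH (mem_cod.1 hp) habr hvb hvr (Ne.symm hpQ.2.1) hpQ.2.2 using 1
  ext x; simp; tauto

theorem flex_thick (hH : ∀ e ∈ H, e.card = 3) {v a b : V}
    (hva : Thick t H v a) (hvb : Thick t H v b) (hab : Thick t H a b) :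
    Flex t H v {a, b} := by
  refine Flex.of_pool (Finset.card_le_two.trans (by norm_num)) hab fun r hr hrQ hrv => ?_
  convert flex_far hH (mem_cod.1 hr) hva hvb (Ne.symm hrv) using 1
  ext x; simp; tauto

end FlexibleThick

section Free

variable {V : Type*} [DecidableEq V] {H : Finset (Finset V)} {t : ℕ}

theorem ContainsFanExp.mono {E : Finset (Finset V)} (hE : E ⊆ H) (h : ContainsFanExp t E) :
    ContainsFanExp t H := by
  obtain ⟨f, hf, h⟩ := h
  exact ⟨f, hf, fun i => ⟨hE (h i).1, hE (h i).2.1, hE (h i).2.2⟩⟩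

theorem exists_hitting (hfree : ¬ ContainsFanExp t H) :
    ∃ B : V → Finset V, (∀ v, (B v).card ≤ 5 * t) ∧
      ∀ v Q, Flex t H v Q → ¬ Disjoint Q (B v) := by
  have : ∀ v, ∃ W : Finset V, W.card ≤ 5 * t ∧ ∀ Q, Flex t H v Q → ¬ Disjoint Q W := by
    intro v
    rcases exists_disjoint_or_hitting (Flex t H v) t with ⟨f, hf, hd⟩ | ⟨s, hs, hsF, hit⟩
    · exact (hfree (containsFanExp_of_flex f hf hd)).elim
    · refine ⟨s.biUnion id, ?_, hit⟩
      refine Finset.card_biUnion_le.trans ?_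
      refine (Finset.sum_le_card_nsmul _ _ 5 fun i hi => (hsF i hi).card_le).trans ?_
      rw [smul_eq_mul]
      omega
  choose B hB using this
  exact ⟨B, fun v => (hB v).1, fun v => (hB v).2⟩

theorem containsFanExp_of_sdr {ι : Type*} [DecidableEq ι] {v : V} (core L : ι → Finset V)
    (J : Finset ι) (hcore : ∀ i ∈ J, ∀ j ∈ J, i ≠ j → Disjoint (core i) (core j))
    (hL : ∀ i ∈ J, t ≤ (L i).card) (hJ : (2 * t + 1) * t ≤ J.card)
    (hflex : ∀ i ∈ J, ∀ u ∈ L i, Flex t H v (insert u (core i))) : ContainsFanExp t H := by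
  obtain ⟨g, u, hg, hu, hgJ, huL, hout⟩ := exists_independent_sdr core L t J hcore hL hJ
  refine containsFanExp_of_flex (fun i => insert (u i) (core (g i)))
    (fun i => hflex _ (hgJ i) _ (huL i)) fun i j hij => ?_
  simp only [Finset.disjoint_insert_left, Finset.disjoint_insert_right, Finset.mem_insert, not_or]
  exact ⟨⟨fun h => hij (hu h.symm), hout j i hij.symm⟩, hout i j hij,
    hcore _ (hgJ i) _ (hgJ j) (hg.ne hij)⟩

theorem exists_eq_triple_of_mem {e : Finset V} (he : e.card = 3) {a b : V} (ha : a ∈ e)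
    (hb : b ∈ e) (hab : a ≠ b) : ∃ c, e = {a, b, c} ∧ a ≠ c ∧ b ≠ c := by
  have h1 : (e \ {a, b}).card = 1 := by
    rw [Finset.card_sdiff_of_subset (by simp [Finset.insert_subset_iff, ha, hb]), he,
      Finset.card_pair hab]
  obtain ⟨c, hc⟩ := Finset.card_eq_one.1 h1
  have hce : c ∈ e \ {a, b} := by simp [hc]
  simp only [Finset.mem_sdiff, Finset.mem_insert, Finset.mem_singleton, not_or] at hce
  refine ⟨c, ?_, Ne.symm hce.2.1, Ne.symm hce.2.2⟩
  rw [← Finset.sdiff_union_of_subset (show {a, b} ⊆ e by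
    simp [Finset.insert_subset_iff, ha, hb]), hc]
  ext x; simp; tauto

theorem exists_eq_triple_of_mem_single {e : Finset V} (he : e.card = 3) {a : V} (ha : a ∈ e) :
    ∃ b c, e = {a, b, c} ∧ a ≠ b ∧ a ≠ c ∧ b ≠ c := by
  obtain ⟨b, hb, hab⟩ := Finset.exists_mem_ne (by omega : 1 < e.card) a
  obtain ⟨c, h1, h2, h3⟩ := exists_eq_triple_of_mem he ha hb hab.symm
  exact ⟨b, c, h1, hab.symm, h2, h3⟩

theorem exists_mem_notMem_of_card_lt {W B : Finset V} (h : B.card < W.card) :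
    ∃ x ∈ W, x ∉ B := by
  by_contra! hc
  exact absurd (Finset.card_le_card (show W ⊆ B from hc)) (by omega)

end Free

section Counting

variable {V : Type*} [Fintype V] [DecidableEq V] {H : Finset (Finset V)} {t : ℕ}

theorem card_filter_pair_le (hH : ∀ e ∈ H, e.card = 3) {a b : V} (hab : a ≠ b) :
    (H.filter fun e => a ∈ e ∧ b ∈ e).card ≤ (cod H a b).card := by
  refine (Finset.card_le_card (t := (cod H a b).image fun w => {a, b, w}) ?_).trans
    Finset.card_image_le
  intro e he
  rw [Finset.mem_filter] at he
  obtain ⟨c, rfl, -⟩ := exists_eq_triple_of_mem (hH e he.1) he.2.1 he.2.2 hab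
  exact Finset.mem_image.2 ⟨c, mem_cod.2 he.1, rfl⟩

theorem card_le_shadow {E : Finset (Finset V)} (hE : ∀ e ∈ E, e.card = 3)
    (hfree : ¬ ContainsFanExp t E) (Sh : Finset (Finset V))
    (hSh : ∀ e ∈ E, ∀ a ∈ e, ∀ b ∈ e, a ≠ b → ({a, b} : Finset V) ∈ Sh) :
    E.card ≤ (5 * t + 7) * Sh.card := by
  induction hk : Sh.card generalizing E Sh with
  | zero =>
    rw [Finset.card_eq_zero] at hk
    subst hk
    have : E = ∅ := by
      refine Finset.eq_empty_of_forall_notMem fun e he => ?_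
      obtain ⟨x, y, z, hxy, -, -, rfl⟩ := Finset.card_eq_three.1 (hE e he)
      simpa using hSh _ he x (by simp) y (by simp) hxy
    simp [this]
  | succ k ih =>
    by_cases hthin : ∃ a b, a ≠ b ∧ ({a, b} : Finset V) ∈ Sh ∧ ¬ Thick t E a b
    · obtain ⟨a, b, hab, hS, hthin⟩ := hthin
      have h1 := ih (E := E.filter fun e => ¬ (a ∈ e ∧ b ∈ e))
        (fun e he => hE e (Finset.mem_filter.1 he).1)
        (fun h => hfree (h.mono (Finset.filter_subset _ _))) (Sh.erase {a, b})
        (by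
          intro e he x hx y hy hxy
          rw [Finset.mem_filter] at he
          refine Finset.mem_erase.2 ⟨fun h => he.2 ?_, hSh e he.1 x hx y hy hxy⟩
          have ha : a ∈ ({x, y} : Finset V) := by rw [h]; simp
          have hb : b ∈ ({x, y} : Finset V) := by rw [h]; simp
          simp only [Finset.mem_insert, Finset.mem_singleton] at ha hb
          constructor
          · rcases ha with rfl | rfl <;> assumption
          · rcases hb with rfl | rfl <;> assumption)
        (by rw [Finset.card_erase_of_mem hS, hk]; rfl)
      have h2 := card_filter_pair_le hE hab
      have h3 := Finset.card_filter_add_card_filter_not (s := E) (fun e => a ∈ e ∧ b ∈ e)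
      unfold Thick at hthin
      rw [mul_add]
      omega
    · push Not at hthin
      have : E = ∅ := by
        refine Finset.eq_empty_of_forall_notMem fun e he => ?_
        obtain ⟨B, hB, hit⟩ := exists_hitting hfree
        obtain ⟨v, a, c, hva, -, -, rfl⟩ := Finset.card_eq_three.1 (hE e he)
        have hth : ∀ {x y z : V}, ({x, y, z} : Finset V) ∈ E →
            Thick t E x y ∧ Thick t E x z ∧ Thick t E y z := by
          intro x y z h
          obtain ⟨h1, h2, h3⟩ := ne_of_triple hE h
          exact ⟨hthin _ _ h1 (hSh _ h _ (by simp) _ (by simp) h1),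
            hthin _ _ h2 (hSh _ h _ (by simp) _ (by simp) h2),
            hthin _ _ h3 (hSh _ h _ (by simp) _ (by simp) h3)⟩
        have hva := (hth he).1
        obtain ⟨x, hx, hxB⟩ := exists_mem_notMem_of_card_lt (W := cod E v a) (B := B v)
          (by unfold Thick at hva; have := hB v; omega)
        have hvx := (hth (mem_cod.1 hx)).2.1
        obtain ⟨y, hy, hyB⟩ := exists_mem_notMem_of_card_lt (W := cod E v x) (B := B v)
          (by unfold Thick at hvx; have := hB v; omega)
        obtain ⟨h1, h2, h3⟩ := hth (mem_cod.1 hy)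
        refine hit v _ (flex_thick hE h1 h2 h3) ?_
        simp [hxB, hyB]
      simp [this]

theorem card_le_of_hitting {E : Finset (Finset V)} (hE : ∀ e ∈ E, e.card = 3) (C : V → Finset V)
    (m : ℕ) (hC : ∀ v, (C v).card ≤ m) (hhit : ∀ e ∈ E, ∀ v ∈ e, ∃ u ∈ e, u ≠ v ∧ u ∈ C v) :
    E.card ≤ Fintype.card V * (m * m) := by
  have hsub : E ⊆ Finset.univ.biUnion fun u => (C u).biUnion fun v =>
      (C v).image fun w => ({u, v, w} : Finset V) := by
    intro e he
    simp only [Finset.mem_biUnion, Finset.mem_univ, true_and, Finset.mem_image]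
    have key : ∀ u ∈ e, ∀ v ∈ e, u ≠ v → v ∈ C u → ∀ w ∈ e, w ≠ u → w ≠ v → w ∈ C v →
        ∃ u, ∃ v ∈ C u, ∃ w ∈ C v, ({u, v, w} : Finset V) = e := by
      intro u hu v hv huv hvu w hw hwu hwv hwC
      refine ⟨u, v, hvu, w, hwC, ?_⟩
      refine Finset.eq_of_subset_of_card_le (by simp [Finset.insert_subset_iff, hu, hv, hw]) ?_
      rw [hE e he, Finset.card_eq_three.2 ⟨u, v, w, huv, hwu.symm, hwv.symm, rfl⟩]
    obtain ⟨u, hu⟩ := Finset.card_pos.1 (by rw [hE e he]; norm_num : 0 < e.card)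
    obtain ⟨v, hv, hvu, hvC⟩ := hhit e he u hu
    obtain ⟨w, hw, hwv, hwC⟩ := hhit e he v hv
    by_cases hwu : w = u
    · subst hwu
      obtain ⟨x, rfl, hx1, hx2⟩ := exists_eq_triple_of_mem (hE e he) hw hv hwv
      obtain ⟨y, hy, hyx, hyC⟩ := hhit _ he x (by simp)
      simp only [Finset.mem_insert, Finset.mem_singleton] at hy
      rcases hy with rfl | rfl | rfl
      · exact key x (by simp) y (by simp) hx1.symm hyC v hv hx2 hvu hvC
      · exact key x (by simp) y (by simp) hx2.symm hyC w hw hx1 hvu.symm hwC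
      · exact (hyx rfl).elim
    · exact key u hu v hv hvu.symm hvC w hw hwu hwv hwC
  refine (Finset.card_le_card hsub).trans ?_
  refine (Finset.card_biUnion_le_card_mul _ _ (m * m) fun u _ => ?_)
  refine (Finset.card_biUnion_le_card_mul _ _ m fun v _ => ?_).trans
    (Nat.mul_le_mul_right _ (hC u))
  exact Finset.card_image_le.trans (hC v)

/-- The hyperedges with two thick pairs whose third pair has codegree exceeding `t`. -/
def HeavyEdge (t : ℕ) (H : Finset (Finset V)) (e : Finset V) : Prop :=
  e ∈ H ∧ ∃ x y z, e = {x, y, z} ∧ Thick t H x z ∧ Thick t H y z ∧ t + 1 ≤ (cod H x y).card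

theorem card_heavy_le (hH : ∀ e ∈ H, e.card = 3) (hfree : ¬ ContainsFanExp t H)
    {E : Finset (Finset V)} (hE : ∀ e ∈ E, HeavyEdge t H e) :
    E.card ≤ Fintype.card V * ((2 * ((2 * t + 1) * t)) * (2 * ((2 * t + 1) * t))) := by
  set M := (2 * t + 1) * t with hM
  have hC : ∀ v, ∃ W : Finset V, W.card ≤ 2 * M ∧ ∀ c : Finset V, c.card = 2 →
      (∃ L : Finset V, t ≤ L.card ∧ ∀ u ∈ L, Flex t H v (insert u c)) → ¬ Disjoint c W := by
    intro v
    rcases exists_disjoint_or_hitting (fun c : Finset V => c.card = 2 ∧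
      ∃ L : Finset V, t ≤ L.card ∧ ∀ u ∈ L, Flex t H v (insert u c)) M with
      ⟨f, hf, hd⟩ | ⟨s, hs, hsF, hit⟩
    · choose hf2 L hL hflex using hf
      exact (hfree (containsFanExp_of_sdr f L Finset.univ (fun i _ j _ => hd i j)
        (fun i _ => hL i) (by simp [hM]) fun i _ => hflex i)).elim
    · refine ⟨s.biUnion id, ?_, fun c h1 h2 => hit c ⟨h1, h2⟩⟩
      refine (Finset.card_biUnion_le_card_mul _ _ 2 fun c hc => (hsF c hc).1.le).trans ?_
      omega
  choose C hCc hC using hC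
  refine card_le_of_hitting (fun e he => hH e (hE e he).1) C _ hCc ?_
  intro e he v hv
  obtain ⟨heH, x, y, z, rfl, hxz, hyz, hxy⟩ := hE e he
  obtain ⟨h1, h2, h3⟩ := ne_of_triple hH heH
  have hL : t ≤ ((cod H x y).erase z).card := by
    rw [Finset.card_erase_of_mem (mem_cod.2 heH)]; omega
  have aux : ∀ a b : V, a ≠ b → (∀ u ∈ (cod H x y).erase z, Flex t H v (insert u {a, b})) →
      a ∈ ({x, y, z} : Finset V) → b ∈ ({x, y, z} : Finset V) → a ≠ v → b ≠ v →
      ∃ u ∈ ({x, y, z} : Finset V), u ≠ v ∧ u ∈ C v := by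
    intro a b hab hfl ha hb hav hbv
    have := hC v {a, b} (Finset.card_pair hab) ⟨_, hL, hfl⟩
    rw [Finset.not_disjoint_iff] at this
    obtain ⟨u, hu, huC⟩ := this
    simp only [Finset.mem_insert, Finset.mem_singleton] at hu
    rcases hu with rfl | rfl
    · exact ⟨u, ha, hav, huC⟩
    · exact ⟨u, hb, hbv, huC⟩
  simp only [Finset.mem_insert, Finset.mem_singleton] at hv
  rcases hv with rfl | rfl | rfl
  · refine aux y z h3 (fun u hu => ?_) (by simp) (by simp) h1.symm h2.symm
    rw [Finset.mem_erase] at hu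
    rw [triple_rotate]
    exact flex_near hH (mem_cod.1 hu.2) hxz hyz hu.1.symm
  · refine aux x z h2 (fun u hu => ?_) (by simp) (by simp) h1 h3.symm
    rw [Finset.mem_erase, cod_comm] at hu
    rw [triple_rotate]
    exact flex_near hH (mem_cod.1 hu.2) hyz hxz hu.1.symm
  · refine aux x y h1 (fun u hu => ?_) (by simp) (by simp) h2 h3
    rw [Finset.mem_erase] at hu
    rw [triple_rotate]
    exact flex_far hH (mem_cod.1 hu.2) hxz.symm hyz.symm hu.1.symm

theorem card_thickTriangles_le (hH : ∀ e ∈ H, e.card = 3) (hfree : ¬ ContainsFanExp t H)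
    {E : Finset (Finset V)} (hE : ∀ e ∈ E, ∃ x y z, e = {x, y, z} ∧ Thick t H x y ∧
      Thick t H x z ∧ Thick t H y z) :
    E.card ≤ Fintype.card V * (5 * t * (5 * t)) := by
  obtain ⟨B, hB, hit⟩ := exists_hitting hfree
  have hE3 : ∀ e ∈ E, e.card = 3 := by
    intro e he
    obtain ⟨x, y, z, rfl, h1, h2, h3⟩ := hE e he
    exact Finset.card_eq_three.2 ⟨x, y, z, h1.ne hH, h2.ne hH, h3.ne hH, rfl⟩
  refine card_le_of_hitting hE3 B _ hB ?_
  intro e he v hv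
  obtain ⟨a, b, rfl, hva, hvb, hab⟩ : ∃ a b, e = {v, a, b} ∧ Thick t H v a ∧ Thick t H v b ∧
      Thick t H a b := by
    obtain ⟨x, y, z, rfl, h1, h2, h3⟩ := hE e he
    simp only [Finset.mem_insert, Finset.mem_singleton] at hv
    rcases hv with rfl | rfl | rfl
    · exact ⟨y, z, rfl, h1, h2, h3⟩
    · exact ⟨x, z, triple_swap_left _ _ _, h1.symm, h3, h2⟩
    · exact ⟨x, y, by rw [triple_rotate, triple_rotate], h2.symm, h3.symm, h1⟩
  have := hit v _ (flex_thick hH hva hvb hab)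
  rw [Finset.not_disjoint_iff] at this
  obtain ⟨u, hu, huB⟩ := this
  simp only [Finset.mem_insert, Finset.mem_singleton] at hu
  rcases hu with rfl | rfl
  · exact ⟨u, by simp, (hva.ne hH).symm, huB⟩
  · exact ⟨u, by simp, (hvb.ne hH).symm, huB⟩

end Counting

section Linear

variable {V : Type*} [Fintype V] [DecidableEq V] {H L : Finset (Finset V)} {t : ℕ}

theorem exists_linear_subfamily (hH : ∀ e ∈ H, e.card = 3) {E : Finset (Finset V)} (hEH : E ⊆ H)
    (hthin : ∀ e ∈ E, ∀ a ∈ e, ∀ b ∈ e, a ≠ b → ¬ Thick t H a b) :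
    ∃ L ⊆ E, (∀ e ∈ L, ∀ f ∈ L, ∀ a b, a ≠ b → a ∈ e → b ∈ e → a ∈ f → b ∈ f → e = f) ∧
      E.card ≤ L.card * (3 * (5 * t + 7)) := by
  classical
  obtain ⟨L, hL⟩ := (E.powerset.filter fun L => ∀ e ∈ L, ∀ f ∈ L, ∀ a b, a ≠ b → a ∈ e → b ∈ e →
    a ∈ f → b ∈ f → e = f).exists_maximal ⟨∅, by simp⟩
  obtain ⟨hLE, hlin⟩ := Finset.mem_filter.1 hL.prop
  rw [Finset.mem_powerset] at hLE
  refine ⟨L, hLE, hlin, ?_⟩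
  have hsub : E ⊆ L.biUnion fun f => f.offDiag.biUnion fun x =>
      H.filter fun e => x.1 ∈ e ∧ x.2 ∈ e := by
    intro e he
    have haux : ∀ f ∈ L, ∀ a b, a ≠ b → a ∈ e → b ∈ e → a ∈ f → b ∈ f →
        e ∈ L.biUnion fun f => f.offDiag.biUnion fun x =>
          H.filter fun e => x.1 ∈ e ∧ x.2 ∈ e := by
      intro f hf a b hab ha hb haf hbf
      simp only [Finset.mem_biUnion, Finset.mem_offDiag, Finset.mem_filter]
      exact ⟨f, hf, (a, b), ⟨haf, hbf, hab⟩, hEH he, ha, hb⟩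
    by_contra hcon
    have hno : ∀ f ∈ L, ∀ a b, a ≠ b → a ∈ e → b ∈ e → a ∈ f → b ∈ f → False :=
      fun f hf a b h1 h2 h3 h4 h5 => hcon (haux f hf a b h1 h2 h3 h4 h5)
    have hmem := hL.le_of_ge (y := insert e L) (by
      simp only [Finset.mem_filter, Finset.mem_powerset, Finset.mem_insert]
      refine ⟨Finset.insert_subset he hLE, ?_⟩
      rintro x (rfl | hx) y (rfl | hy) a b hab h1 h2 h3 h4
      · rfl
      · exact (hno y hy a b hab h1 h2 h3 h4).elim
      · exact (hno x hx a b hab h3 h4 h1 h2).elim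
      · exact hlin x hx y hy a b hab h1 h2 h3 h4) (Finset.subset_insert _ _)
    have heL : e ∈ L := hmem (Finset.mem_insert_self _ _)
    obtain ⟨a, ha, b, hb, hab⟩ := Finset.one_lt_card.1
      (by rw [hH e (hEH he)]; norm_num : 1 < e.card)
    exact hno e heL a b hab ha hb ha hb
  have h3 : ∀ f ∈ L, (f.offDiag.biUnion fun x => H.filter fun e => x.1 ∈ e ∧ x.2 ∈ e).card ≤
      3 * (5 * t + 7) := by
    intro f hf
    obtain ⟨x, y, z, hxy, hxz, hyz, rfl⟩ := Finset.card_eq_three.1 (hH f (hEH (hLE hf)))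
    have hp : ∀ a b : V, a ∈ ({x, y, z} : Finset V) → b ∈ ({x, y, z} : Finset V) → a ≠ b →
        (H.filter fun e => a ∈ e ∧ b ∈ e).card ≤ 5 * t + 7 := by
      intro a b ha hb hab
      have := hthin _ (hLE hf) a ha b hb hab
      unfold Thick at this
      exact (card_filter_pair_le hH hab).trans (by omega)
    refine (Finset.card_le_card (t := (H.filter fun e => x ∈ e ∧ y ∈ e) ∪
      ((H.filter fun e => x ∈ e ∧ z ∈ e) ∪ (H.filter fun e => y ∈ e ∧ z ∈ e))) ?_).trans ?_
    · intro e
      simp only [Finset.mem_biUnion, Finset.mem_offDiag, Finset.mem_filter, Finset.mem_union,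
        Finset.mem_insert, Finset.mem_singleton]
      rintro ⟨⟨a, b⟩, ⟨ha, hb, hab⟩, he, hae, hbe⟩
      grind
    · have h1 := hp x y (by simp) (by simp) hxy
      have h2 := hp x z (by simp) (by simp) hxz
      have h3 := hp y z (by simp) (by simp) hyz
      refine (Finset.card_union_le _ _).trans ?_
      have := Finset.card_union_le (H.filter fun e => x ∈ e ∧ z ∈ e)
        (H.filter fun e => y ∈ e ∧ z ∈ e)
      omega
  exact (Finset.card_le_card hsub).trans (Finset.card_biUnion_le_card_mul _ _ _ h3)

/-- The graph whose edges are the pairs inside members of `L`. -/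
def shadowGraph (L : Finset (Finset V)) : SimpleGraph V where
  Adj x y := x ≠ y ∧ ∃ e ∈ L, x ∈ e ∧ y ∈ e
  symm := ⟨fun _ _ ⟨h, e, he, h1, h2⟩ => ⟨h.symm, e, he, h2, h1⟩⟩
  loopless := ⟨fun _ h => h.1 rfl⟩

instance : DecidableRel (shadowGraph L).Adj := fun x y =>
  inferInstanceAs (Decidable (x ≠ y ∧ ∃ e ∈ L, x ∈ e ∧ y ∈ e))

theorem card_shadow_triangles_le (hL3 : ∀ e ∈ L, e.card = 3)
    (hlin : ∀ e ∈ L, ∀ f ∈ L, ∀ a b, a ≠ b → a ∈ e → b ∈ e → a ∈ f → b ∈ f → e = f)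
    (hfree : ¬ ContainsFanExp t L) :
    ((shadowGraph L).cliqueFinset 3).card ≤ (25 * t + 1) * Fintype.card V ^ 2 := by
  obtain ⟨B, hB, hit⟩ := exists_hitting hfree
  have huniq : ∀ {x y z w : V}, ({x, y, z} : Finset V) ∈ L → ({x, y, w} : Finset V) ∈ L →
      z = w := by
    intro x y z w h1 h2
    obtain ⟨hxy, hxz, hyz⟩ := ne_of_triple hL3 h1
    have := hlin _ h1 _ h2 x y hxy (by simp) (by simp) (by simp) (by simp)
    have hz : z ∈ ({x, y, w} : Finset V) := by rw [← this]; simp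
    simp only [Finset.mem_insert, Finset.mem_singleton] at hz
    grind
  have hth : ∃ th : V → V → V, ∀ x y z, ({x, y, z} : Finset V) ∈ L → th x y = z := by
    refine ⟨fun x y => if h : ∃ z, ({x, y, z} : Finset V) ∈ L then h.choose else x, ?_⟩
    intro x y z h
    have h' : ∃ z, ({x, y, z} : Finset V) ∈ L := ⟨z, h⟩
    simp only [h', dite_true]
    exact huniq h'.choose_spec h
  obtain ⟨th, hth⟩ := hth
  let K : Finset (V × V × V) := ((Finset.univ.biUnion fun v => (B v).biUnion fun x =>
    Finset.univ.biUnion fun y =>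
      {(v, x, y), (v, y, x), (v, th v x, y), (v, y, th v x), (v, y, th y x)}) ∪
    Finset.univ.image fun x : V × V => (x.1, x.2, th x.1 x.2))
  have hK : K.card ≤ (25 * t + 1) * Fintype.card V ^ 2 := by
    refine (Finset.card_union_le _ _).trans ?_
    have h1 : (Finset.univ.biUnion fun v => (B v).biUnion fun x => Finset.univ.biUnion fun y =>
      ({(v, x, y), (v, y, x), (v, th v x, y), (v, y, th v x), (v, y, th y x)} :
        Finset (V × V × V))).card ≤ Fintype.card V * (5 * t * (Fintype.card V * 5)) := by
      refine Finset.card_biUnion_le_card_mul _ _ _ fun v _ => ?_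
      refine le_trans (Finset.card_biUnion_le_card_mul _ _ _ fun x _ =>
        Finset.card_biUnion_le_card_mul _ _ 5 fun y _ => Finset.card_le_five) ?_
      exact Nat.mul_le_mul_right _ (hB v)
    have h2 : (Finset.univ.image fun x : V × V => (x.1, x.2, th x.1 x.2)).card ≤
        Fintype.card V ^ 2 := by
      refine Finset.card_image_le.trans ?_
      simp [sq]
    nlinarith
  refine le_trans ?_ hK
  refine (Finset.card_le_card (t := K.image fun x => ({x.1, x.2.1, x.2.2} : Finset V)) ?_).trans
    Finset.card_image_le
  intro T hT
  rw [SimpleGraph.mem_cliqueFinset_iff, SimpleGraph.is3Clique_iff] at hT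
  obtain ⟨v, a, b, ⟨hva, e, he, hve, hae⟩, ⟨hvb, f, hf, hvf, hbf⟩,
    ⟨hab, g, hg, hag, hbg⟩, rfl⟩ := hT
  refine Finset.mem_image.2 ⟨(v, a, b), ?_, rfl⟩
  obtain ⟨p, rfl, hvp, hap⟩ := exists_eq_triple_of_mem (hL3 e he) hve hae hva
  obtain ⟨q, rfl, hvq, hbq⟩ := exists_eq_triple_of_mem (hL3 f hf) hvf hbf hvb
  obtain ⟨r, rfl, har, hbr⟩ := exists_eq_triple_of_mem (hL3 g hg) hag hbg hab
  simp only [K, Finset.mem_union, Finset.mem_biUnion, Finset.mem_univ, true_and, Finset.mem_insert,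
    Finset.mem_singleton, Finset.mem_image, Prod.mk.injEq, Prod.exists]
  by_cases hT : ({v, a, b} : Finset V) ∈ L
  · exact Or.inr ⟨v, a, rfl, rfl, hth _ _ _ hT⟩
  left
  have hpb : p ≠ b := by rintro rfl; exact hT he
  have hqa : q ≠ a := by rintro rfl; exact hT (by rwa [triple_swap_right])
  have hrv : r ≠ v := by rintro rfl; exact hT (by rwa [← triple_rotate] at hg)
  have hpq : p ≠ q := by
    rintro rfl
    rw [triple_swap_right] at he hf
    exact hab (huniq he hf)
  have hpr : p ≠ r := by
    rintro rfl
    rw [triple_rotate] at he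
    rw [triple_swap_right] at hg
    exact hvb (huniq he hg)
  have hqr : q ≠ r := by
    rintro rfl
    rw [triple_rotate] at hf hg
    exact hva (huniq hf hg)
  have hpet : Petal L v {a, b, p, q, r} := by
    refine ⟨a, b, p, q, r, ?_, rfl, he, hf, hg⟩
    simp only [List.nodup_cons, List.mem_cons, List.not_mem_nil, or_false, not_or,
      List.nodup_nil, and_true, not_false_eq_true]
    grind
  have := hit v _ hpet.flex
  rw [Finset.not_disjoint_iff] at this
  obtain ⟨x, hx, hxB⟩ := this
  simp only [Finset.mem_insert, Finset.mem_singleton] at hx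
  rcases hx with rfl | rfl | rfl | rfl | rfl
  · exact ⟨v, x, hxB, b, Or.inl ⟨rfl, rfl, rfl⟩⟩
  · exact ⟨v, x, hxB, a, Or.inr (Or.inl ⟨rfl, rfl, rfl⟩)⟩
  · rw [triple_swap_right] at he
    exact ⟨v, x, hxB, b, Or.inr (Or.inr (Or.inl ⟨rfl, (hth _ _ _ he).symm, rfl⟩))⟩
  · rw [triple_swap_right] at hf
    exact ⟨v, x, hxB, a, Or.inr (Or.inr (Or.inr (Or.inl ⟨rfl, rfl, (hth _ _ _ hf).symm⟩)))⟩
  · rw [triple_swap_right] at hg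
    exact ⟨v, x, hxB, a, Or.inr (Or.inr (Or.inr (Or.inr ⟨rfl, rfl, (hth _ _ _ hg).symm⟩)))⟩

end Linear

theorem card_thin_le (t : ℕ) {η : ℝ} (hη : 0 < η) : ∃ N : ℕ, ∀ (V : Type) [Fintype V]
    [DecidableEq V] (H E : Finset (Finset V)), N ≤ Fintype.card V → (∀ e ∈ H, e.card = 3) →
    ¬ ContainsFanExp t H → E ⊆ H →
    (∀ e ∈ E, ∀ a ∈ e, ∀ b ∈ e, a ≠ b → ¬ Thick t H a b) →
    (E.card : ℝ) ≤ η * (Fintype.card V : ℝ) ^ 2 := by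
  set ε : ℝ := min (η / (3 * (5 * t + 7))) 1 with hε
  have hε0 : 0 < ε := by positivity
  have hδ := SimpleGraph.triangleRemovalBound_pos hε0
  set δ := SimpleGraph.triangleRemovalBound ε
  refine ⟨⌈(25 * t + 1) / δ⌉₊ + 1, fun V _ _ H E hN hH hfree hEH hthin => ?_⟩
  set n := Fintype.card V with hn
  have hNR : (25 * t + 1) / δ < (n : ℝ) := by
    refine (Nat.le_ceil _).trans_lt ?_
    exact_mod_cast hN
  have hn0 : (0 : ℝ) < n := lt_of_le_of_lt (by positivity) hNR
  obtain ⟨L, hLE, hlin, hcard⟩ := exists_linear_subfamily hH hEH hthin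
  have hL3 : ∀ e ∈ L, e.card = 3 := fun e he => hH e (hEH (hLE he))
  have hLfree : ¬ ContainsFanExp t L := fun h => hfree (h.mono (hLE.trans hEH))
  have hLsmall : (L.card : ℝ) ≤ ε * (n : ℝ) ^ 2 := by
    by_contra hcon
    push Not at hcon
    have hfar : (shadowGraph L).FarFromTriangleFree ε := by
      refine SimpleGraph.farFromTriangleFree_of_disjoint_triangles L ?_ ?_ ?_
      · intro e he
        rw [SimpleGraph.mem_cliqueFinset_iff, SimpleGraph.is3Clique_iff]
        obtain ⟨x, y, z, h1, h2, h3, rfl⟩ := Finset.card_eq_three.1 (hL3 e he)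
        exact ⟨x, y, z, ⟨h1, _, he, by simp, by simp⟩, ⟨h2, _, he, by simp, by simp⟩,
          ⟨h3, _, he, by simp, by simp⟩, rfl⟩
      · intro e he f hf hef a ha b hb
        by_contra hab
        exact hef (hlin e he f hf a b hab ha.1 hb.1 ha.2 hb.2)
      · push_cast
        exact hcon.le
    have h1 := hfar.le_card_cliqueFinset
    have h2 : (((shadowGraph L).cliqueFinset 3).card : ℝ) ≤ (25 * t + 1) * (n : ℝ) ^ 2 := by
      exact_mod_cast card_shadow_triangles_le hL3 hlin hLfree
    have h3 : δ * (n : ℝ) ^ 3 ≤ (25 * t + 1) * (n : ℝ) ^ 2 := by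
      refine le_trans ?_ h2
      exact_mod_cast h1
    rw [div_lt_iff₀ hδ] at hNR
    have : (25 * t + 1) * (n : ℝ) ^ 2 < n * δ * (n : ℝ) ^ 2 := by gcongr
    nlinarith
  have hcR : (E.card : ℝ) ≤ L.card * (3 * (5 * t + 7)) := by exact_mod_cast hcard
  calc (E.card : ℝ) ≤ L.card * (3 * (5 * t + 7)) := hcR
    _ ≤ (η / (3 * (5 * t + 7)) * (n : ℝ) ^ 2) * (3 * (5 * t + 7)) := by
      gcongr
      refine hLsmall.trans ?_
      gcongr
      exact min_le_left _ _
    _ = η * (n : ℝ) ^ 2 := by field_simp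

/-- The weight of a vertex of degree `k` in a link: `0, D - 1, D, D, …`. -/
def linkWeight (D k : ℕ) : ℕ := if k = 0 then 0 else if k = 1 then D - 1 else D

theorem linkWeight_mono (D : ℕ) : Monotone (linkWeight D) := by
  intro a b hab
  unfold linkWeight
  split_ifs <;> omega

theorem mul_sum_degree_le {V : Type*} [Fintype V] (R : V → V → Prop)
    [DecidableRel R] (hsymm : ∀ x y, R x y → R y x)
    (hP : ∀ p x y q, R p x → R x y → R y q → p ≠ y → x ≠ q → p = q) (D : ℕ) (hD : 2 ≤ D)
    (hdeg : ∀ x, (Finset.univ.filter (R x)).card ≤ D) :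
    D * ∑ x, (Finset.univ.filter (R x)).card ≤
      2 * ∑ x, linkWeight D (Finset.univ.filter (R x)).card := by
  set d : V → ℕ := fun x => (Finset.univ.filter (R x)).card with hd
  let h : V → ℚ := fun x => linkWeight D (d x) / d x
  have hDQ : (2 : ℚ) ≤ D := by exact_mod_cast hD
  have hone : ∀ x y, R x y → 1 ≤ d x := fun x y hxy => Finset.card_pos.2 ⟨y, by simp [hxy]⟩
  have htwo : ∀ x y, R x y → 2 ≤ d x → ∃ p, R x p ∧ p ≠ y := by
    intro x y hxy h2
    obtain ⟨p, hp, hpy⟩ := Finset.exists_mem_ne (show 1 < d x from h2) y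
    exact ⟨p, (Finset.mem_filter.1 hp).2, hpy⟩
  have hle : ∀ x y, R x y → 2 ≤ d x → 2 ≤ d y → d x = 2 := by
    intro x y hxy hx hy
    obtain ⟨q, hyq, hqx⟩ := htwo y x (hsymm _ _ hxy) hy
    refine le_antisymm ?_ hx
    classical
    refine (Finset.card_le_card (t := {y, q}) ?_).trans Finset.card_le_two
    intro p hp
    simp only [Finset.mem_filter, Finset.mem_univ, true_and, Finset.mem_insert,
      Finset.mem_singleton] at hp ⊢
    by_cases hpy : p = y
    · exact Or.inl hpy
    · exact Or.inr (hP p x y q (hsymm _ _ hp) hxy hyq hpy hqx.symm)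
  have hedge : ∀ x y, R x y → (D : ℚ) ≤ h x + h y := by
    have hw : ∀ x y, R x y → d x = 1 → (D : ℚ) ≤ h x + h y := by
      intro x y hxy hx
      have hhx : h x = D - 1 := by
        simp only [h, hx, linkWeight]
        simp
        rw [Nat.cast_sub (by omega)]; simp
      have hy := hone y x (hsymm _ _ hxy)
      have hhy : 1 ≤ h y := by
        by_cases hy1 : d y = 1
        · simp only [h, hy1, linkWeight]
          simp
          omega
        · have : linkWeight D (d y) = D := by
            unfold linkWeight; rw [if_neg (by omega), if_neg hy1]
          simp only [h, this]
          rw [le_div_iff₀ (by exact_mod_cast hy), one_mul]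
          exact_mod_cast hdeg y
      rw [hhx]; linarith
    intro x y hxy
    have hyx := hsymm _ _ hxy
    rcases (hone x y hxy).eq_or_lt with hx | hx
    · exact hw x y hxy hx.symm
    rcases (hone y x hyx).eq_or_lt with hy | hy
    · rw [add_comm]; exact hw y x hyx hy.symm
    have h1 := hle x y hxy hx hy
    have h2 := hle y x hyx hy hx
    simp only [h, h1, h2, linkWeight]
    norm_num
  have hsum : ∑ x, ∑ y ∈ Finset.univ.filter (R x), (D : ℚ) ≤
      ∑ x, ∑ y ∈ Finset.univ.filter (R x), (h x + h y) := by
    refine Finset.sum_le_sum fun x _ => Finset.sum_le_sum fun y hy => hedge x y ?_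
    exact (Finset.mem_filter.1 hy).2
  have hxs : ∀ x, ∑ y ∈ Finset.univ.filter (R x), h x = linkWeight D (d x) := by
    intro x
    rw [Finset.sum_const, nsmul_eq_mul]
    change (d x : ℚ) * (linkWeight D (d x) / d x) = _
    rcases Nat.eq_zero_or_pos (d x) with h0 | h0
    · simp [h0, linkWeight]
    · have : (d x : ℚ) ≠ 0 := by positivity
      field_simp
  have hswap : ∑ x, ∑ y ∈ Finset.univ.filter (R x), h y =
      ∑ x, ∑ y ∈ Finset.univ.filter (R x), h x := by
    refine Finset.sum_comm' ?_
    intro x y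
    simp only [Finset.mem_univ, Finset.mem_filter, true_and, and_true]
    exact ⟨hsymm x y, hsymm y x⟩
  simp only [Finset.sum_add_distrib, hswap] at hsum
  simp only [hxs, Finset.sum_const, nsmul_eq_mul] at hsum
  rw [← Finset.sum_mul] at hsum
  have : (D : ℚ) * ∑ x, (d x : ℚ) ≤ 2 * ∑ x, (linkWeight D (d x) : ℚ) := by
    rw [mul_comm]; linarith
  exact_mod_cast this

section Link

open scoped Classical in
/-- The completions `w` of `x, y` forming thick pairs with both. -/
noncomputable def apex {V : Type*} [Fintype V] [DecidableEq V] (t : ℕ) (H : Finset (Finset V))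
    (x y : V) : Finset V :=
  Finset.univ.filter fun w => ({x, y, w} : Finset V) ∈ H ∧ Thick t H x w ∧ Thick t H y w

open scoped Classical in
/-- The neighbours of `x` in the graph of thick pairs in the link of `z`
whose other two pairs are thin. -/
noncomputable def lk {V : Type*} [Fintype V] [DecidableEq V] (t : ℕ) (H : Finset (Finset V))
    (z x : V) : Finset V :=
  Finset.univ.filter fun w => ({z, x, w} : Finset V) ∈ H ∧ Thick t H x w ∧ ¬ Thick t H z x ∧
    ¬ Thick t H z w

variable {V : Type*} [Fintype V] [DecidableEq V] {H : Finset (Finset V)} {t : ℕ}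

theorem mem_apex {x y w : V} :
    w ∈ apex t H x y ↔ ({x, y, w} : Finset V) ∈ H ∧ Thick t H x w ∧ Thick t H y w := by
  simp [apex]

theorem mem_lk {z x w : V} : w ∈ lk t H z x ↔ ({z, x, w} : Finset V) ∈ H ∧ Thick t H x w ∧
    ¬ Thick t H z x ∧ ¬ Thick t H z w := by
  simp [lk]

theorem mem_lk_comm {z x w : V} : w ∈ lk t H z x ↔ x ∈ lk t H z w := by
  rw [mem_lk, mem_lk, triple_swap_right, thick_comm (x := x)]
  tauto

theorem apex_subset (x y : V) : apex t H x y ⊆ cod H x y := by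
  intro w hw
  exact mem_cod.2 (mem_apex.1 hw).1

theorem apex_comm (x y : V) : apex t H x y = apex t H y x := by
  ext w
  rw [mem_apex, mem_apex, triple_swap_left]
  tauto

theorem lk_subset (z x : V) : lk t H z x ⊆ cod H z x := by
  intro w hw
  exact mem_cod.2 (mem_lk.1 hw).1

theorem card_lk_le (z x : V) : (lk t H z x).card ≤ 5 * t + 7 := by
  by_cases h : Thick t H z x
  · have : lk t H z x = ∅ := by
      refine Finset.eq_empty_of_forall_notMem fun w hw => ?_
      exact (mem_lk.1 hw).2.2.1 h
    simp [this]
  · refine (Finset.card_le_card (lk_subset z x)).trans ?_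
    unfold Thick at h
    omega

theorem mul_sum_card_lk_le (hH : ∀ e ∈ H, e.card = 3) (hfree : ¬ ContainsFanExp t H) (z : V) :
    (5 * t + 7) * ∑ x, (lk t H z x).card ≤
      2 * ∑ x, linkWeight (5 * t + 7) (lk t H z x).card +
        (5 * t + 7) * (2 * (5 * t * (5 * t + 7))) := by
  classical
  obtain ⟨B, hB, hit⟩ := exists_hitting hfree
  set D := 5 * t + 7 with hD
  let R : V → V → Prop := fun x y => y ∈ lk t H z x ∧ x ∉ B z ∧ y ∉ B z
  have hRsub : ∀ x, Finset.univ.filter (R x) ⊆ lk t H z x := by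
    intro x y hy
    exact (Finset.mem_filter.1 hy).2.1
  have h1 := mul_sum_degree_le R
    (fun x y h => ⟨mem_lk_comm.1 h.1, h.2.2, h.2.1⟩)
    (by
      intro p x y q hpx hxy hyq hpy hxq
      by_contra hpq
      have := hit z _ (flex_thick_far hH (mem_lk.1 (mem_lk_comm.1 hpx.1)).1 (mem_lk.1 hyq.1).1
        (mem_lk.1 hxy.1).2.1 hxq hpy.symm hpq)
      apply this
      simp [hxy.2.1, hxy.2.2, hpx.2.1, hyq.2.2])
    D (by omega) (fun x => (Finset.card_le_card (hRsub x)).trans (card_lk_le z x))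
  have h2 : ∑ x, linkWeight D (Finset.univ.filter (R x)).card ≤
      ∑ x, linkWeight D (lk t H z x).card :=
    Finset.sum_le_sum fun x _ => linkWeight_mono D (Finset.card_le_card (hRsub x))
  have h3 : ∑ x, (lk t H z x).card ≤ ∑ x, (Finset.univ.filter (R x)).card +
      (∑ x, (if x ∈ B z then D else 0) + ∑ x, ((B z).filter fun b => b ∈ lk t H z x).card) := by
    rw [← Finset.sum_add_distrib, ← Finset.sum_add_distrib]
    refine Finset.sum_le_sum fun x _ => ?_
    by_cases hx : x ∈ B z
    · have := card_lk_le (H := H) (t := t) z x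
      rw [if_pos hx]; omega
    · rw [if_neg hx, zero_add]
      refine (Finset.card_le_card ?_).trans (Finset.card_union_le _ _)
      intro y hy
      simp only [Finset.mem_union, Finset.mem_filter, Finset.mem_univ, true_and, R]
      tauto
  have h4 : ∑ x, (if x ∈ B z then D else 0) ≤ 5 * t * D := by
    rw [Finset.sum_ite_mem, Finset.univ_inter, Finset.sum_const, smul_eq_mul]
    exact Nat.mul_le_mul_right _ (hB z)
  have h5 : ∑ x, ((B z).filter fun b => b ∈ lk t H z x).card ≤ 5 * t * D := by
    have := Finset.sum_card_bipartiteAbove_eq_sum_card_bipartiteBelow (s := Finset.univ)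
      (t := B z) (fun x b => b ∈ lk t H z x)
    unfold Finset.bipartiteAbove Finset.bipartiteBelow at this
    rw [this]
    refine (Finset.sum_le_card_nsmul _ _ D fun b _ => ?_).trans
      (by rw [smul_eq_mul]; exact Nat.mul_le_mul_right _ (hB z))
    refine (Finset.card_le_card ?_).trans (card_lk_le (H := H) (t := t) z b)
    intro x hx
    exact mem_lk_comm.1 (Finset.mem_filter.1 hx).2
  calc D * ∑ x, (lk t H z x).card
      ≤ D * (∑ x, (Finset.univ.filter (R x)).card + 2 * (5 * t * D)) :=
        Nat.mul_le_mul_left _ (by omega)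
    _ = D * ∑ x, (Finset.univ.filter (R x)).card + D * (2 * (5 * t * D)) := mul_add _ _ _
    _ ≤ _ := by omega

end Link

section Weights

variable {V : Type*} [Fintype V] [DecidableEq V] {H : Finset (Finset V)} {t : ℕ}

/-- A pair with exactly `t` thick completions. -/
def Perf (t : ℕ) (H : Finset (Finset V)) (x y : V) : Prop := (apex t H x y).card = t

/-- A pair of degree at least two in the link graphs of both of its vertices; relevant for
`t = 2` only. -/
def Dbl (t : ℕ) (H : Finset (Finset V)) (x y : V) : Prop :=
  t = 2 ∧ 2 ≤ (lk t H x y).card ∧ 2 ≤ (lk t H y x).card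

/-- A thin pair in a hyperedge with two thick pairs, of codegree exceeding `t`. -/
def Plus (t : ℕ) (H : Finset (Finset V)) (x y : V) : Prop :=
  ¬ Thick t H x y ∧ 1 ≤ (apex t H x y).card ∧ t + 1 ≤ (cod H x y).card

open scoped Classical in
/-- The share of a pair in the weighted count of hyperedges. -/
noncomputable def pairWeight (t : ℕ) (H : Finset (Finset V)) (x y : V) : ℕ :=
  (5 * t + 7) * (if Thick t H x y then 0 else (apex t H x y).card) +
    (linkWeight (5 * t + 7) (lk t H x y).card + linkWeight (5 * t + 7) (lk t H y x).card)

theorem linkWeight_le (D k : ℕ) : linkWeight D k ≤ D := by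
  unfold linkWeight
  split_ifs <;> omega

theorem linkWeight_le_mul {D k : ℕ} (hD : 1 ≤ D) :
    linkWeight D k + (if k = 0 then 0 else 1) ≤ D * k := by
  unfold linkWeight
  rcases Nat.eq_zero_or_pos k with h | h
  · simp [h]
  by_cases h1 : k = 1
  · simp [h1]; omega
  · rw [if_neg (by omega), if_neg h1, if_neg (by omega)]
    have : D * 2 ≤ D * k := Nat.mul_le_mul_left _ (by omega)
    omega

theorem weight_bound {t a k l c : ℕ} (ht : 2 ≤ t) (h : a + k + l ≤ c) (hc : c ≤ 5 * t + 7) :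
    (5 * t + 7) * a + (linkWeight (5 * t + 7) k + linkWeight (5 * t + 7) l) +
      (if a ≠ t ∧ ¬ (t = 2 ∧ 2 ≤ k ∧ 2 ≤ l) then 1 else 0) ≤
    (5 * t + 7) * t +
      (if 1 ≤ a ∧ t + 1 ≤ c then 3 * (5 * t + 7) * (5 * t + 7) else 0) := by
  set D := 5 * t + 7 with hD
  have hDt : D * 2 ≤ D * t := Nat.mul_le_mul_left _ ht
  have hk := linkWeight_le D k
  have hl := linkWeight_le D l
  by_cases hplus : 1 ≤ a ∧ t + 1 ≤ c
  · rw [if_pos hplus]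
    have h1 : D * a ≤ D * D := Nat.mul_le_mul_left _ (by omega)
    have h2 : D * 1 ≤ D * D := Nat.mul_le_mul_left _ (by omega)
    have : 3 * D * D = D * D + D * D + D * D := by ring
    split_ifs <;> omega
  rw [if_neg hplus]
  rcases Nat.eq_zero_or_pos a with ha | ha
  · subst ha
    split_ifs with hex
    · by_cases ht2 : t = 2
      · have : linkWeight D k + linkWeight D l + 1 ≤ D * 2 := by
          unfold linkWeight
          split_ifs <;> omega
        omega
      · have : D * 3 ≤ D * t := Nat.mul_le_mul_left _ (by omega)
        omega
    · omega
  · have hct : c ≤ t := by omega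
    have h1 := linkWeight_le_mul (D := D) (k := k) (by omega)
    have h2 := linkWeight_le_mul (D := D) (k := l) (by omega)
    have h3 : D * (a + k + l) ≤ D * t := Nat.mul_le_mul_left _ (by omega)
    rw [mul_add, mul_add] at h3
    split_ifs with hex
    · rcases Nat.eq_zero_or_pos k with hk0 | hk0
      · rcases Nat.eq_zero_or_pos l with hl0 | hl0
        · subst hk0 hl0
          have h4 : D * (a + 1) ≤ D * t := Nat.mul_le_mul_left _ (by omega)
          rw [mul_add] at h4
          simp only [linkWeight, if_true]
          omega
        · rw [if_neg (by omega)] at h2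
          omega
      · rw [if_neg (by omega)] at h1
        omega
    · omega

open scoped Classical in
theorem pairWeight_le (ht : 2 ≤ t) (x y : V) :
    pairWeight t H x y + (if ¬ Perf t H x y ∧ ¬ Dbl t H x y then 1 else 0) ≤
      (5 * t + 7) * t +
        (if Plus t H x y then 3 * (5 * t + 7) * (5 * t + 7) else 0) := by
  by_cases hxy : Thick t H x y
  · have h1 : lk t H x y = ∅ :=
      Finset.eq_empty_of_forall_notMem fun w hw => (mem_lk.1 hw).2.2.1 hxy
    have h2 : lk t H y x = ∅ :=
      Finset.eq_empty_of_forall_notMem fun w hw => (mem_lk.1 hw).2.2.1 hxy.symm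
    rw [pairWeight, if_pos hxy, h1, h2]
    simp only [Finset.card_empty, linkWeight, if_true]
    have : (5 * t + 7) * 2 ≤ (5 * t + 7) * t := Nat.mul_le_mul_left _ ht
    split_ifs <;> omega
  · have h := weight_bound (t := t) (a := (apex t H x y).card) (k := (lk t H x y).card)
      (l := (lk t H y x).card) (c := (cod H x y).card) ht (by
        rw [← Finset.card_union_of_disjoint, ← Finset.card_union_of_disjoint]
        · refine Finset.card_le_card ?_
          refine Finset.union_subset (Finset.union_subset (apex_subset _ _) (lk_subset _ _)) ?_
          rw [cod_comm]
          exact lk_subset _ _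
        · rw [Finset.disjoint_left]
          intro w hw hw'
          rw [Finset.mem_union, mem_apex, mem_lk] at hw
          rw [mem_lk] at hw'
          tauto
        · rw [Finset.disjoint_left]
          intro w hw hw'
          rw [mem_apex] at hw
          rw [mem_lk] at hw'
          tauto) (by unfold Thick at hxy; omega)
    rw [pairWeight, if_neg hxy]
    have e : Plus t H x y ↔ 1 ≤ (apex t H x y).card ∧ t + 1 ≤ (cod H x y).card := by
      unfold Plus; tauto
    simp only [e]
    convert h using 2
    exact if_congr Iff.rfl rfl rfl

theorem two_mul_card_le_sum {E : Finset (Finset V)} (F : V → V → Finset V)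
    (hE : ∀ e ∈ E, ∃ x y z x' y' z' : V, (x, y, z) ≠ (x', y', z') ∧ e = {x, y, z} ∧
      e = {x', y', z'} ∧ z ∈ F x y ∧ z' ∈ F x' y') :
    2 * E.card ≤ ∑ x, ∑ y, (F x y).card := by
  let S : Finset (V × V × V) := Finset.univ.filter fun p => p.2.2 ∈ F p.1 p.2.1
  have hS : S.card = ∑ x, ∑ y, (F x y).card := by
    simp only [S, Finset.card_filter, Fintype.sum_prod_type]
    simp
  have := Finset.card_mul_le_card_mul (s := E) (t := S) (m := 2) (n := 1)
    (fun e p => e = {p.1, p.2.1, p.2.2}) (by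
      intro e he
      obtain ⟨x, y, z, x', y', z', hne, h1, h2, hF, hF'⟩ := hE e he
      rw [← Finset.card_pair hne]
      refine Finset.card_le_card ?_
      intro p hp
      simp only [Finset.mem_insert, Finset.mem_singleton] at hp
      rw [Finset.mem_bipartiteAbove]
      rcases hp with rfl | rfl
      · exact ⟨by simpa [S] using hF, h1⟩
      · exact ⟨by simpa [S] using hF', h2⟩) (by
      intro p _
      refine Finset.card_le_one.2 ?_
      intro a ha b hb
      rw [Finset.mem_bipartiteBelow] at ha hb
      rw [ha.2, hb.2])
  omega

theorem eq_of_thick_split (hH : ∀ e ∈ H, e.card = 3) {e : Finset V} (he : e ∈ H) :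
    (∀ a ∈ e, ∀ b ∈ e, a ≠ b → ¬ Thick t H a b) ∨
    (∃ x y z, e = {x, y, z} ∧ z ∈ lk t H x y) ∨
    (∃ x y z, e = {x, y, z} ∧ ¬ Thick t H x y ∧ z ∈ apex t H x y) ∨
    ∃ x y z, e = {x, y, z} ∧ Thick t H x y ∧ Thick t H x z ∧ Thick t H y z := by
  obtain ⟨x, y, z, hxy, hxz, hyz, rfl⟩ := Finset.card_eq_three.1 (hH e he)
  have s : ∀ a b, Thick t H a b ↔ Thick t H b a := fun a b => thick_comm
  by_cases h1 : Thick t H x y <;> by_cases h2 : Thick t H x z <;> by_cases h3 : Thick t H y z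
  · exact Or.inr (Or.inr (Or.inr ⟨x, y, z, rfl, h1, h2, h3⟩))
  · refine Or.inr (Or.inr (Or.inl ⟨y, z, x, triple_rotate _ _ _, h3, mem_apex.2 ⟨?_, ?_⟩⟩))
    · rwa [← triple_rotate]
    · exact ⟨h1.symm, h2.symm⟩
  · refine Or.inr (Or.inr (Or.inl ⟨x, z, y, triple_swap_right _ _ _, h2, mem_apex.2 ⟨?_, ?_⟩⟩))
    · rwa [triple_swap_right]
    · exact ⟨h1, h3.symm⟩
  · refine Or.inr (Or.inl ⟨z, x, y, ?_, mem_lk.2 ⟨?_, h1, fun h => h2 h.symm, fun h => h3 h.symm⟩⟩)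
    · rw [triple_rotate z]
    · rwa [triple_rotate z]
  · refine Or.inr (Or.inr (Or.inl ⟨x, y, z, rfl, h1, mem_apex.2 ⟨he, h2, h3⟩⟩))
  · refine Or.inr (Or.inl ⟨y, x, z, triple_swap_left _ _ _,
      mem_lk.2 ⟨?_, h2, fun h => h1 h.symm, h3⟩⟩)
    rwa [triple_swap_left]
  · exact Or.inr (Or.inl ⟨x, y, z, rfl, mem_lk.2 ⟨he, h3, h1, h2⟩⟩)
  · left
    intro a ha b hb hab
    simp only [Finset.mem_insert, Finset.mem_singleton] at ha hb
    rcases ha with rfl | rfl | rfl <;> rcases hb with rfl | rfl | rfl <;>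
      first | exact (hab rfl).elim | assumption | (rw [s]; assumption)

open scoped Classical in
theorem card_plus_le (hH : ∀ e ∈ H, e.card = 3) (hfree : ¬ ContainsFanExp t H) :
    (Finset.univ.filter fun p : V × V => Plus t H p.1 p.2).card ≤
      Fintype.card V * ((2 * ((2 * t + 1) * t)) * (2 * ((2 * t + 1) * t))) * 9 := by
  refine le_trans ?_ (Nat.mul_le_mul_right _ (card_heavy_le hH hfree
    (E := H.filter fun e => HeavyEdge t H e) (by simp)))
  refine (Finset.card_le_card (t := (H.filter fun e => HeavyEdge t H e).biUnion fun e => e ×ˢ e)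
    ?_).trans (Finset.card_biUnion_le_card_mul _ _ _ ?_)
  · intro p hp
    obtain ⟨h1, h2, h3⟩ := (Finset.mem_filter.1 hp).2
    obtain ⟨w, hw⟩ := Finset.card_pos.1 h2
    rw [mem_apex] at hw
    refine Finset.mem_biUnion.2 ⟨{p.1, p.2, w}, Finset.mem_filter.2 ⟨hw.1, hw.1, p.1, p.2, w, rfl,
      hw.2.1, hw.2.2, h3⟩, ?_⟩
    simp [Finset.mem_product]
  · intro e he
    rw [Finset.card_product, hH e (Finset.mem_filter.1 he).1]

end Weights

open scoped Classical in
theorem exists_weighted_count (t : ℕ) (ht : 2 ≤ t) : ∃ C : ℕ, ∀ (V : Type) [Fintype V]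
    [DecidableEq V] (H : Finset (Finset V)), (∀ e ∈ H, e.card = 3) → ¬ ContainsFanExp t H →
    2 * (5 * t + 7) * H.card +
      (Finset.univ.filter fun p : V × V => ¬ Perf t H p.1 p.2 ∧ ¬ Dbl t H p.1 p.2).card ≤
    2 * (5 * t + 7) *
      (H.filter fun e => ∀ a ∈ e, ∀ b ∈ e, a ≠ b → ¬ Thick t H a b).card +
    (5 * t + 7) * t * Fintype.card V ^ 2 + C * Fintype.card V := by
  set D := 5 * t + 7 with hD
  set M := (2 * t + 1) * t with hM
  refine ⟨2 * D * (5 * t * (5 * t)) + D * (2 * (5 * t * D)) +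
    3 * D * D * ((2 * M) * (2 * M) * 9), fun V _ _ H hH hfree => ?_⟩
  set n := Fintype.card V with hn
  set H0 := H.filter fun e => ∀ a ∈ e, ∀ b ∈ e, a ≠ b → ¬ Thick t H a b with hH0
  set H1 := H.filter fun e => ∃ x y z, e = {x, y, z} ∧ z ∈ lk t H x y with hH1
  set H2 := H.filter fun e => ∃ x y z, e = {x, y, z} ∧ ¬ Thick t H x y ∧ z ∈ apex t H x y with hH2
  set H3 := H.filter fun e => ∃ x y z, e = {x, y, z} ∧ Thick t H x y ∧ Thick t H x z ∧
    Thick t H y z with hH3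
  have hcover : H.card ≤ H0.card + H1.card + H2.card + H3.card := by
    have hsub : H ⊆ ((H0 ∪ H1) ∪ H2) ∪ H3 := by
      intro e he
      simp only [Finset.mem_union, hH0, hH1, hH2, hH3, Finset.mem_filter, he, true_and]
      rcases eq_of_thick_split (t := t) hH he with h | h | h | h
      · exact Or.inl (Or.inl (Or.inl h))
      · exact Or.inl (Or.inl (Or.inr h))
      · exact Or.inl (Or.inr h)
      · exact Or.inr h
    refine (Finset.card_le_card hsub).trans ((Finset.card_union_le _ _).trans ?_)
    gcongr
    refine (Finset.card_union_le _ _).trans ?_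
    gcongr
    exact Finset.card_union_le _ _
  have c3 : H3.card ≤ n * (5 * t * (5 * t)) :=
    card_thickTriangles_le hH hfree (fun e he => (Finset.mem_filter.1 he).2)
  have c1 : 2 * H1.card ≤ ∑ x, ∑ y, (lk t H x y).card := by
    refine two_mul_card_le_sum _ fun e he => ?_
    obtain ⟨heH, x, y, z, rfl, hz⟩ := Finset.mem_filter.1 he
    refine ⟨x, y, z, x, z, y, ?_, rfl, triple_swap_right _ _ _, hz, mem_lk_comm.1 hz⟩
    have := (ne_of_triple hH heH).2.2
    simp [this]
  have c2 : 2 * H2.card ≤ ∑ x, ∑ y, (if Thick t H x y then ∅ else apex t H x y).card := by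
    refine two_mul_card_le_sum (fun x y => if Thick t H x y then ∅ else apex t H x y) fun e he => ?_
    obtain ⟨heH, x, y, z, rfl, hxy, hz⟩ := Finset.mem_filter.1 he
    refine ⟨x, y, z, y, x, z, ?_, rfl, triple_swap_left _ _ _, ?_, ?_⟩
    · have := (ne_of_triple hH heH).1
      simp [this]
    · rwa [if_neg hxy]
    · rw [if_neg fun h => hxy h.symm]
      rwa [apex_comm]
  have c2' : ∀ x y : V, (if Thick t H x y then ∅ else apex t H x y).card =
      if Thick t H x y then 0 else (apex t H x y).card := by
    intro x y; split_ifs <;> simp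
  simp only [c2'] at c2
  have c1' : D * ∑ x, ∑ y, (lk t H x y).card ≤
      2 * ∑ x, ∑ y, linkWeight D (lk t H x y).card + n * (D * (2 * (5 * t * D))) := by
    rw [Finset.mul_sum, Finset.mul_sum]
    refine (Finset.sum_le_sum fun z _ => mul_sum_card_lk_le hH hfree z).trans ?_
    rw [Finset.sum_add_distrib, Finset.sum_const, Finset.card_univ, smul_eq_mul]
  have hW : ∑ x, ∑ y, pairWeight t H x y =
      D * (∑ x, ∑ y, if Thick t H x y then 0 else (apex t H x y).card) +
        2 * ∑ x, ∑ y, linkWeight D (lk t H x y).card := by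
    simp only [pairWeight, Finset.sum_add_distrib, Finset.mul_sum, two_mul]
    congr 2
    rw [Finset.sum_comm]
  have hsum : ∑ x, ∑ y, pairWeight t H x y +
      (Finset.univ.filter fun p : V × V => ¬ Perf t H p.1 p.2 ∧ ¬ Dbl t H p.1 p.2).card ≤
      D * t * n ^ 2 +
        3 * D * D * (Finset.univ.filter fun p : V × V => Plus t H p.1 p.2).card := by
    have : ∑ p : V × V, (pairWeight t H p.1 p.2 +
        (if ¬ Perf t H p.1 p.2 ∧ ¬ Dbl t H p.1 p.2 then 1 else 0)) ≤
        ∑ p : V × V, (D * t + (if Plus t H p.1 p.2 then 3 * D * D else 0)) :=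
      Finset.sum_le_sum fun p _ => pairWeight_le ht p.1 p.2
    rw [Finset.sum_add_distrib, Finset.sum_add_distrib, ← Finset.card_filter,
      Fintype.sum_prod_type, Finset.sum_const, Finset.card_univ, Fintype.card_prod,
      ← Finset.sum_filter, Finset.sum_const, smul_eq_mul, smul_eq_mul] at this
    refine this.trans (le_of_eq ?_)
    rw [hn]; ring
  have hp := card_plus_le hH hfree
  have hp' : 3 * D * D * (Finset.univ.filter fun p : V × V => Plus t H p.1 p.2).card ≤
      3 * D * D * (n * ((2 * M) * (2 * M)) * 9) := Nat.mul_le_mul_left _ hp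
  have e1 : 2 * D * H.card ≤ 2 * D * (H0.card + H1.card + H2.card + H3.card) :=
    Nat.mul_le_mul_left _ hcover
  have e2 : D * (2 * H2.card) ≤ D * _ := Nat.mul_le_mul_left _ c2
  have e3 : D * (2 * H1.card) ≤ D * _ := Nat.mul_le_mul_left _ c1
  have e4 : 2 * D * H3.card ≤ 2 * D * (n * (5 * t * (5 * t))) := Nat.mul_le_mul_left _ c3
  have e5 : 2 * D * (H0.card + H1.card + H2.card + H3.card) =
    2 * D * H0.card + D * (2 * H1.card) + D * (2 * H2.card) + 2 * D * H3.card := by ring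
  have e6 : (2 * D * (5 * t * (5 * t)) + D * (2 * (5 * t * D)) +
    3 * D * D * ((2 * M) * (2 * M) * 9)) * n = 2 * D * (n * (5 * t * (5 * t))) +
    n * (D * (2 * (5 * t * D))) + 3 * D * D * (n * ((2 * M) * (2 * M)) * 9) := by ring
  rw [e6]
  omega

section Double

variable {V : Type*} [Fintype V] [DecidableEq V] {H : Finset (Finset V)} {t : ℕ}

theorem notMem_lk_of_thick {z x w : V} (h : Thick t H z w) : w ∉ lk t H z x :=
  fun hw => (mem_lk.1 hw).2.2.2 h

open scoped Classical in
theorem card_dbl_triangle_le (hH : ∀ e ∈ H, e.card = 3) (hfree : ¬ ContainsFanExp t H)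
    {u : Fin 2 → V} {v : V} (ht : t = 2) (hu : Thick t H (u 0) (u 1))
    (hz : ∀ i, Thick t H v (u i)) :
    (Finset.univ.filter fun x => Dbl t H x v ∧ ∀ i, Dbl t H x (u i) ∧ u i ∈ lk t H x v).card ≤
      6 * (5 * t + 7) + 3 := by
  set D := 5 * t + 7 with hD
  by_contra! hc
  set X := Finset.univ.filter fun x => Dbl t H x v ∧ ∀ i, Dbl t H x (u i) ∧ u i ∈ lk t H x v
    with hX
  have hpair : ∀ x ∈ X, ∀ i, ∃ a b, a ∈ lk t H v x ∧ b ∈ lk t H (u i) x ∧ a ≠ b := by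
    intro x hx i
    have hx' := (Finset.mem_filter.1 hx).2
    obtain ⟨a, ha⟩ := Finset.card_pos.1 (show 0 < (lk t H v x).card by have := hx'.1.2.2; omega)
    obtain ⟨b, hb, hba⟩ := Finset.exists_mem_ne
      (show 1 < (lk t H (u i) x).card by have := (hx'.2 i).1.2.2; omega) a
    exact ⟨a, b, ha, hb, hba.symm⟩
  obtain ⟨x₁, hx₁⟩ := Finset.card_pos.1 (show 0 < X.card by omega)
  obtain ⟨a₁, b₁, ha₁, hb₁, hab₁⟩ := hpair x₁ hx₁ 0
  set W : Finset V := {x₁, a₁, b₁} with hW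
  have hW3 : W.card ≤ 3 := Finset.card_le_three
  have hbad : (W ∪ W.biUnion fun w => lk t H v w ∪ lk t H (u 1) w).card ≤ 6 * D + 3 := by
    refine (Finset.card_union_le _ _).trans ?_
    have : (W.biUnion fun w => lk t H v w ∪ lk t H (u 1) w).card ≤ W.card * (D + D) :=
      Finset.card_biUnion_le_card_mul _ _ _ fun w _ =>
        (Finset.card_union_le _ _).trans (Nat.add_le_add (card_lk_le _ _) (card_lk_le _ _))
    have h2 : W.card * (D + D) ≤ 3 * (D + D) := Nat.mul_le_mul_right _ hW3
    omega
  obtain ⟨x₂, hx₂, hx₂W⟩ := exists_mem_notMem_of_card_lt (lt_of_le_of_lt hbad hc)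
  obtain ⟨a₂, b₂, ha₂, hb₂, hab₂⟩ := hpair x₂ hx₂ 1
  simp only [Finset.mem_union, Finset.mem_biUnion, not_or, not_exists, not_and] at hx₂W
  have ha₂W : a₂ ∉ W := fun h => (hx₂W.2 _ h).1 (mem_lk_comm.1 ha₂)
  have hb₂W : b₂ ∉ W := fun h => (hx₂W.2 _ h).2 (mem_lk_comm.1 hb₂)
  have hflex : ∀ x ∈ X, ∀ i a b, a ∈ lk t H v x → b ∈ lk t H (u i) x → a ≠ b →
      Flex t H v {x, u i, a, b} := by
    intro x hx i a b ha hb hab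
    refine flex_thick_near hH (mem_lk.1 ha).1 ?_ (hz i) ?_ ?_ hab
    · rw [triple_swap_left]; exact (mem_lk.1 hb).1
    · rintro rfl; exact notMem_lk_of_thick (hz i).symm hb
    · rintro rfl; exact notMem_lk_of_thick (hz i) ha
  have hux : ∀ x ∈ X, ∀ i, u i ≠ x := by
    rintro x hx i rfl
    exact (mem_lk.1 ((Finset.mem_filter.1 hx).2.2 i).2).2.2.1 (hz i).symm
  subst ht
  refine hfree (containsFanExp_of_flex (v := v)
    ![{x₁, u 0, a₁, b₁}, {x₂, u 1, a₂, b₂}] ?_ ?_)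
  · intro i
    fin_cases i
    · exact hflex x₁ hx₁ 0 a₁ b₁ ha₁ hb₁ hab₁
    · exact hflex x₂ hx₂ 1 a₂ b₂ ha₂ hb₂ hab₂
  · have key : Disjoint ({x₁, u 0, a₁, b₁} : Finset V) {x₂, u 1, a₂, b₂} := by
      have e1 : u 0 ≠ u 1 := hu.ne hH
      have e2 := hux x₁ hx₁ 1
      have e3 := hux x₂ hx₂ 0
      have e4 : u 1 ≠ a₁ := by rintro rfl; exact notMem_lk_of_thick (hz 1) ha₁
      have e5 : u 0 ≠ a₂ := by rintro rfl; exact notMem_lk_of_thick (hz 0) ha₂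
      have e6 : u 1 ≠ b₁ := by rintro rfl; exact notMem_lk_of_thick hu hb₁
      have e7 : u 0 ≠ b₂ := by rintro rfl; exact notMem_lk_of_thick hu.symm hb₂
      have e8 := hx₂W.1
      simp only [hW, Finset.mem_insert, Finset.mem_singleton, not_or] at ha₂W hb₂W e8
      simp only [Finset.disjoint_insert_left, Finset.disjoint_singleton_left, Finset.mem_insert,
        Finset.mem_singleton, not_or]
      refine ⟨⟨?_, ?_, ?_, ?_⟩, ⟨?_, ?_, ?_, ?_⟩, ⟨?_, ?_, ?_, ?_⟩, ⟨?_, ?_, ?_, ?_⟩⟩ <;>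
        first | assumption | (apply Ne.symm; tauto)
    intro i j hij
    fin_cases i <;> fin_cases j
    · exact (hij rfl).elim
    · exact key
    · exact key.symm
    · exact (hij rfl).elim

theorem card_ordered_thick_triangles_le (hH : ∀ e ∈ H, e.card = 3) (hfree : ¬ ContainsFanExp t H)
    (T : Finset (V × V × V)) (hT : ∀ p ∈ T, Thick t H p.1 p.2.1 ∧ Thick t H p.1 p.2.2 ∧
      Thick t H p.2.1 p.2.2) :
    T.card ≤ Fintype.card V * (5 * t * (5 * t)) * 27 := by
  refine le_trans ?_ (Nat.mul_le_mul_right _ (card_thickTriangles_le hH hfree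
    (E := T.image fun p => {p.1, p.2.1, p.2.2}) ?_))
  · refine (Finset.card_le_card (t := (T.image fun p => ({p.1, p.2.1, p.2.2} : Finset V)).biUnion
      fun e => e ×ˢ e ×ˢ e) ?_).trans (Finset.card_biUnion_le_card_mul _ _ _ ?_)
    · intro p hp
      refine Finset.mem_biUnion.2 ⟨_, Finset.mem_image_of_mem _ hp, ?_⟩
      simp [Finset.mem_product]
    · intro e he
      obtain ⟨p, hp, rfl⟩ := Finset.mem_image.1 he
      have : ({p.1, p.2.1, p.2.2} : Finset V).card ≤ 3 := Finset.card_le_three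
      rw [Finset.card_product, Finset.card_product]
      calc _ ≤ 3 * (3 * 3) := Nat.mul_le_mul this (Nat.mul_le_mul this this)
        _ = 27 := rfl
  · intro e he
    obtain ⟨p, hp, rfl⟩ := Finset.mem_image.1 he
    exact ⟨_, _, _, rfl, hT p hp⟩

open scoped Classical in
theorem card_dbl_le (hH : ∀ e ∈ H, e.card = 3) (hfree : ¬ ContainsFanExp t H) :
    (Finset.univ.filter fun p : V × V => Dbl t H p.1 p.2).card ≤
      ((Finset.univ.filter fun p : V × V => ¬ Perf t H p.1 p.2 ∧ ¬ Dbl t H p.1 p.2).card +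
        (Finset.univ.filter fun p : V × V => Plus t H p.1 p.2).card) * (5 * t + 7) +
      Fintype.card V * (5 * t * (1 + (5 * t + 7) + (5 * t + 7) * (5 * t + 7))) +
      Fintype.card V * (5 * t * (5 * t)) * 27 * (6 * (5 * t + 7) + 3) := by
  obtain ⟨B, hB, hit⟩ := exists_hitting hfree
  set D := 5 * t + 7 with hD
  set X0 := Finset.univ.filter fun p : V × V => ¬ Perf t H p.1 p.2 ∧ ¬ Dbl t H p.1 p.2
  set X1 := Finset.univ.filter fun p : V × V => Plus t H p.1 p.2
  set N : V → Finset V := fun x => B x ∪ (B x).biUnion (lk t H x) ∪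
    ((B x).biUnion (lk t H x)).biUnion (lk t H x) with hN
  set T := Finset.univ.filter fun p : V × V × V => t = 2 ∧ Thick t H p.1 p.2.1 ∧
    Thick t H p.1 p.2.2 ∧ Thick t H p.2.1 p.2.2 with hT
  set Y : V × V × V → Finset V := fun p => Finset.univ.filter fun x => Dbl t H x p.1 ∧
    ∀ i, Dbl t H x (![p.2.1, p.2.2] i) ∧ ![p.2.1, p.2.2] i ∈ lk t H x p.1 with hY
  have hsub : (Finset.univ.filter fun p : V × V => Dbl t H p.1 p.2) ⊆
      ((X0 ∪ X1).biUnion fun p => (lk t H p.1 p.2).image fun z => (p.1, z)) ∪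
      (Finset.univ.biUnion fun x => (N x).image fun z => (x, z)) ∪
      (T.biUnion fun p => (Y p).image fun x => (x, p.1)) := by
    rintro ⟨x, z⟩ hp
    have hp := (Finset.mem_filter.1 hp).2
    have ht : t = 2 := hp.1
    simp only [Finset.mem_union, Finset.mem_biUnion, Finset.mem_image, Finset.mem_univ, true_and,
      Prod.mk.injEq]
    by_cases h1 : ∃ u ∈ lk t H x z, ¬ Dbl t H x u
    · obtain ⟨u, hu, hd⟩ := h1
      have hzu := mem_lk_comm.1 hu
      refine Or.inl (Or.inl ⟨(x, u), ?_, z, hzu, rfl, rfl⟩)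
      by_cases hperf : Perf t H x u
      · right
        refine Finset.mem_filter.2 ⟨Finset.mem_univ _, (mem_lk.1 hu).2.2.2, ?_, ?_⟩
        · unfold Perf at hperf; simp only; omega
        · have hz : z ∉ apex t H x u := fun h => (mem_lk.1 hu).2.2.1 (mem_apex.1 h).2.1
          unfold Perf at hperf
          rw [← hperf, ← Finset.card_insert_of_notMem hz]
          exact Finset.card_le_card (Finset.insert_subset (lk_subset _ _ hzu) (apex_subset _ _))
      · left
        exact Finset.mem_filter.2 ⟨Finset.mem_univ _, hperf, hd⟩
    push Not at h1
    obtain ⟨u₁, hu₁, u₂, hu₂, hne⟩ := Finset.one_lt_card.1 (show 1 < (lk t H x z).card from hp.2.1)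
    by_cases h2 : ∃ w ∈ lk t H x u₁, w ≠ z ∧ w ≠ u₂
    · obtain ⟨w, hw, hwz, hwu⟩ := h2
      left; right
      refine ⟨x, z, ?_, rfl, rfl⟩
      have hflex := flex_thick_far hH (mem_lk.1 hw).1 (mem_lk.1 hu₂).1 (mem_lk.1 hu₁).2.1.symm
        hne hwz.symm hwu
      obtain ⟨b, hb, hbB⟩ := Finset.not_disjoint_iff.1 (hit x _ hflex)
      simp only [Finset.mem_insert, Finset.mem_singleton] at hb
      simp only [hN, Finset.mem_union, Finset.mem_biUnion]
      rcases hb with rfl | rfl | rfl | rfl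
      · exact Or.inl (Or.inr ⟨_, hbB, mem_lk_comm.1 hu₁⟩)
      · exact Or.inl (Or.inl hbB)
      · exact Or.inr ⟨_, ⟨_, hbB, mem_lk_comm.1 hw⟩, mem_lk_comm.1 hu₁⟩
      · exact Or.inl (Or.inr ⟨_, hbB, mem_lk_comm.1 hu₂⟩)
    push Not at h2
    obtain ⟨w, hw, hwz⟩ := Finset.exists_mem_ne
      (show 1 < (lk t H x u₁).card from (h1 u₁ hu₁).2.1) z
    obtain rfl := h2 w hw hwz
    right
    refine ⟨(z, u₁, w), ?_, x, ?_, rfl, rfl⟩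
    · exact Finset.mem_filter.2 ⟨Finset.mem_univ _, ht, (mem_lk.1 hu₁).2.1, (mem_lk.1 hu₂).2.1,
        (mem_lk.1 hw).2.1⟩
    · refine Finset.mem_filter.2 ⟨Finset.mem_univ _, hp, fun i => ?_⟩
      fin_cases i
      · exact ⟨h1 _ hu₁, hu₁⟩
      · exact ⟨h1 _ hu₂, hu₂⟩
  refine (Finset.card_le_card hsub).trans ((Finset.card_union_le _ _).trans (Nat.add_le_add
    ((Finset.card_union_le _ _).trans (Nat.add_le_add ?_ ?_)) ?_))
  · refine (Finset.card_biUnion_le_card_mul _ _ D fun p _ =>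
      Finset.card_image_le.trans (card_lk_le _ _)).trans ?_
    exact Nat.mul_le_mul_right _ (Finset.card_union_le _ _)
  · refine Finset.card_biUnion_le_card_mul _ _ _ fun x _ => Finset.card_image_le.trans ?_
    have c1 : ((B x).biUnion (lk t H x)).card ≤ 5 * t * D :=
      (Finset.card_biUnion_le_card_mul _ _ D fun _ _ => card_lk_le _ _).trans
        (Nat.mul_le_mul_right _ (hB x))
    have c2 : (((B x).biUnion (lk t H x)).biUnion (lk t H x)).card ≤ 5 * t * D * D :=
      (Finset.card_biUnion_le_card_mul _ _ D fun _ _ => card_lk_le _ _).trans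
        (Nat.mul_le_mul_right _ c1)
    calc (N x).card ≤ 5 * t + 5 * t * D + 5 * t * D * D :=
          (Finset.card_union_le _ _).trans (Nat.add_le_add ((Finset.card_union_le _ _).trans
            (Nat.add_le_add (hB x) c1)) c2)
      _ = _ := by ring
  · refine (Finset.card_biUnion_le_card_mul _ _ (6 * D + 3) fun p hp => ?_).trans
      (Nat.mul_le_mul_right _ (card_ordered_thick_triangles_le hH hfree T ?_))
    · obtain ⟨ht, h1, h2, h3⟩ := (Finset.mem_filter.1 hp).2
      refine Finset.card_image_le.trans ?_
      refine card_dbl_triangle_le hH hfree (u := ![p.2.1, p.2.2]) ht h3 ?_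
      intro i
      fin_cases i
      · exact h1
      · exact h2
    · intro p hp
      exact (Finset.mem_filter.1 hp).2.2

end Double

open scoped Classical in
theorem card_not_perf_le (t : ℕ) (ht : 2 ≤ t) (C₁ : ℕ) {ε : ℝ} (hε : 0 < ε) : ∃ N : ℕ,
    ∀ (V : Type) [Fintype V] [DecidableEq V] (H : Finset (Finset V)), N ≤ Fintype.card V →
    (∀ e ∈ H, e.card = 3) → ¬ ContainsFanExp t H →
    t * Fintype.card V ^ 2 ≤ 2 * H.card + C₁ * Fintype.card V →
    ((Finset.univ.filter fun p : V × V => ¬ Perf t H p.1 p.2).card : ℝ) ≤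
      ε * (Fintype.card V : ℝ) ^ 2 := by
  obtain ⟨C, hC⟩ := exists_weighted_count t ht
  set D := 5 * t + 7 with hD
  have hDpos : (0 : ℝ) < D := by rw [hD]; positivity
  obtain ⟨N₀, hN₀⟩ := card_thin_le t (η := ε / (4 * D * (D + 1))) (by positivity)
  set K : ℕ := (C + D * C₁) * (D + 1) + (2 * ((2 * t + 1) * t)) * (2 * ((2 * t + 1) * t)) * 9 * D +
    5 * t * (1 + D + D * D) + 5 * t * (5 * t) * 27 * (6 * D + 3) with hK
  refine ⟨max N₀ ⌈2 * K / ε⌉₊, fun V _ _ H hN hH hfree hlow => ?_⟩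
  set n := Fintype.card V with hn
  have h0 := hN₀ V H (H.filter fun e => ∀ a ∈ e, ∀ b ∈ e, a ≠ b → ¬ Thick t H a b)
    (le_of_max_le_left hN) hH hfree (Finset.filter_subset _ _)
    (fun e he => (Finset.mem_filter.1 he).2)
  have h1 := hC V H hH hfree
  have h2 := card_dbl_le hH hfree
  have h3 := card_plus_le hH hfree
  have h4 : (Finset.univ.filter fun p : V × V => ¬ Perf t H p.1 p.2).card ≤
      (Finset.univ.filter fun p : V × V => ¬ Perf t H p.1 p.2 ∧ ¬ Dbl t H p.1 p.2).card +
      (Finset.univ.filter fun p : V × V => Dbl t H p.1 p.2).card := by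
    refine (Finset.card_le_card ?_).trans (Finset.card_union_le _ _)
    intro p
    simp only [Finset.mem_filter, Finset.mem_univ, true_and, Finset.mem_union]
    tauto
  rw [← hn, ← hD] at *
  set A := (Finset.univ.filter fun p : V × V => ¬ Perf t H p.1 p.2).card
  set X := (Finset.univ.filter fun p : V × V => ¬ Perf t H p.1 p.2 ∧ ¬ Dbl t H p.1 p.2).card
  set Y := (Finset.univ.filter fun p : V × V => Dbl t H p.1 p.2).card
  set P := (Finset.univ.filter fun p : V × V => Plus t H p.1 p.2).card
  set E := (H.filter fun e => ∀ a ∈ e, ∀ b ∈ e, a ≠ b → ¬ Thick t H a b).card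
  have hnR : 2 * K / ε ≤ n := (Nat.le_ceil _).trans (by exact_mod_cast le_of_max_le_right hN)
  rw [div_le_iff₀ hε] at hnR
  have hX : X ≤ 2 * D * E + (C + D * C₁) * n := by nlinarith [Nat.mul_le_mul_left D hlow]
  have hA : A ≤ 2 * D * (D + 1) * E + K * n := by
    calc A ≤ X + ((X + P) * D + n * (5 * t * (1 + D + D * D)) +
          n * (5 * t * (5 * t)) * 27 * (6 * D + 3)) := h4.trans (Nat.add_le_add_left h2 _)
      _ = X * (D + 1) + (P * D + n * (5 * t * (1 + D + D * D)) +
          n * (5 * t * (5 * t)) * 27 * (6 * D + 3)) := by ring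
      _ ≤ (2 * D * E + (C + D * C₁) * n) * (D + 1) +
          (n * ((2 * ((2 * t + 1) * t)) * (2 * ((2 * t + 1) * t))) * 9 * D +
            n * (5 * t * (1 + D + D * D)) + n * (5 * t * (5 * t)) * 27 * (6 * D + 3)) := by gcongr
      _ = _ := by rw [hK]; ring
  have hAR : (A : ℝ) ≤ 2 * D * (D + 1) * E + K * n := by exact_mod_cast hA
  have hE : 2 * D * (D + 1) * (E : ℝ) ≤ ε / 2 * n ^ 2 := by
    calc 2 * D * (D + 1) * (E : ℝ) ≤ 2 * D * (D + 1) * (ε / (4 * D * (D + 1)) * n ^ 2) := by gcongr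
      _ = _ := by field_simp; ring
  have : (K : ℝ) * n ≤ ε / 2 * n ^ 2 := by nlinarith [(Nat.cast_nonneg n : (0 : ℝ) ≤ n)]
  linarith

theorem sum_card_filter_eq {α β : Type*} (A : Finset α) (B : Finset β) (R : α → β → Prop)
    [∀ a, DecidablePred (R a)] [DecidablePred fun p : α × β => R p.1 p.2] :
    ∑ a ∈ A, (B.filter (R a)).card = ((A ×ˢ B).filter fun p => R p.1 p.2).card := by
  rw [Finset.card_filter, Finset.sum_product]
  refine Finset.sum_congr rfl fun a _ => ?_
  rw [Finset.card_filter]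
  exact Finset.sum_congr rfl fun b _ => if_congr Iff.rfl rfl rfl

open scoped Classical in
theorem exists_disjoint_pairs {V : Type*} [Fintype V] [DecidableEq V] (R : V → V → Prop) (k : ℕ)
    (U : Finset V) (h : 2 * Fintype.card V * (U.card + 2 * k) <
      (Finset.univ.filter fun p : V × V => R p.1 p.2).card) :
    ∃ J : Finset (V × V), J.card = k ∧ (∀ p ∈ J, R p.1 p.2) ∧
      (∀ p ∈ J, ∀ q ∈ J, p ≠ q → Disjoint ({p.1, p.2} : Finset V) {q.1, q.2}) ∧
      ∀ p ∈ J, Disjoint ({p.1, p.2} : Finset V) U := by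
  rcases exists_disjoint_or_hitting
    (fun A : Finset V => ∃ x y, A = {x, y} ∧ R x y ∧ Disjoint A U) k
    with ⟨f, hf, hd⟩ | ⟨s, hs, hF, hit⟩
  · choose x y hfe hR hU using hf
    have hinj : Function.Injective fun i => (x i, y i) := by
      intro i j hij
      by_contra hne
      have := hd i j hne
      simp only [Prod.mk.injEq] at hij
      rw [hfe, hfe, hij.1, Finset.disjoint_left] at this
      exact this (Finset.mem_insert_self _ _) (Finset.mem_insert_self _ _)
    refine ⟨Finset.univ.image fun i => (x i, y i), ?_, ?_, ?_, ?_⟩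
    · rw [Finset.card_image_of_injective _ hinj, Finset.card_univ, Fintype.card_fin]
    · intro p hp
      obtain ⟨i, -, rfl⟩ := Finset.mem_image.1 hp
      exact hR i
    · intro p hp q hq hpq
      obtain ⟨i, -, rfl⟩ := Finset.mem_image.1 hp
      obtain ⟨j, -, rfl⟩ := Finset.mem_image.1 hq
      have := hd i j fun h => hpq (by rw [h])
      rwa [hfe, hfe] at this
    · intro p hp
      obtain ⟨i, -, rfl⟩ := Finset.mem_image.1 hp
      have := hU i
      rwa [hfe] at this
  · exfalso
    set W := U ∪ s.biUnion id with hW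
    have hWc : W.card ≤ U.card + 2 * k := by
      refine (Finset.card_union_le _ _).trans (Nat.add_le_add_left ?_ _)
      refine (Finset.card_biUnion_le_card_mul _ _ 2 fun A hA => ?_).trans (by omega)
      obtain ⟨x, y, rfl, -⟩ := hF A hA
      exact Finset.card_le_two
    have hsub : (Finset.univ.filter fun p : V × V => R p.1 p.2) ⊆
        W ×ˢ Finset.univ ∪ Finset.univ ×ˢ W := by
      intro p hp
      have hR := (Finset.mem_filter.1 hp).2
      have hmeet : ¬ Disjoint ({p.1, p.2} : Finset V) W := by
        by_cases hU : Disjoint ({p.1, p.2} : Finset V) U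
        · intro hdis
          exact hit _ ⟨_, _, rfl, hR, hU⟩ (hdis.mono_right Finset.subset_union_right)
        · exact fun hdis => hU (hdis.mono_right Finset.subset_union_left)
      obtain ⟨w, hw, hwW⟩ := Finset.not_disjoint_iff.1 hmeet
      simp only [Finset.mem_insert, Finset.mem_singleton] at hw
      simp only [Finset.mem_union, Finset.mem_product, Finset.mem_univ, true_and, and_true]
      rcases hw with rfl | rfl
      · exact Or.inl hwW
      · exact Or.inr hwW
    have := (Finset.card_le_card hsub).trans (Finset.card_union_le _ _)
    rw [Finset.card_product, Finset.card_product, Finset.card_univ] at this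
    have h2 := Nat.mul_le_mul_left (2 * Fintype.card V) hWc
    have h3 : 2 * Fintype.card V * W.card = W.card * Fintype.card V + Fintype.card V * W.card := by
      ring
    omega

open scoped Classical in
theorem exists_common_neighbours {V : Type*} [Fintype V] [DecidableEq V] (R : V → V → Prop)
    (T : Finset V) (D : ℕ) (hD : 0 < D * Fintype.card V)
    (hdeg : ∀ a ∈ T, 2 * D * Fintype.card V ≤ T.card * (Finset.univ.filter (R a)).card) :
    T.card = 0 ∨ ∃ S ⊆ T, D ≤ S.card ∧ D * Fintype.card V ≤
      T.card * 2 ^ T.card * (Finset.univ.filter fun z => ∀ a ∈ S, R a z).card := by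
  set K := T.card with hK
  rcases Nat.eq_zero_or_pos K with hK0 | hK0
  · exact Or.inl hK0
  right
  let sig : V → Finset V := fun z => T.filter fun a => R a z
  have hsum : ∑ z, (sig z).card = ∑ a ∈ T, (Finset.univ.filter (R a)).card :=
    (Finset.sum_card_bipartiteAbove_eq_sum_card_bipartiteBelow (s := T) (t := Finset.univ) R).symm
  set Z := Finset.univ.filter fun z => D ≤ (sig z).card with hZ
  have h1 : K * (2 * D * Fintype.card V) ≤ K * ∑ z, (sig z).card := by
    rw [hsum, Finset.mul_sum, hK, ← smul_eq_mul, ← Finset.sum_const]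
    exact Finset.sum_le_sum hdeg
  have h1' := Nat.le_of_mul_le_mul_left h1 hK0
  have h2 : ∑ z, (sig z).card ≤ Fintype.card V * D + Z.card * K := by
    calc ∑ z, (sig z).card ≤ ∑ z, (D + if z ∈ Z then K else 0) := by
          refine Finset.sum_le_sum fun z _ => ?_
          split_ifs with hz
          · have : (sig z).card ≤ K := Finset.card_le_card (Finset.filter_subset _ _)
            omega
          · simp only [hZ, Finset.mem_filter, Finset.mem_univ, true_and, not_le] at hz
            omega
      _ = _ := by
          rw [Finset.sum_add_distrib, Finset.sum_ite_mem, Finset.univ_inter]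
          simp
  have h3 : D * Fintype.card V ≤ Z.card * K := by
    have : 2 * D * Fintype.card V = D * Fintype.card V + Fintype.card V * D := by ring
    omega
  have hZne : Z.Nonempty := by
    rw [← Finset.card_pos]
    by_contra hc
    have : Z.card = 0 := by omega
    rw [this] at h3
    omega
  obtain ⟨S, hS, hmax⟩ := Finset.exists_max_image (Z.image sig)
    (fun S => (Z.filter fun z => sig z = S).card) (hZne.image sig)
  obtain ⟨z, hz, rfl⟩ := Finset.mem_image.1 hS
  refine ⟨sig z, Finset.filter_subset _ _, (Finset.mem_filter.1 hz).2, ?_⟩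
  have h4 := Finset.card_le_mul_card_image_of_maps_to (s := Z) (t := Z.image sig) (f := sig)
    (fun a ha => Finset.mem_image_of_mem _ ha) _ hmax
  have h5 : (Z.image sig).card ≤ 2 ^ K := by
    rw [hK, ← Finset.card_powerset]
    refine Finset.card_le_card fun A hA => ?_
    obtain ⟨w, -, rfl⟩ := Finset.mem_image.1 hA
    exact Finset.mem_powerset.2 (Finset.filter_subset _ _)
  have h6 : (Z.filter fun w => sig w = sig z).card ≤
      (Finset.univ.filter fun w => ∀ a ∈ sig z, R a w).card := by
    refine Finset.card_le_card fun w hw => ?_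
    have hw' := (Finset.mem_filter.1 hw).2
    refine Finset.mem_filter.2 ⟨Finset.mem_univ _, fun a ha => ?_⟩
    rw [← hw'] at ha
    exact (Finset.mem_filter.1 ha).2
  calc D * Fintype.card V ≤ Z.card * K := h3
    _ ≤ ((Finset.univ.filter fun w => ∀ a ∈ sig z, R a w).card * 2 ^ K) * K := by
        gcongr
        exact h4.trans (Nat.mul_le_mul h6 h5)
    _ = _ := by ring

theorem containsFanExp_of_finset {V ι : Type*} [DecidableEq V] {H : Finset (Finset V)} {t : ℕ}
    {v : V} (J : Finset ι) (hJ : t ≤ J.card) (f : ι → Finset V) (hf : ∀ i ∈ J, Flex t H v (f i))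
    (hd : ∀ i ∈ J, ∀ j ∈ J, i ≠ j → Disjoint (f i) (f j)) : ContainsFanExp t H := by
  obtain ⟨J', hJ', hc⟩ := Finset.exists_subset_card_eq hJ
  let e : Fin t ≃ J' := (Fin.castOrderIso hc.symm).toEquiv.trans J'.equivFin.symm
  refine containsFanExp_of_flex (v := v) (fun i => f (e i)) (fun i => hf _ (hJ' (e i).2))
    fun i j hij => hd _ (hJ' (e i).2) _ (hJ' (e j).2) fun h => hij (e.injective (Subtype.ext h))

section Hubs

variable {V : Type*} [Fintype V] [DecidableEq V] {H : Finset (Finset V)} {t : ℕ}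

theorem flex_apex (hH : ∀ e ∈ H, e.card = 3) {y z a b : V} (ha : a ∈ apex t H y z)
    (hb : b ∈ apex t H y z) (hab : a ≠ b) : Flex t H y {z, a, b} := by
  rw [triple_swap_right]
  exact flex_near hH (mem_apex.1 ha).1 (mem_apex.1 hb).2.1 (mem_apex.1 hb).2.2 hab.symm

theorem exists_mem_apex_hitting (hH : ∀ e ∈ H, e.card = 3) (ht : 2 ≤ t) {B : V → Finset V}
    (hit : ∀ v Q, Flex t H v Q → ¬ Disjoint Q (B v)) {y z : V} (hp : Perf t H y z)
    (hz : z ∉ B y) : ∃ a ∈ apex t H y z, a ∈ B y := by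
  obtain ⟨a, ha, b, hb, hab⟩ := Finset.one_lt_card.1
    (show 1 < (apex t H y z).card by unfold Perf at hp; omega)
  obtain ⟨c, hc, hcB⟩ := Finset.not_disjoint_iff.1 (hit _ _ (flex_apex hH ha hb hab))
  simp only [Finset.mem_insert, Finset.mem_singleton] at hc
  rcases hc with rfl | rfl | rfl
  · exact (hz hcB).elim
  · exact ⟨_, ha, hcB⟩
  · exact ⟨_, hb, hcB⟩

theorem notMem_apex_left (hH : ∀ e ∈ H, e.card = 3) (y z : V) : y ∉ apex t H y z :=
  fun h => (ne_of_triple hH (mem_apex.1 h).1).2.1 rfl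

theorem notMem_apex_right (hH : ∀ e ∈ H, e.card = 3) (y z : V) : z ∉ apex t H y z :=
  fun h => (ne_of_triple hH (mem_apex.1 h).1).2.2 rfl

open scoped Classical in
theorem card_sq_le_of_common (hH : ∀ e ∈ H, e.card = 3) (hfree : ¬ ContainsFanExp t H)
    {Z S : Finset V} (hS : 5 * t + 7 ≤ S.card) (hZ : ∀ z ∈ Z, ∀ a ∈ S, Thick t H z a) :
    Z.card * Z.card ≤ (Finset.univ.filter fun p : V × V => ¬ Perf t H p.1 p.2).card +
      Z.card * ((2 * t + 1) * t) := by
  have h1 : ∀ z ∈ Z, Z.card ≤ (Z.filter fun x => ¬ Perf t H z x).card + (2 * t + 1) * t := by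
    intro z hz
    by_contra! hc
    have hsplit := Finset.card_filter_add_card_filter_not (s := Z) fun x => Perf t H z x
    refine hfree (containsFanExp_of_sdr (v := z) (fun x => {x}) (fun x => apex t H z x)
      (Z.filter fun x => Perf t H z x) ?_ ?_ (by omega) ?_)
    · intro i _ j _ hij
      exact Finset.disjoint_singleton.2 hij
    · intro i hi
      exact (Finset.mem_filter.1 hi).2.ge
    · intro x hx u hu
      have hxZ := (Finset.mem_filter.1 hx).1
      refine Flex.of_pool (Finset.card_le_two.trans (by norm_num)) hS fun a ha haQ hav => ?_
      simp only [Finset.mem_insert, Finset.mem_singleton, not_or] at haQ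
      convert flex_near hH (mem_apex.1 hu).1 (hZ z hz a ha) (hZ x hxZ a ha) haQ.1 using 1
      ext; simp; tauto
  calc Z.card * Z.card ≤ ∑ z ∈ Z, ((Z.filter fun x => ¬ Perf t H z x).card + (2 * t + 1) * t) := by
        rw [← smul_eq_mul, ← Finset.sum_const]
        exact Finset.sum_le_sum h1
    _ = ((Z ×ˢ Z).filter fun p : V × V => ¬ Perf t H p.1 p.2).card +
        Z.card * ((2 * t + 1) * t) := by
        rw [Finset.sum_add_distrib, sum_card_filter_eq Z Z (fun z x => ¬ Perf t H z x),
          Finset.sum_const, smul_eq_mul]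
    _ ≤ _ := by
        gcongr
        exact Finset.subset_univ _

open scoped Classical in
theorem card_hubs_le (hH : ∀ e ∈ H, e.card = 3) (hfree : ¬ ContainsFanExp t H) {q K c : ℕ}
    (hq : 0 < q) (hK : K = 2 * (5 * t + 7) * q) (hc : c = K * 2 ^ K)
    (hn : 2 * c ^ 2 * ((2 * t + 1) * t + 1) + 1 ≤ Fintype.card V)
    (hNP : 2 * c ^ 2 * (Finset.univ.filter fun p : V × V => ¬ Perf t H p.1 p.2).card ≤
      Fintype.card V ^ 2) :
    (Finset.univ.filter fun a : V =>
      Fintype.card V ≤ q * (Finset.univ.filter fun z => Thick t H a z).card).card ≤ K := by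
  set n := Fintype.card V
  set M := (2 * t + 1) * t
  set NP := (Finset.univ.filter fun p : V × V => ¬ Perf t H p.1 p.2).card
  set T := Finset.univ.filter fun a => n ≤ q * (Finset.univ.filter fun z => Thick t H a z).card
    with hT
  by_contra! hcon
  obtain ⟨T', hT'T, hT'⟩ := Finset.exists_subset_card_eq hcon.le
  have hKpos : 0 < K := by
    rw [hK]
    exact Nat.mul_pos (by omega) hq
  rcases exists_common_neighbours (fun a z => Thick t H a z) T' (5 * t + 7)
    (Nat.mul_pos (by omega) (by omega)) (by
      intro a ha
      have := (Finset.mem_filter.1 (hT'T ha)).2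
      rw [hT', hK, mul_assoc (2 * (5 * t + 7)) q]
      exact Nat.mul_le_mul_left _ this) with h | ⟨S, hS, hSD, hSZ⟩
  · omega
  rw [hT', ← hc] at hSZ
  set Z := Finset.univ.filter fun z => ∀ a ∈ S, Thick t H a z
  have h1 := card_sq_le_of_common hH hfree hSD (Z := Z)
    (fun z hz a ha => ((Finset.mem_filter.1 hz).2 a ha).symm)
  have h2 : n ≤ c * Z.card := le_trans (Nat.le_mul_of_pos_left _ (by omega)) hSZ
  have h3 : Z.card ≤ n := Finset.card_le_univ _
  have h4 : n ^ 2 ≤ c ^ 2 * (NP + n * M) := by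
    calc n ^ 2 ≤ (c * Z.card) ^ 2 := Nat.pow_le_pow_left h2 2
      _ = c ^ 2 * (Z.card * Z.card) := by ring
      _ ≤ c ^ 2 * (NP + Z.card * M) := Nat.mul_le_mul_left _ h1
      _ ≤ _ := by gcongr
  clear_value NP M n
  generalize c ^ 2 = d at *
  have h6 : 2 * d * M + 1 ≤ n := by nlinarith
  have h7 : (2 * d * M + 1) * n ≤ n * n := Nat.mul_le_mul_right _ h6
  have h8 : 0 < n := by omega
  nlinarith

end Hubs

open scoped Classical in
theorem exists_hub (t : ℕ) (ht : 2 ≤ t) : ∃ C : ℕ, 0 < C ∧ ∀ (V : Type) [Fintype V]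
    [DecidableEq V] (H : Finset (Finset V)), C ≤ Fintype.card V → (∀ e ∈ H, e.card = 3) →
    ¬ ContainsFanExp t H →
    C * (Finset.univ.filter fun p : V × V => ¬ Perf t H p.1 p.2).card ≤ Fintype.card V ^ 2 →
    ∃ s, Fintype.card V ^ 2 ≤
      C * (Finset.univ.filter fun p : V × V => Perf t H p.1 p.2 ∧ s ∈ apex t H p.1 p.2).card := by
  set D := 5 * t + 7 with hD
  obtain ⟨q, hq⟩ : ∃ q, q = 20 * t := ⟨_, rfl⟩
  obtain ⟨K, hK⟩ : ∃ K, K = 2 * D * q := ⟨_, rfl⟩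
  obtain ⟨c, hc⟩ : ∃ c, c = K * 2 ^ K := ⟨_, rfl⟩
  obtain ⟨M, hM⟩ : ∃ M, M = (2 * t + 1) * t := ⟨_, rfl⟩
  have hKpos : 0 < K := by
    rw [hK]
    exact Nat.mul_pos (by omega) (by omega)
  obtain ⟨C, hC⟩ : ∃ C, C = 2 * c ^ 2 * (M + 1) + 4 * K + 20 * t + 4 := ⟨_, rfl⟩
  have hC2 : 2 * c ^ 2 ≤ C := by
    have : 2 * c ^ 2 * 1 ≤ 2 * c ^ 2 * (M + 1) := Nat.mul_le_mul_left _ (by omega)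
    omega
  refine ⟨C, by omega, fun V _ _ H hn hH hfree hNP => ?_⟩
  set n := Fintype.card V with hn'
  set NP := (Finset.univ.filter fun p : V × V => ¬ Perf t H p.1 p.2).card with hNP'
  set T := Finset.univ.filter fun a => n ≤ q * (Finset.univ.filter fun z => Thick t H a z).card
    with hT
  have hTK : T.card ≤ K := card_hubs_le hH hfree (by omega) hK hc (by rw [← hn', ← hM]; omega)
    (le_trans (Nat.mul_le_mul_right _ hC2) hNP)
  obtain ⟨B, hB, hit⟩ := exists_hitting hfree
  let deg : V → V → ℕ := fun y a =>
    (Finset.univ.filter fun z => Perf t H y z ∧ a ∈ apex t H y z).card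
  have hgood : n ^ 2 ≤ NP + 5 * t * n + ∑ y, ∑ a ∈ B y, deg y a := by
    have : ∀ y, n ≤ (Finset.univ.filter fun z => ¬ Perf t H y z).card + 5 * t +
        ∑ a ∈ B y, deg y a := by
      intro y
      have hsub : (Finset.univ : Finset V) ⊆ (Finset.univ.filter fun z => ¬ Perf t H y z) ∪ B y ∪
          (B y).biUnion fun a => Finset.univ.filter fun z => Perf t H y z ∧ a ∈ apex t H y z := by
        intro z _
        simp only [Finset.mem_union, Finset.mem_filter, Finset.mem_univ, true_and,
          Finset.mem_biUnion]
        by_cases h1 : Perf t H y z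
        · by_cases h2 : z ∈ B y
          · exact Or.inl (Or.inr h2)
          · obtain ⟨a, ha, haB⟩ := exists_mem_apex_hitting hH ht hit h1 h2
            exact Or.inr ⟨a, haB, h1, ha⟩
        · exact Or.inl (Or.inl h1)
      refine (Finset.card_le_card hsub).trans ((Finset.card_union_le _ _).trans
        (Nat.add_le_add ((Finset.card_union_le _ _).trans (Nat.add_le_add_left (hB y) _))
        Finset.card_biUnion_le))
    have h2 := Finset.sum_le_sum fun y (_ : y ∈ Finset.univ) => this y
    rw [Finset.sum_add_distrib, Finset.sum_add_distrib, Finset.sum_const, Finset.sum_const,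
      sum_card_filter_eq Finset.univ Finset.univ (fun y z => ¬ Perf t H y z), Finset.card_univ,
      smul_eq_mul, smul_eq_mul, Finset.univ_product_univ] at h2
    rw [pow_two]
    calc _ ≤ _ := h2
      _ = _ := by rw [hNP']; ring
  have hlow : q * ∑ y, ∑ a ∈ (B y).filter (· ∉ T), deg y a ≤ n * (5 * t * n) := by
    rw [Finset.mul_sum, hn', ← Finset.card_univ, ← smul_eq_mul, ← Finset.sum_const]
    refine Finset.sum_le_sum fun y _ => ?_
    rw [Finset.mul_sum]
    refine (Finset.sum_le_card_nsmul _ _ n fun a ha => ?_).trans ?_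
    · have ha' := (Finset.mem_filter.1 ha).2
      simp only [hT, Finset.mem_filter, Finset.mem_univ, true_and, not_le] at ha'
      refine le_trans (Nat.mul_le_mul_left _ (Finset.card_le_card fun z hz => ?_)) ha'.le
      have := (Finset.mem_filter.1 hz).2
      exact Finset.mem_filter.2 ⟨Finset.mem_univ _, (mem_apex.1 this.2).2.2.symm⟩
    · rw [smul_eq_mul]
      exact Nat.mul_le_mul_right _ ((Finset.card_le_card (Finset.filter_subset _ _)).trans (hB y))
  have hhigh : ∑ y, ∑ a ∈ (B y).filter (· ∈ T), deg y a ≤ ∑ a ∈ T, ∑ y, deg y a := by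
    rw [Finset.sum_comm (s := T)]
    refine Finset.sum_le_sum fun y _ => Finset.sum_le_sum_of_subset ?_
    intro a ha
    exact (Finset.mem_filter.1 ha).2
  have hsplit : ∑ y, ∑ a ∈ B y, deg y a = ∑ y, ∑ a ∈ (B y).filter (· ∈ T), deg y a +
      ∑ y, ∑ a ∈ (B y).filter (· ∉ T), deg y a := by
    rw [← Finset.sum_add_distrib]
    exact Finset.sum_congr rfl fun y _ => (Finset.sum_filter_add_sum_filter_not _ _ _).symm
  have hmain : n ^ 2 ≤ 4 * ∑ a ∈ T, ∑ y, deg y a := by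
    have h1 : 4 * NP ≤ n ^ 2 := le_trans (Nat.mul_le_mul_right _ (by omega)) hNP
    have h2 : 20 * t * n ≤ n ^ 2 := by rw [pow_two]; exact Nat.mul_le_mul_right _ (by omega)
    have h3 : (5 * t) * (4 * ∑ y, ∑ a ∈ (B y).filter (· ∉ T), deg y a) ≤ (5 * t) * n ^ 2 := by
      calc _ = q * ∑ y, ∑ a ∈ (B y).filter (· ∉ T), deg y a := by rw [hq]; ring
        _ ≤ _ := hlow
        _ = _ := by ring
    have h4 := Nat.le_of_mul_le_mul_left h3 (by omega)
    nlinarith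
  by_contra! hcon
  have hn0 : 0 < n ^ 2 := by
    have : 0 < n := by omega
    positivity
  have hfin : 4 * K * ∑ a ∈ T, ∑ y, deg y a ≤ K * (n ^ 2 - 1) := by
    rw [Finset.mul_sum]
    refine (Finset.sum_le_card_nsmul _ _ (n ^ 2 - 1) fun a _ => ?_).trans
      (by rw [smul_eq_mul]; exact Nat.mul_le_mul_right _ hTK)
    have h1 := hcon a
    have h2 : ∑ y, deg y a =
        (Finset.univ.filter fun p : V × V => Perf t H p.1 p.2 ∧ a ∈ apex t H p.1 p.2).card := by
      simp only [deg]
      rw [sum_card_filter_eq Finset.univ Finset.univ (fun y z => Perf t H y z ∧ a ∈ apex t H y z),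
        Finset.univ_product_univ]
    rw [h2]
    exact Nat.le_sub_one_of_lt (lt_of_le_of_lt (Nat.mul_le_mul_right _ (by omega)) h1)
  have : K * n ^ 2 ≤ K * (n ^ 2 - 1) := by
    refine le_trans (Nat.mul_le_mul_left _ hmain) (le_of_eq_of_le ?_ hfin)
    ring
  have := Nat.le_of_mul_le_mul_left this hKpos
  omega

theorem exists_injOn_of_card_le {α β : Type*} [Nonempty β] (J : Finset α) (S : Finset β)
    (h : J.card ≤ S.card) :
    ∃ e : α → β, (∀ i ∈ J, e i ∈ S) ∧ ∀ i ∈ J, ∀ j ∈ J, e i = e j → i = j := by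
  classical
  obtain ⟨f, hf⟩ := Function.Embedding.exists_of_card_le_finset (α := J) (s := S) (by simpa using h)
  refine ⟨fun i => if hi : i ∈ J then f ⟨i, hi⟩ else Classical.arbitrary β, ?_, ?_⟩
  · intro i hi
    simp only [hi, dif_pos]
    exact hf ⟨_, rfl⟩
  · intro i hi j hj hij
    simp only [hi, hj, dif_pos] at hij
    exact congrArg Subtype.val (f.injective hij)

section Common

variable {V : Type*} [Fintype V] [DecidableEq V] {H : Finset (Finset V)} {t : ℕ}

theorem flex_apex_center (hH : ∀ e ∈ H, e.card = 3) {s y z u : V} (hs : s ∈ apex t H y z)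
    (hu : u ∈ apex t H y z) (hsu : s ≠ u) : Flex t H s {y, z, u} :=
  flex_far hH (mem_apex.1 hu).1 (mem_apex.1 hs).2.1.symm (mem_apex.1 hs).2.2.symm hsu

theorem apex_eq_of_independent (hH : ∀ e ∈ H, e.card = 3) (hfree : ¬ ContainsFanExp t H)
    (ht : 2 ≤ t) {s : V} (J : Finset (V × V)) (hJ : t ≤ J.card)
    (hperf : ∀ p ∈ J, Perf t H p.1 p.2 ∧ s ∈ apex t H p.1 p.2)
    (hd : ∀ p ∈ J, ∀ q ∈ J, p ≠ q → Disjoint ({p.1, p.2} : Finset V) {q.1, q.2})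
    (hA : ∀ p ∈ J, ∀ q ∈ J, p ≠ q → Disjoint (apex t H p.1 p.2) {q.1, q.2})
    {p q : V × V} (hp : p ∈ J) (hq : q ∈ J) : apex t H p.1 p.2 = apex t H q.1 q.2 := by
  by_contra hne
  have hpq : p ≠ q := by rintro rfl; exact hne rfl
  obtain ⟨J', h1, h2, hJ'⟩ := Finset.exists_subsuperset_card_eq (s := {p, q}) (t := J) (n := t)
    (by simp [Finset.insert_subset_iff, hp, hq]) (by rw [Finset.card_pair hpq]; exact ht) hJ
  have hcard : ∀ i ∈ J, ((apex t H i.1 i.2).erase s).card = t - 1 := by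
    intro i hi
    rw [Finset.card_erase_of_mem (hperf i hi).2, (hperf i hi).1]
  obtain ⟨u, hu, huL⟩ := (Finset.all_card_le_biUnion_card_iff_exists_injective
    (fun i : J' => (apex t H i.1.1 i.1.2).erase s)).1 (by
      intro I
      rcases I.eq_empty_or_nonempty with rfl | ⟨i, hi⟩
      · simp
      have hsub : ∀ i ∈ I, (apex t H i.1.1 i.1.2).erase s ⊆
          I.biUnion fun i => (apex t H i.1.1 i.1.2).erase s :=
        fun i hi => Finset.subset_biUnion_of_mem (fun i : J' => (apex t H i.1.1 i.1.2).erase s) hi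
      have hle := Finset.card_le_card (hsub i hi)
      rw [hcard _ (h2 i.2)] at hle
      by_cases hI : I.card ≤ t - 1
      · omega
      have hIu : I = Finset.univ := by
        refine Finset.eq_univ_of_card _ (le_antisymm (Finset.card_le_univ _) ?_)
        rw [Fintype.card_coe]; omega
      have hIt : I.card = t := by rw [hIu, Finset.card_univ, Fintype.card_coe, hJ']
      rw [hIt]
      by_contra! hlt
      have e1 := Finset.eq_of_subset_of_card_le
        (hsub ⟨p, h1 (by simp)⟩ (by rw [hIu]; exact Finset.mem_univ _))
        (by rw [hcard p hp]; omega)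
      have e2 := Finset.eq_of_subset_of_card_le
        (hsub ⟨q, h1 (by simp)⟩ (by rw [hIu]; exact Finset.mem_univ _))
        (by rw [hcard q hq]; omega)
      apply hne
      rw [← Finset.insert_erase (hperf p hp).2, ← Finset.insert_erase (hperf q hq).2]
      congr 1
      exact e1.trans e2.symm)
  refine hfree (containsFanExp_of_finset (v := s) (Finset.univ : Finset J')
    (by rw [Finset.card_univ, Fintype.card_coe, hJ'])
    (fun i => {i.1.1, i.1.2, u i}) (fun i _ => ?_) fun i _ j _ hij => ?_)
  · have := Finset.mem_erase.1 (huL i)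
    exact flex_apex_center hH (hperf _ (h2 i.2)).2 this.2 this.1.symm
  · have hij' : i.1 ≠ j.1 := fun h => hij (Subtype.ext h)
    have d1 := hd _ (h2 i.2) _ (h2 j.2) hij'
    have d2 := Finset.disjoint_left.1 (hA _ (h2 i.2) _ (h2 j.2) hij') (Finset.mem_erase.1 (huL i)).2
    have d3 := Finset.disjoint_left.1 (hA _ (h2 j.2) _ (h2 i.2) hij'.symm)
      (Finset.mem_erase.1 (huL j)).2
    have d4 : u i ≠ u j := fun h => hij (hu h)
    simp only [Finset.disjoint_insert_left, Finset.disjoint_singleton_left, Finset.mem_insert,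
      Finset.mem_singleton, not_or] at d1 d2 d3 ⊢
    exact ⟨⟨d1.1.1, d1.1.2, Ne.symm d3.1⟩, ⟨d1.2.1, d1.2.2, Ne.symm d3.2⟩, d2.1, d2.2, d4⟩

open scoped Classical in
/-- The pairs whose thick completions are exactly the elements of `S`. -/
noncomputable def apexPairs (t : ℕ) (H : Finset (Finset V)) (S : Finset V) : Finset (V × V) :=
  Finset.univ.filter fun p => apex t H p.1 p.2 = S

open scoped Classical in
/-- The vertices forming thick pairs with all of `S`. -/
noncomputable def hubNbrs (t : ℕ) (H : Finset (Finset V)) (S : Finset V) : Finset V :=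
  Finset.univ.filter fun x => ∀ s ∈ S, Thick t H x s

variable {S : Finset V}

theorem mem_apexPairs {p : V × V} : p ∈ apexPairs t H S ↔ apex t H p.1 p.2 = S := by
  simp [apexPairs]

theorem mem_hubNbrs {x : V} : x ∈ hubNbrs t H S ↔ ∀ s ∈ S, Thick t H x s := by
  simp [hubNbrs]

theorem disjoint_hubNbrs (hH : ∀ e ∈ H, e.card = 3) : Disjoint S (hubNbrs t H S) :=
  Finset.disjoint_left.2 fun x hx h => (mem_hubNbrs.1 h x hx).ne hH rfl

theorem left_mem_hubNbrs {p : V × V} (hp : p ∈ apexPairs t H S) : p.1 ∈ hubNbrs t H S := by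
  rw [mem_apexPairs] at hp
  subst hp
  exact mem_hubNbrs.2 fun s hs => (mem_apex.1 hs).2.1

theorem right_mem_hubNbrs {p : V × V} (hp : p ∈ apexPairs t H S) : p.2 ∈ hubNbrs t H S := by
  rw [mem_apexPairs] at hp
  subst hp
  exact mem_hubNbrs.2 fun s hs => (mem_apex.1 hs).2.2

theorem exists_disjoint_apexPairs (R : V → Prop) [DecidablePred R] (k : ℕ) (U : Finset V)
    (h : 2 * Fintype.card V * (U.card + 2 * k) <
      ((apexPairs t H S).filter fun p => R p.1 ∧ R p.2).card) :
    ∃ J ⊆ apexPairs t H S, J.card = k ∧ (∀ p ∈ J, R p.1 ∧ R p.2) ∧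
      (∀ p ∈ J, ∀ q ∈ J, p ≠ q → Disjoint ({p.1, p.2} : Finset V) {q.1, q.2}) ∧
      ∀ p ∈ J, Disjoint ({p.1, p.2} : Finset V) U := by
  classical
  obtain ⟨J, h1, h2, h3, h4⟩ := exists_disjoint_pairs
    (fun x y => apex t H x y = S ∧ R x ∧ R y) k U (by
      convert h using 2
      ext p
      simp [mem_apexPairs])
  exact ⟨J, fun p hp => mem_apexPairs.2 (h2 p hp).1, h1, fun p hp => (h2 p hp).2, h3, h4⟩

theorem exists_disjoint_apexPairs' (k : ℕ) (U : Finset V)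
    (h : 2 * Fintype.card V * (U.card + 2 * k) < (apexPairs t H S).card) :
    ∃ J ⊆ apexPairs t H S, J.card = k ∧
      (∀ p ∈ J, ∀ q ∈ J, p ≠ q → Disjoint ({p.1, p.2} : Finset V) {q.1, q.2}) ∧
      ∀ p ∈ J, Disjoint ({p.1, p.2} : Finset V) U := by
  obtain ⟨J, h1, h2, -, h3⟩ := exists_disjoint_apexPairs (t := t) (H := H) (S := S)
    (fun _ => True) k U (by simpa using h)
  exact ⟨J, h1, h2, h3⟩

theorem disjoint_of_mem_apexPairs (hH : ∀ e ∈ H, e.card = 3) {p : V × V}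
    (hp : p ∈ apexPairs t H S) : Disjoint S {p.1, p.2} := by
  rw [mem_apexPairs] at hp
  subst hp
  rw [Finset.disjoint_right]
  simp only [Finset.mem_insert, Finset.mem_singleton]
  rintro x (rfl | rfl)
  · exact notMem_apex_left hH _ _
  · exact notMem_apex_right hH _ _

theorem apex_eq_of_not_disjoint (hH : ∀ e ∈ H, e.card = 3) (hfree : ¬ ContainsFanExp t H)
    (ht : 2 ≤ t) (hS : S.card = t)
    (hpairs : 2 * Fintype.card V * (3 * t + 2) < (apexPairs t H S).card) {x y : V}
    (hxy : Perf t H x y) (hx : x ∉ S) (hy : y ∉ S) (h : ¬ Disjoint (apex t H x y) S) :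
    apex t H x y = S := by
  have hU : ({x, y} ∪ apex t H x y).card ≤ t + 2 := by
    refine (Finset.card_union_le _ _).trans ?_
    have : ({x, y} : Finset V).card ≤ 2 := Finset.card_le_two
    rw [Perf] at hxy
    omega
  obtain ⟨J, hJ, hJt, hd, hJU⟩ := exists_disjoint_apexPairs' (t := t) (H := H) (S := S) t
    ({x, y} ∪ apex t H x y) (lt_of_le_of_lt (Nat.mul_le_mul_left _ (by omega)) hpairs)
  obtain ⟨s, hs, hsS⟩ := Finset.not_disjoint_iff.1 h
  obtain ⟨q, hq⟩ := Finset.card_pos.1 (show 0 < J.card by omega)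
  have hS' : ∀ p ∈ J, apex t H p.1 p.2 = S := fun p hp => mem_apexPairs.1 (hJ hp)
  have hxyS : Disjoint S {x, y} := by simp [hx, hy]
  rw [← hS' q hq]
  refine apex_eq_of_independent (s := s) (p := (x, y)) hH hfree ht (insert (x, y) J)
    (hJt.ge.trans (Finset.card_le_card (Finset.subset_insert _ _))) ?_ ?_ ?_
    (Finset.mem_insert_self _ _) (Finset.mem_insert_of_mem hq)
  · intro p hp
    rcases Finset.mem_insert.1 hp with rfl | hp
    · exact ⟨hxy, hs⟩
    · rw [Perf, hS' p hp]
      exact ⟨hS, hsS⟩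
  · intro p hp q hq hpq
    rcases Finset.mem_insert.1 hp with rfl | hp <;> rcases Finset.mem_insert.1 hq with rfl | hq
    · exact (hpq rfl).elim
    · exact ((hJU q hq).mono_right Finset.subset_union_left).symm
    · exact (hJU p hp).mono_right Finset.subset_union_left
    · exact hd p hp q hq hpq
  · intro p hp q hq hpq
    rcases Finset.mem_insert.1 hp with rfl | hp <;> rcases Finset.mem_insert.1 hq with rfl | hq
    · exact (hpq rfl).elim
    · exact ((hJU q hq).mono_right Finset.subset_union_right).symm
    · rw [hS' p hp]; exact hxyS
    · rw [hS' p hp]; exact disjoint_of_mem_apexPairs hH (hJ hq)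

open scoped Classical in
theorem exists_apexPairs (hH : ∀ e ∈ H, e.card = 3) (hfree : ¬ ContainsFanExp t H)
    (ht : 2 ≤ t) {s : V} (hs : 2 * Fintype.card V * (2 * ((2 * t + 1) * (2 * t))) <
      (Finset.univ.filter fun p : V × V => Perf t H p.1 p.2 ∧ s ∈ apex t H p.1 p.2).card) :
    ∃ S : Finset V, S.card = t ∧
      (Finset.univ.filter fun p : V × V => Perf t H p.1 p.2 ∧ s ∈ apex t H p.1 p.2).card ≤
        (apexPairs t H S).card + 2 * Fintype.card V * (5 * t) := by
  obtain ⟨J₀, hJ₀, hR, hd, -⟩ := exists_disjoint_pairs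
    (fun x y => Perf t H x y ∧ s ∈ apex t H x y) ((2 * t + 1) * (2 * t)) ∅
    (by rw [Finset.card_empty, zero_add]; convert hs using 2; ext; simp)
  obtain ⟨J, hJ, hJc, hind⟩ := exists_independent (fun p : V × V => ({p.1, p.2} : Finset V))
    (fun p => apex t H p.1 p.2) t (2 * t) J₀ hd (fun p hp => (hR p hp).1.le) hJ₀.ge
  obtain ⟨q₀, hq₀⟩ := Finset.card_pos.1 (show 0 < J.card by omega)
  have heq : ∀ q ∈ J, apex t H q.1 q.2 = apex t H q₀.1 q₀.2 := fun q hq =>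
    apex_eq_of_independent hH hfree ht J (by omega) (fun p hp => hR p (hJ hp))
      (fun p hp q hq => hd p (hJ hp) q (hJ hq)) hind hq hq₀
  refine ⟨apex t H q₀.1 q₀.2, (hR _ (hJ hq₀)).1, ?_⟩
  set S := apex t H q₀.1 q₀.2 with hSdef
  set W := S ∪ J.biUnion fun p => {p.1, p.2} with hW
  have hWc : W.card ≤ 5 * t := by
    refine (Finset.card_union_le _ _).trans ?_
    have h1 : S.card = t := (hR _ (hJ hq₀)).1
    have h2 : (J.biUnion fun p => ({p.1, p.2} : Finset V)).card ≤ J.card * 2 :=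
      Finset.card_biUnion_le_card_mul _ _ _ fun p _ => Finset.card_le_two
    omega
  have hsub : (Finset.univ.filter fun p : V × V => Perf t H p.1 p.2 ∧ s ∈ apex t H p.1 p.2) ⊆
      apexPairs t H S ∪ (W ×ˢ Finset.univ ∪ Finset.univ ×ˢ W) := by
    intro p hp
    have hp' := (Finset.mem_filter.1 hp).2
    by_cases hpW : p.1 ∈ W ∨ p.2 ∈ W
    · refine Finset.mem_union_right _ ?_
      simpa [Finset.mem_union, Finset.mem_product] using hpW
    refine Finset.mem_union_left _ (mem_apexPairs.2 ?_)
    have hpd : Disjoint ({p.1, p.2} : Finset V) W := by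
      push Not at hpW
      simp [hpW.1, hpW.2]
    set G := J.filter fun q => Disjoint (apex t H p.1 p.2) {q.1, q.2} with hG
    have hbad : (J.filter fun q => ¬ Disjoint (apex t H p.1 p.2) {q.1, q.2}).card ≤ t := by
      refine le_of_le_of_eq ?_ hp'.1
      have : Nonempty V := ⟨s⟩
      choose! g hg using fun (q : V × V) =>
        fun h : ¬ Disjoint (apex t H p.1 p.2) ({q.1, q.2} : Finset V) =>
        Finset.not_disjoint_iff.1 h
      refine Finset.card_le_card_of_injOn g (fun q hq => (hg q (Finset.mem_filter.1 hq).2).1) ?_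
      intro q hq q' hq' hqq
      have m1 := Finset.mem_filter.1 hq
      have m2 := Finset.mem_filter.1 hq'
      by_contra hne
      have e1 := (hg q m1.2).2
      rw [hqq] at e1
      exact Finset.disjoint_left.1 (hd q (hJ m1.1) q' (hJ m2.1) hne) e1 (hg q' m2.2).2
    have hsplit : G.card + (J.filter fun q => ¬ Disjoint (apex t H p.1 p.2) {q.1, q.2}).card =
        J.card := by
      rw [← Finset.card_filter_add_card_filter_not (s := J)
        fun q => Disjoint (apex t H p.1 p.2) {q.1, q.2}]
    have hGt : t ≤ G.card := by omega
    obtain ⟨q, hq⟩ := Finset.card_pos.1 (show 0 < G.card by omega)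
    have hGJ : ∀ q ∈ G, q ∈ J := fun q hq => (Finset.mem_filter.1 hq).1
    have hcoreW : ∀ q ∈ J, ({q.1, q.2} : Finset V) ⊆ W := fun q hq =>
      (Finset.subset_biUnion_of_mem (fun p : V × V => ({p.1, p.2} : Finset V)) hq).trans
        Finset.subset_union_right
    rw [← heq q (hGJ q hq)]
    refine apex_eq_of_independent (s := s) hH hfree ht (insert p G)
      (hGt.trans (Finset.card_le_card (Finset.subset_insert _ _))) ?_ ?_ ?_
      (Finset.mem_insert_self _ _) (Finset.mem_insert_of_mem hq)
    · intro a ha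
      rcases Finset.mem_insert.1 ha with rfl | ha
      · exact hp'
      · exact hR a (hJ (hGJ a ha))
    · intro a ha b hb hab
      rcases Finset.mem_insert.1 ha with rfl | ha <;> rcases Finset.mem_insert.1 hb with rfl | hb
      · exact (hab rfl).elim
      · exact hpd.mono_right (hcoreW b (hGJ b hb))
      · exact (hpd.mono_right (hcoreW a (hGJ a ha))).symm
      · exact hd a (hJ (hGJ a ha)) b (hJ (hGJ b hb)) hab
    · intro a ha b hb hab
      rcases Finset.mem_insert.1 ha with rfl | ha <;> rcases Finset.mem_insert.1 hb with rfl | hb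
      · exact (hab rfl).elim
      · exact (Finset.mem_filter.1 hb).2
      · rw [heq a (hGJ a ha)]
        exact (hpd.mono_right Finset.subset_union_left).symm
      · exact hind a (hGJ a ha) b (hGJ b hb) hab
  refine (Finset.card_le_card hsub).trans ((Finset.card_union_le _ _).trans
    (Nat.add_le_add_left ((Finset.card_union_le _ _).trans ?_) _))
  rw [Finset.card_product, Finset.card_product, Finset.card_univ]
  nlinarith [Nat.mul_le_mul_left (Fintype.card V) hWc]

open scoped Classical in
theorem card_filter_apex_ne_le (hH : ∀ e ∈ H, e.card = 3) (hfree : ¬ ContainsFanExp t H)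
    (ht : 2 ≤ t) (hS : S.card = t)
    (hpairs : 2 * Fintype.card V * (3 * t + 2) < (apexPairs t H S).card) {y : V}
    (hy : y ∈ hubNbrs t H S) :
    ((hubNbrs t H S).filter fun z => Perf t H y z ∧ apex t H y z ≠ S).card ≤ (2 * t + 1) * t := by
  by_contra! hc
  have hNS := disjoint_hubNbrs (S := S) (t := t) hH
  obtain ⟨g, u, hg, hu, hgJ, huL, hout⟩ := exists_independent_sdr (fun z : V => {z})
    (fun z => apex t H y z) t ((hubNbrs t H S).filter fun z => Perf t H y z ∧ apex t H y z ≠ S)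
    (fun i _ j _ hij => Finset.disjoint_singleton.2 hij)
    (fun z hz => (Finset.mem_filter.1 hz).2.1.ge) hc.le
  let e : Fin t ≃ S := (Fin.castOrderIso hS.symm).toEquiv.trans S.equivFin.symm
  have hgN : ∀ i, g i ∈ hubNbrs t H S := fun i => (Finset.mem_filter.1 (hgJ i)).1
  have hdis : ∀ i, Disjoint (apex t H y (g i)) S := by
    intro i
    by_contra hcon
    exact (Finset.mem_filter.1 (hgJ i)).2.2 (apex_eq_of_not_disjoint hH hfree ht hS hpairs
      (Finset.mem_filter.1 (hgJ i)).2.1 (Finset.disjoint_right.1 hNS hy)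
      (Finset.disjoint_right.1 hNS (hgN i)) hcon)
  have hue : ∀ i j, u i ≠ e j := fun i j h =>
    Finset.disjoint_left.1 (hdis i) (huL i) (h ▸ (e j).2)
  have hge : ∀ i j, g i ≠ e j := fun i j h => Finset.disjoint_left.1 hNS (e j).2 (h ▸ hgN i)
  have hgu : ∀ i j, i ≠ j → u i ≠ g j := fun i j hij => by simpa using hout i j hij
  refine hfree (containsFanExp_of_flex (v := y) (fun i => {g i, (e i : V), u i}) (fun i => ?_)
    fun i j hij => ?_)
  · exact flex_near hH (mem_apex.1 (huL i)).1 (mem_hubNbrs.1 hy _ (e i).2)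
      (mem_hubNbrs.1 (hgN i) _ (e i).2) (hue i i).symm
  · simp only [Finset.disjoint_insert_left, Finset.disjoint_singleton_left, Finset.mem_insert,
      Finset.mem_singleton, not_or]
    exact ⟨⟨fun h => hij (hg h), hge i j, (hgu j i hij.symm).symm⟩,
      ⟨(hge j i).symm, fun h => hij (e.injective (Subtype.ext h)), (hue j i).symm⟩,
      hgu i j hij, hue i j, fun h => hij (hu h)⟩

open scoped Classical in
theorem card_apexPairs_thick_le (hH : ∀ e ∈ H, e.card = 3) (hfree : ¬ ContainsFanExp t H)
    (hS : S.card = t) {a : V} (ha : a ∉ S) :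
    ((apexPairs t H S).filter fun p => Thick t H a p.1 ∧ Thick t H a p.2).card ≤
      2 * Fintype.card V * (2 * t) := by
  by_contra! hc
  obtain ⟨J, hJ, hJt, hR, hd, -⟩ := exists_disjoint_apexPairs (t := t) (H := H) (S := S)
    (fun x => Thick t H a x) t ∅ (by simpa using hc)
  have : Nonempty V := ⟨a⟩
  obtain ⟨e, heS, he⟩ := exists_injOn_of_card_le J S (by omega)
  refine hfree (containsFanExp_of_finset (v := a) J hJt.ge (fun p => {p.1, p.2, e p})
    (fun p hp => ?_) fun p hp q hq hpq => ?_)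
  · have h := heS p hp
    rw [← mem_apexPairs.1 (hJ hp)] at h
    exact flex_far hH (mem_apex.1 h).1 (hR p hp).1 (hR p hp).2
      (by rintro h2; exact ha (h2 ▸ heS p hp))
  · have d1 := hd p hp q hq hpq
    have d2 := Finset.disjoint_left.1 (disjoint_of_mem_apexPairs hH (hJ hq)) (heS p hp)
    have d3 := Finset.disjoint_left.1 (disjoint_of_mem_apexPairs hH (hJ hp)) (heS q hq)
    have d4 : e p ≠ e q := fun h => hpq (he p hp q hq h)
    simp only [Finset.disjoint_insert_left, Finset.disjoint_singleton_left, Finset.mem_insert,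
      Finset.mem_singleton, not_or] at d1 d2 d3 ⊢
    exact ⟨⟨d1.1.1, d1.1.2, Ne.symm d3.1⟩, ⟨d1.2.1, d1.2.2, Ne.symm d3.2⟩, d2.1, d2.2, d4⟩

end Common

section HubSet

variable {V : Type*} [Fintype V] [DecidableEq V] {H : Finset (Finset V)} {t : ℕ} {S : Finset V}

open scoped Classical in
theorem card_hub_apex_ne_le (hH : ∀ e ∈ H, e.card = 3) (hfree : ¬ ContainsFanExp t H)
    (ht : 2 ≤ t) (hS : S.card = t)
    (hpairs : 2 * Fintype.card V * (3 * t + 2) < (apexPairs t H S).card) :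
    ((hubNbrs t H S ×ˢ hubNbrs t H S).filter fun p => apex t H p.1 p.2 ≠ S).card ≤
      (Finset.univ.filter fun p : V × V => ¬ Perf t H p.1 p.2).card +
        Fintype.card V * ((2 * t + 1) * t) := by
  have hsub : ((hubNbrs t H S ×ˢ hubNbrs t H S).filter fun p => apex t H p.1 p.2 ≠ S) ⊆
      (Finset.univ.filter fun p : V × V => ¬ Perf t H p.1 p.2) ∪
        (hubNbrs t H S ×ˢ hubNbrs t H S).filter fun p =>
          Perf t H p.1 p.2 ∧ apex t H p.1 p.2 ≠ S := by
    intro p hp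
    simp only [Finset.mem_filter, Finset.mem_union, Finset.mem_univ, true_and] at hp ⊢
    tauto
  refine (Finset.card_le_card hsub).trans ((Finset.card_union_le _ _).trans
    (Nat.add_le_add_left ?_ _))
  rw [← sum_card_filter_eq (hubNbrs t H S) (hubNbrs t H S)
    fun y z => Perf t H y z ∧ apex t H y z ≠ S]
  refine (Finset.sum_le_card_nsmul _ _ _ fun y hy =>
    card_filter_apex_ne_le hH hfree ht hS hpairs hy).trans ?_
  rw [smul_eq_mul]
  exact Nat.mul_le_mul_right _ (Finset.card_le_univ _)

open scoped Classical in
theorem sq_card_hub_thick_le (hH : ∀ e ∈ H, e.card = 3) (hfree : ¬ ContainsFanExp t H)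
    (hS : S.card = t) {a : V} (ha : a ∉ S) :
    ((hubNbrs t H S).filter fun y => Thick t H a y).card ^ 2 ≤
      ((hubNbrs t H S ×ˢ hubNbrs t H S).filter fun p => apex t H p.1 p.2 ≠ S).card +
        2 * Fintype.card V * (2 * t) := by
  rw [sq, ← Finset.card_product]
  refine (Finset.card_le_card ?_).trans ((Finset.card_union_le _ _).trans
    (Nat.add_le_add_left (card_apexPairs_thick_le hH hfree hS ha) _))
  intro p hp
  simp only [Finset.mem_product, Finset.mem_filter, Finset.mem_union, mem_apexPairs] at hp ⊢
  tauto

open scoped Classical in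
theorem card_perf_hub_le (hH : ∀ e ∈ H, e.card = 3) (hfree : ¬ ContainsFanExp t H)
    (ht : 2 ≤ t) (hS : S.card = t)
    (hpairs : 2 * Fintype.card V * (3 * t + 2) < (apexPairs t H S).card) {L : ℕ}
    (hL : ∀ a ∉ S, ((hubNbrs t H S).filter fun y => Thick t H a y).card ≤ L) {z : V}
    (hzS : z ∉ S) (hz : z ∉ hubNbrs t H S) :
    ((hubNbrs t H S).filter fun y => Perf t H z y).card ≤ 5 * t + 5 * t * L := by
  obtain ⟨B, hB, hit⟩ := exists_hitting hfree
  have hsub : ((hubNbrs t H S).filter fun y => Perf t H z y) ⊆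
      B z ∪ (B z \ S).biUnion fun a => (hubNbrs t H S).filter fun y => Thick t H a y := by
    intro y hy
    obtain ⟨hyN, hyp⟩ := Finset.mem_filter.1 hy
    by_cases hyB : y ∈ B z
    · exact Finset.mem_union_left _ hyB
    obtain ⟨a, ha, haB⟩ := exists_mem_apex_hitting hH ht hit hyp hyB
    have haS : a ∉ S := by
      intro haS
      have heq := apex_eq_of_not_disjoint hH hfree ht hS hpairs hyp hzS
        (fun h => Finset.disjoint_left.1 (disjoint_hubNbrs (t := t) hH) h hyN)
        (Finset.not_disjoint_iff.2 ⟨a, ha, haS⟩)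
      refine hz (mem_hubNbrs.2 fun s hs => ?_)
      rw [← heq] at hs
      exact (mem_apex.1 hs).2.1
    refine Finset.mem_union_right _ (Finset.mem_biUnion.2
      ⟨a, Finset.mem_sdiff.2 ⟨haB, haS⟩, Finset.mem_filter.2 ⟨hyN, ?_⟩⟩)
    exact (mem_apex.1 ha).2.2.symm
  refine (Finset.card_le_card hsub).trans ((Finset.card_union_le _ _).trans
    (Nat.add_le_add (hB z) ((Finset.card_biUnion_le_card_mul _ _ L fun a ha =>
      hL a (Finset.mem_sdiff.1 ha).2).trans (Nat.mul_le_mul_right _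
        ((Finset.card_le_card Finset.sdiff_subset).trans (hB z))))))

open scoped Classical in
theorem card_compl_hub_mul_le (hH : ∀ e ∈ H, e.card = 3) (hfree : ¬ ContainsFanExp t H)
    (ht : 2 ≤ t) (hS : S.card = t)
    (hpairs : 2 * Fintype.card V * (3 * t + 2) < (apexPairs t H S).card) {L : ℕ}
    (hL : ∀ a ∉ S, ((hubNbrs t H S).filter fun y => Thick t H a y).card ≤ L) :
    (S ∪ hubNbrs t H S)ᶜ.card * (hubNbrs t H S).card ≤
      (Finset.univ.filter fun p : V × V => ¬ Perf t H p.1 p.2).card +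
        (S ∪ hubNbrs t H S)ᶜ.card * (5 * t + 5 * t * L) := by
  rw [← Finset.card_product]
  have hsub : (S ∪ hubNbrs t H S)ᶜ ×ˢ hubNbrs t H S ⊆
      (Finset.univ.filter fun p : V × V => ¬ Perf t H p.1 p.2) ∪
        ((S ∪ hubNbrs t H S)ᶜ ×ˢ hubNbrs t H S).filter fun p => Perf t H p.1 p.2 := by
    intro p hp
    simp only [Finset.mem_filter, Finset.mem_union, Finset.mem_univ, true_and, hp]
    tauto
  refine (Finset.card_le_card hsub).trans ((Finset.card_union_le _ _).trans
    (Nat.add_le_add_left ?_ _))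
  rw [← sum_card_filter_eq (S ∪ hubNbrs t H S)ᶜ (hubNbrs t H S) fun z y => Perf t H z y]
  refine (Finset.sum_le_card_nsmul _ _ (5 * t + 5 * t * L) fun z hz => ?_).trans_eq
    (smul_eq_mul _ _)
  simp only [Finset.mem_compl, Finset.mem_union, not_or] at hz
  exact card_perf_hub_le hH hfree ht hS hpairs hL hz.1 hz.2

end HubSet

theorem le_mul_of_self_improving {O m n C t κ δ ε : ℝ} (hO : 0 ≤ O) (hC : 0 ≤ C)
    (hn : 0 < n) (hnm : n ≤ 2 * C * m) (hOm : O * m ≤ ε * n ^ 2 + O * (5 * t + 5 * t * (δ * n)))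
    (hδ : 40 * C * t * δ = 1) (hCn : C * (100 * (t + 1)) ≤ n) (hε : ε * (4 * C) ≤ κ) :
    O ≤ κ * n := by
  have h3 : O * n ≤ κ / 2 * n ^ 2 + O * n / 2 := by
      calc (O : ℝ) * n ≤ O * (2 * C * m) := by gcongr
        _ = 2 * C * (O * m) := by ring
        _ ≤ 2 * C * (ε * n ^ 2 + O * (5 * t + 5 * t * (δ * n))) := by gcongr
        _ = (ε * (4 * C)) / 2 * n ^ 2 + O * (10 * C * t) + O * n * (40 * C * t * δ) / 4 := by
          ring
        _ ≤ κ / 2 * n ^ 2 + O * (n / 4) + O * n * 1 / 4 := by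
          rw [hδ]
          gcongr
          nlinarith
        _ = _ := by ring
  refine le_of_mul_le_mul_right ?_ hn
  nlinarith

set_option maxHeartbeats 800000 in
open scoped Classical in
/-- Stability: a nearly extremal fan-free hypergraph has a set `S` of `t` vertices such that almost
every vertex is thick to all of `S`, and almost every pair of these has `S` as its apex set. -/
theorem exists_hub_set (t : ℕ) (ht : 2 ≤ t) (C₁ : ℕ) {κ : ℝ} (hκ : 0 < κ) :
    ∃ N : ℕ, ∀ (V : Type) [Fintype V] [DecidableEq V] (H : Finset (Finset V)),
      N ≤ Fintype.card V → (∀ e ∈ H, e.card = 3) → ¬ ContainsFanExp t H →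
      t * Fintype.card V ^ 2 ≤ 2 * H.card + C₁ * Fintype.card V →
      ∃ S : Finset V, S.card = t ∧
        ((S ∪ hubNbrs t H S)ᶜ.card : ℝ) ≤ κ * Fintype.card V ∧
        (((hubNbrs t H S ×ˢ hubNbrs t H S).filter fun p => apex t H p.1 p.2 ≠ S).card : ℝ) ≤
          κ * (Fintype.card V : ℝ) ^ 2 := by
  obtain ⟨C, hC, hhub⟩ := exists_hub t ht
  have hC' : (1 : ℝ) ≤ C := by exact_mod_cast hC
  have ht' : (2 : ℝ) ≤ t := by exact_mod_cast ht
  obtain ⟨δ, hδ⟩ : ∃ δ : ℝ, δ = 1 / (40 * C * t) := ⟨_, rfl⟩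
  have hδ0 : 0 < δ := by rw [hδ]; positivity
  obtain ⟨M, hM⟩ : ∃ M, M = (2 * t + 1) * t := ⟨_, rfl⟩
  obtain ⟨ε, hε⟩ : ∃ ε : ℝ, ε = min (κ / (4 * C)) (min (1 / C) (δ ^ 2 / 2)) := ⟨_, rfl⟩
  have hε0 : 0 < ε := by rw [hε]; positivity
  have hε1 : ε ≤ κ / (4 * C) := by rw [hε]; exact min_le_left _ _
  have hε2 : ε ≤ 1 / C := by rw [hε]; exact (min_le_right _ _).trans (min_le_left _ _)
  have hε3 : ε ≤ δ ^ 2 / 2 := by rw [hε]; exact (min_le_right _ _).trans (min_le_right _ _)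
  rw [le_div_iff₀ (by positivity)] at hε1 hε2
  obtain ⟨N₁, hN₁⟩ := card_not_perf_le t ht C₁ hε0
  obtain ⟨N₂, hN₂⟩ := exists_nat_ge (2 * M / κ)
  obtain ⟨N₃, hN₃⟩ := exists_nat_ge (2 * (M + 4 * t) / δ ^ 2)
  rw [div_le_iff₀ (by positivity)] at hN₂ hN₃
  obtain ⟨K, hK⟩ : ∃ K, K = C * (1 + 100 * (M + 1)) := ⟨_, rfl⟩
  refine ⟨N₁ + N₂ + N₃ + K, ?_⟩
  intro V _ _ H hn hH hfree hcard
  have hNP := hN₁ V H (by omega) hH hfree hcard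
  have hn2 : (N₂ : ℝ) ≤ Fintype.card V := by exact_mod_cast (by omega)
  have hn3 : (N₃ : ℝ) ≤ Fintype.card V := by exact_mod_cast (by omega)
  have hnK : K ≤ Fintype.card V := by omega
  have hCn : C ≤ Fintype.card V :=
    le_trans (by rw [hK]; exact Nat.le_mul_of_pos_right _ (by omega)) hnK
  have hnpos : 0 < Fintype.card V := by omega
  obtain ⟨s, hs⟩ := hhub V H hCn hH hfree (by
    have : (C : ℝ) * (Finset.univ.filter fun p : V × V => ¬ Perf t H p.1 p.2).card ≤
        (Fintype.card V : ℝ) ^ 2 := by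
      calc _ ≤ (C : ℝ) * (ε * (Fintype.card V : ℝ) ^ 2) := by gcongr
        _ = (ε * C) * (Fintype.card V : ℝ) ^ 2 := by ring
        _ ≤ 1 * (Fintype.card V : ℝ) ^ 2 := by gcongr
        _ = _ := one_mul _
    exact_mod_cast this)
  have hMt : t ≤ M := by rw [hM]; nlinarith
  have hbig : C * (100 * (M + 1)) < Fintype.card V := by nlinarith
  have hcancel : ∀ c Q : ℕ, c ≤ 100 * (M + 1) → Fintype.card V ^ 2 ≤ C * Q →
      Fintype.card V * c < Q := by
    intro c Q hc hQ
    by_contra! h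
    have h1 : C * Q ≤ C * (Fintype.card V * c) := Nat.mul_le_mul_left _ h
    have h2 : C * (Fintype.card V * c) ≤ Fintype.card V * (C * (100 * (M + 1))) := by
      rw [mul_left_comm]; gcongr
    have h3 : Fintype.card V * (C * (100 * (M + 1))) < Fintype.card V * Fintype.card V :=
      Nat.mul_lt_mul_of_pos_left hbig hnpos
    rw [sq] at hQ
    omega
  obtain ⟨S, hS, hΓ⟩ := exists_apexPairs (s := s) hH hfree ht (by
    have := hcancel (4 * ((2 * t + 1) * (2 * t))) _ (by rw [hM]; nlinarith) hs
    linarith)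
  have hcancel' : ∀ c : ℕ, c + 10 * t ≤ 100 * (M + 1) →
      Fintype.card V * c < (apexPairs t H S).card := by
    intro c hc
    have := hcancel (c + 10 * t) _ hc hs
    nlinarith
  have hpairs : 2 * Fintype.card V * (3 * t + 2) < (apexPairs t H S).card := by
    have := hcancel' (2 * (3 * t + 2)) (by omega)
    linarith
  have hP2 : Fintype.card V ^ 2 ≤ 2 * C * (apexPairs t H S).card := by
    have := hcancel' (10 * t) (by omega)
    calc _ ≤ _ := hs
      _ ≤ C * (2 * (apexPairs t H S).card) := by gcongr; linarith
      _ = _ := by ring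
  have hnN : Fintype.card V ≤ 2 * C * (hubNbrs t H S).card := by
    have h1 : (apexPairs t H S).card ≤ Fintype.card V * (hubNbrs t H S).card := by
      rw [← Finset.card_univ, ← Finset.card_product]
      exact Finset.card_le_card fun p hp => by
        simpa using right_mem_hubNbrs hp
    refine Nat.le_of_mul_le_mul_left ?_ hnpos
    calc _ = Fintype.card V ^ 2 := (sq _).symm
      _ ≤ 2 * C * (Fintype.card V * (hubNbrs t H S).card) := hP2.trans (by gcongr)
      _ = _ := by ring
  have hbad := card_hub_apex_ne_le hH hfree ht hS hpairs
  rw [← hM] at hbad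
  obtain ⟨n, hndef⟩ : ∃ n : ℕ, n = Fintype.card V := ⟨_, rfl⟩
  rw [← hndef] at hbad hnN hNP hn2 hn3 hnpos hbig ⊢
  have hn0 : (0 : ℝ) < n := by exact_mod_cast hnpos
  have hbad' : (((hubNbrs t H S ×ˢ hubNbrs t H S).filter fun p =>
      apex t H p.1 p.2 ≠ S).card : ℝ) ≤ ε * (n : ℝ) ^ 2 + n * M := by
    refine (Nat.cast_le (α := ℝ).2 hbad).trans ?_
    push_cast
    gcongr
  have hL : ∀ a ∉ S, ((hubNbrs t H S).filter fun y => Thick t H a y).card ≤ ⌊δ * n⌋₊ := by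
    intro a ha
    refine Nat.le_floor ?_
    have h1 := sq_card_hub_thick_le hH hfree hS ha
    rw [← hndef] at h1
    have h2 : ((((hubNbrs t H S).filter fun y => Thick t H a y).card : ℝ)) ^ 2 ≤
        ε * (n : ℝ) ^ 2 + n * M + 2 * n * (2 * t) := by
      refine le_trans (by exact_mod_cast Nat.cast_le (α := ℝ).2 h1) (add_le_add_left hbad' _)
    refine abs_le_of_sq_le_sq' ?_ (by positivity) |>.2
    refine h2.trans ?_
    have h3 : (2 * ((M : ℝ) + 4 * t)) * n ≤ (n * δ ^ 2) * n :=
      mul_le_mul_of_nonneg_right (hN₃.trans (by gcongr)) hn0.le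
    have h4 : ε * (n : ℝ) ^ 2 ≤ δ ^ 2 / 2 * (n : ℝ) ^ 2 := by gcongr
    nlinarith
  have hO := card_compl_hub_mul_le hH hfree ht hS hpairs hL
  refine ⟨S, hS, ?_, ?_⟩
  · obtain ⟨O, hOdef⟩ : ∃ O : ℕ, O = (S ∪ hubNbrs t H S)ᶜ.card := ⟨_, rfl⟩
    rw [← hOdef] at hO ⊢
    have hO' : (O : ℝ) * (hubNbrs t H S).card ≤
        ε * (n : ℝ) ^ 2 + O * (5 * t + 5 * t * (δ * n)) := by
      refine le_trans (b := ((Finset.univ.filter fun p : V × V => ¬ Perf t H p.1 p.2).card : ℝ) +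
        O * (5 * t + 5 * t * (⌊δ * n⌋₊ : ℝ))) (by exact_mod_cast hO) ?_
      gcongr
      exact Nat.floor_le (by positivity)
    have hnN' : (n : ℝ) ≤ 2 * C * (hubNbrs t H S).card := by exact_mod_cast hnN
    have h1 : 40 * C * t * δ = 1 := by rw [hδ]; field_simp
    have h2 : (C : ℝ) * (100 * (t + 1)) ≤ n := by
      have : C * (100 * (t + 1)) ≤ n := le_trans (by gcongr) hbig.le
      exact_mod_cast this
    exact le_mul_of_self_improving (Nat.cast_nonneg _) (Nat.cast_nonneg _) hn0
      hnN' hO' h1 h2 hε1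
  · clear hO hL hcancel hcancel' hhub
    refine hbad'.trans ?_
    have h1 : 2 * (M : ℝ) * n ≤ (n * κ) * n :=
      mul_le_mul_of_nonneg_right (hN₂.trans (by gcongr)) hn0.le
    have h2 : ε ≤ κ / 2 := by nlinarith
    have h3 : ε * (n : ℝ) ^ 2 ≤ κ / 2 * (n : ℝ) ^ 2 := by gcongr
    nlinarith

section Exact

variable {V : Type*} [Fintype V] [DecidableEq V] {H : Finset (Finset V)} {t : ℕ} {S : Finset V}

theorem not_thick_of_disjoint (hH : ∀ e ∈ H, e.card = 3) (hfree : ¬ ContainsFanExp t H)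
    (hS : S.card = t) (hpairs : 2 * Fintype.card V * (2 * t + 3) < (apexPairs t H S).card)
    {e : Finset V} (he : e ∈ H) (hd : Disjoint e S) {a b s : V} (ha : a ∈ e) (hb : b ∈ e)
    (hab : a ≠ b) (hs : s ∈ S) (has : Thick t H a s) : ¬ Thick t H b s := by
  intro hbs
  obtain ⟨r, rfl, -⟩ := exists_eq_triple_of_mem (hH e he) ha hb hab
  have hsr : s ≠ r := by
    rintro rfl
    exact Finset.disjoint_left.1 hd (by simp) hs
  have hF : Flex t H s {a, b, r} := flex_far hH he has.symm hbs.symm hsr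
  have he3 := hH _ he
  obtain ⟨J, hJ, hJc, hJd, hJe⟩ := exists_disjoint_apexPairs' t ({a, b, r} : Finset V)
    (lt_of_le_of_lt (Nat.mul_le_mul_left _ (by omega)) hpairs)
  obtain ⟨q, -⟩ := Finset.card_pos.1 (show 0 < J.card by
    rw [hJc, ← hS]; exact Finset.card_pos.2 ⟨s, hs⟩)
  have : Nonempty (V × V) := ⟨q⟩
  obtain ⟨p, hpJ, hp⟩ := exists_injOn_of_card_le S J (by omega)
  have hpS : ∀ i ∈ S, Disjoint S {(p i).1, (p i).2} := fun i hi =>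
    disjoint_of_mem_apexPairs hH (hJ (hpJ i hi))
  refine hfree (containsFanExp_of_finset (v := s) S hS.ge
    (fun i => if i = s then {a, b, r} else {(p i).1, (p i).2, i}) (fun i hi => ?_)
    fun i hi j hj hij => ?_)
  · have hap := mem_apexPairs.1 (hJ (hpJ i hi))
    split_ifs with his
    · exact hF
    · exact flex_apex_center hH (by rwa [hap]) (by rwa [hap]) (Ne.symm his)
  · have key : ∀ j ∈ S, j ≠ s → Disjoint ({a, b, r} : Finset V) {(p j).1, (p j).2, j} := by
      intro j hj _
      have h1 := hJe _ (hpJ j hj)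
      have h2 : j ∉ ({a, b, r} : Finset V) := Finset.disjoint_right.1 hd hj
      rw [disjoint_comm]
      simp only [Finset.disjoint_insert_left, Finset.disjoint_singleton_left] at h1 ⊢
      exact ⟨h1.1, h1.2, h2⟩
    split_ifs with his hjs hjs
    · exact (hij (his.trans hjs.symm)).elim
    · exact key j hj hjs
    · exact (key i hi his).symm
    · have d1 := hJd _ (hpJ i hi) _ (hpJ j hj) fun h => hij (hp i hi j hj h)
      have d2 := Finset.disjoint_left.1 (hpS j hj) hi
      have d3 := Finset.disjoint_left.1 (hpS i hi) hj
      simp only [Finset.disjoint_insert_left, Finset.disjoint_singleton_left, Finset.mem_insert,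
        Finset.mem_singleton, not_or] at d1 d2 d3 ⊢
      exact ⟨⟨d1.1.1, d1.1.2, Ne.symm d3.1⟩, ⟨d1.2.1, d1.2.2, Ne.symm d3.2⟩, d2.1, d2.2, hij⟩

open scoped Classical in
/-- The vertices outside `S` forming a thick pair with no element of `S`. -/
noncomputable def nonNbrs (t : ℕ) (H : Finset (Finset V)) (S : Finset V) : Finset V :=
  Finset.univ.filter fun y => y ∉ S ∧ ∀ s ∈ S, ¬ Thick t H y s

theorem mem_nonNbrs {y : V} : y ∈ nonNbrs t H S ↔ y ∉ S ∧ ∀ s ∈ S, ¬ Thick t H y s := by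
  simp [nonNbrs]

theorem disjoint_hubNbrs_nonNbrs (hS : S.Nonempty) :
    Disjoint (hubNbrs t H S) (nonNbrs t H S) := by
  obtain ⟨s, hs⟩ := hS
  exact Finset.disjoint_left.2 fun x hx hy => (mem_nonNbrs.1 hy).2 s hs (mem_hubNbrs.1 hx s hs)

theorem nonNbrs_subset (hS : S.Nonempty) : nonNbrs t H S ⊆ (S ∪ hubNbrs t H S)ᶜ := by
  intro y hy
  simp only [Finset.mem_compl, Finset.mem_union, not_or]
  exact ⟨(mem_nonNbrs.1 hy).1, Finset.disjoint_right.1 (disjoint_hubNbrs_nonNbrs hS) hy⟩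

open scoped Classical in
theorem card_not_thick_ge (hS : S.card = t) (ht : 1 ≤ t) :
    (S ∪ hubNbrs t H S)ᶜ.card + (t - 1) * (nonNbrs t H S).card ≤
      (((S ∪ hubNbrs t H S)ᶜ ×ˢ S).filter fun p => ¬ Thick t H p.1 p.2).card := by
  rw [← sum_card_filter_eq (S ∪ hubNbrs t H S)ᶜ S fun y s => ¬ Thick t H y s]
  have hne : S.Nonempty := Finset.card_pos.1 (by omega)
  calc (S ∪ hubNbrs t H S)ᶜ.card + (t - 1) * (nonNbrs t H S).card
      = ∑ y ∈ (S ∪ hubNbrs t H S)ᶜ, (1 + if y ∈ nonNbrs t H S then t - 1 else 0) := by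
        rw [Finset.sum_add_distrib, Finset.sum_const, smul_eq_mul, mul_one, Finset.sum_ite_mem,
          Finset.inter_eq_right.2 (nonNbrs_subset hne), Finset.sum_const, smul_eq_mul, mul_comm]
    _ ≤ _ := by
        refine Finset.sum_le_sum fun y hy => ?_
        split_ifs with h
        · rw [Finset.filter_true_of_mem (mem_nonNbrs.1 h).2]
          omega
        · simp only [Finset.mem_compl, Finset.mem_union, mem_hubNbrs, not_or, not_forall] at hy
          obtain ⟨-, s, hs, hsy⟩ := hy
          exact Finset.card_pos.2 ⟨s, Finset.mem_filter.2 ⟨hs, hsy⟩⟩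

open scoped Classical in
/-- Every thin pair between `S` and the remaining vertices misses many hyperedges. -/
theorem card_missing_ge (hH : ∀ e ∈ H, e.card = 3) :
    (((S ∪ hubNbrs t H S)ᶜ ×ˢ S).filter fun p => ¬ Thick t H p.1 p.2).card *
        ((hubNbrs t H S).card - (5 * t + 7)) ≤
      ((Finset.univ.powersetCard 3).filter fun e => ¬ Disjoint e S ∧ e ∉ H).card := by
  set W := ((S ∪ hubNbrs t H S)ᶜ ×ˢ S).filter fun p => ¬ Thick t H p.1 p.2 with hW
  have hNS := disjoint_hubNbrs (S := S) (t := t) hH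
  calc W.card * ((hubNbrs t H S).card - (5 * t + 7))
      ≤ ∑ p ∈ W, ((hubNbrs t H S).filter fun z => z ∉ cod H p.1 p.2).card := by
        rw [← smul_eq_mul]
        refine Finset.card_nsmul_le_sum _ _ _ fun p hp => ?_
        have h1 := (Finset.mem_filter.1 hp).2
        rw [Thick, not_le] at h1
        have h2 := Finset.le_card_sdiff (cod H p.1 p.2) (hubNbrs t H S)
        rw [Finset.filter_notMem_eq_sdiff]
        omega
    _ = ((W ×ˢ hubNbrs t H S).filter fun q => q.2 ∉ cod H q.1.1 q.1.2).card :=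
        sum_card_filter_eq W (hubNbrs t H S) fun p z => z ∉ cod H p.1 p.2
    _ ≤ _ := by
        have hprop : ∀ q ∈ (W ×ˢ hubNbrs t H S).filter fun q => q.2 ∉ cod H q.1.1 q.1.2,
            (q.1.1 ∉ S ∧ q.1.1 ∉ hubNbrs t H S) ∧ q.1.2 ∈ S ∧ q.2 ∈ hubNbrs t H S ∧
              ({q.1.1, q.1.2, q.2} : Finset V) ∉ H := by
          intro q hq
          simp only [hW, Finset.mem_filter, Finset.mem_product, Finset.mem_compl, Finset.mem_union,
            not_or, mem_cod] at hq
          exact ⟨hq.1.1.1.1, hq.1.1.1.2, hq.1.2, hq.2⟩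
        refine Finset.card_le_card_of_injOn (fun q => {q.1.1, q.1.2, q.2}) (fun q hq => ?_) ?_
        · obtain ⟨⟨h1, h2⟩, h3, h4, h5⟩ := hprop q hq
          simp only [Finset.coe_filter, Set.mem_ofPred_eq, Finset.mem_powersetCard,
            Finset.subset_univ, true_and]
          refine ⟨Finset.card_eq_three.2 ⟨_, _, _, ?_, ?_, ?_, rfl⟩, ?_, h5⟩
          · exact fun h => h1 (h ▸ h3)
          · exact fun h => h2 (h ▸ h4)
          · exact fun h => Finset.disjoint_left.1 hNS h3 (h ▸ h4)
          · exact Finset.not_disjoint_iff.2 ⟨q.1.2, by simp, h3⟩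
        · rintro ⟨⟨y, s⟩, z⟩ hq ⟨⟨y', s'⟩, z'⟩ hq' heq
          obtain ⟨⟨h1, h2⟩, h3, h4, h5⟩ := hprop _ hq
          obtain ⟨⟨h1', h2'⟩, h3', h4', h5'⟩ := hprop _ hq'
          dsimp only at *
          have hSz : z ∉ S := fun h => Finset.disjoint_left.1 hNS h h4
          have hSz' : z' ∉ S := fun h => Finset.disjoint_left.1 hNS h h4'
          have e1 : s ∈ ({y', s', z'} : Finset V) := heq ▸ (by simp)
          have e2 : y ∈ ({y', s', z'} : Finset V) := heq ▸ (by simp)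
          have e3 : z ∈ ({y', s', z'} : Finset V) := heq ▸ (by simp)
          simp only [Finset.mem_insert, Finset.mem_singleton] at e1 e2 e3
          have f1 : s = s' := by
            rcases e1 with rfl | h | rfl
            · exact (h1' h3).elim
            · exact h
            · exact (hSz' h3).elim
          have f2 : y = y' := by
            rcases e2 with h | rfl | rfl
            · exact h
            · exact (h1 h3').elim
            · exact (h2 h4').elim
          have f3 : z = z' := by
            rcases e3 with rfl | rfl | h
            · exact (h2' h4).elim
            · exact (hSz h3').elim
            · exact h
          rw [f1, f2, f3]

end Exact

section Cross

variable {V : Type*} [Fintype V] [DecidableEq V] {H : Finset (Finset V)} {t : ℕ} {S : Finset V}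

/-- The outer vertices of two hyperedges through `y` whose hub vertices form an apex pair. -/
def CrossCore (t : ℕ) (H : Finset (Finset V)) (S : Finset V) (y : V) (A : Finset V) : Prop :=
  ∃ x x' y₁ y₂ : V, A = {x, x', y₁, y₂} ∧ (x, x') ∈ apexPairs t H S ∧ y₁ ∈ nonNbrs t H S ∧
    y₂ ∈ nonNbrs t H S ∧ y₁ ≠ y₂ ∧ ({y, x, y₁} : Finset V) ∈ H ∧ ({y, x', y₂} : Finset V) ∈ H

theorem containsFanExp_of_crossCore (hH : ∀ e ∈ H, e.card = 3) (hS : S.card = t)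
    (hne : S.Nonempty) {y : V} (hy : y ∈ nonNbrs t H S) (f : Fin t → Finset V)
    (hf : ∀ i, CrossCore t H S y (f i))
    (hd : ∀ i j, i ≠ j → Disjoint (f i) (f j)) : ContainsFanExp t H := by
  choose x x' y₁ y₂ hA hxx h1 h2 h12 he1 he2 using hf
  let e : Fin t ≃ S := (Fin.castOrderIso hS.symm).toEquiv.trans S.equivFin.symm
  have hNS := disjoint_hubNbrs (S := S) (t := t) hH
  have hns : ∀ i z, z ∈ f i → z ∉ S := by
    intro i z hz hzS
    have hx := Finset.disjoint_left.1 hNS hzS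
    have hz' : z ∉ nonNbrs t H S := fun h => (mem_nonNbrs.1 h).1 hzS
    rw [hA] at hz
    simp only [Finset.mem_insert, Finset.mem_singleton] at hz
    rcases hz with rfl | rfl | rfl | rfl
    · exact hx (left_mem_hubNbrs (hxx i))
    · exact hx (right_mem_hubNbrs (hxx i))
    · exact hz' (h1 i)
    · exact hz' (h2 i)
  have hsep : ∀ a ∈ hubNbrs t H S, ∀ b ∈ nonNbrs t H S, a ≠ b := fun a ha b hb =>
    Finset.disjoint_iff_ne.1 (disjoint_hubNbrs_nonNbrs hne) a ha b hb
  refine containsFanExp_of_petals (v := y) (fun i => insert (e i : V) (f i)) (fun i => ?_)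
    fun i j hij => ?_
  · have hes : (({x i, x' i, (e i : V)} : Finset V)) ∈ H := by
      have : (e i : V) ∈ apex t H (x i) (x' i) := by
        rw [mem_apexPairs.1 (hxx i)]; exact (e i).2
      exact (mem_apex.1 this).1
    have hne0 := ne_of_triple hH hes
    have hne1 := ne_of_triple hH (he1 i)
    have hne2 := ne_of_triple hH (he2 i)
    refine ⟨x i, x' i, y₁ i, y₂ i, e i, ?_, ?_, he1 i, he2 i, hes⟩
    · have hb1 := hsep _ (left_mem_hubNbrs (hxx i)) _ (h2 i)
      have hb2 := hsep _ (right_mem_hubNbrs (hxx i)) _ (h1 i)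
      have hc0 : y ≠ e i := fun h => (mem_nonNbrs.1 hy).1 (h ▸ (e i).2)
      have hc1 : y₁ i ≠ e i := fun h => (mem_nonNbrs.1 (h1 i)).1 (h ▸ (e i).2)
      have hc2 : y₂ i ≠ e i := fun h => (mem_nonNbrs.1 (h2 i)).1 (h ▸ (e i).2)
      simp only [List.nodup_cons, List.mem_cons, List.not_mem_nil, or_false, not_or,
        List.nodup_nil, not_false_eq_true, and_true]
      exact ⟨⟨hne1.1, hne2.1, hne1.2.1, hne2.2.1, hc0⟩, ⟨hne0.1, hne1.2.2, hb1, hne0.2.1⟩,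
        ⟨hb2, hne2.2.2, hne0.2.2⟩, ⟨h12 i, hc1⟩, hc2⟩
    · rw [hA]
      ext z
      simp only [Finset.mem_insert, Finset.mem_singleton]
      tauto
  · rw [Finset.disjoint_insert_left, Finset.disjoint_insert_right, Finset.mem_insert]
    exact ⟨fun h => h.elim (fun h => hij (e.injective (Subtype.ext h)))
      fun h => hns j _ h (e i).2, fun h => hns i _ h (e j).2, hd i j hij⟩

open scoped Classical in
theorem exists_link_cover (hH : ∀ e ∈ H, e.card = 3) (hfree : ¬ ContainsFanExp t H)
    (ht : 2 ≤ t) (hS : S.card = t) {g : ℕ}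
    (hg : ((hubNbrs t H S).filter fun x =>
      g < ((hubNbrs t H S).filter fun x' => apex t H x x' ≠ S).card).card ≤ g) {y : V}
    (hy : y ∈ nonNbrs t H S) :
    ∃ U : Finset V, U.card ≤ 2 * t - 1 ∧ ((hubNbrs t H S).filter fun x =>
      ∃ y' ∈ nonNbrs t H S, y' ∉ U ∧ ({y, x, y'} : Finset V) ∈ H).card ≤ 2 * t + g := by
  have hne : S.Nonempty := Finset.card_pos.1 (by omega)
  have hNY := disjoint_hubNbrs_nonNbrs (t := t) (H := H) hne
  rcases exists_disjoint_or_hitting (CrossCore t H S y) t with ⟨f, hf, hd⟩ | ⟨s, hst, hs, hit⟩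
  · exact (hfree (containsFanExp_of_crossCore hH hS hne hy f hf hd)).elim
  set W := s.biUnion id with hW
  have hcard : ∀ X : Finset V, (∀ A ∈ s, (A ∩ X).card ≤ 2) → (W ∩ X).card ≤ 2 * (t - 1) := by
    intro X hX
    rw [hW, Finset.biUnion_inter]
    exact (Finset.card_biUnion_le_card_mul _ _ 2 hX).trans (by omega)
  have hWY : (W ∩ nonNbrs t H S).card ≤ 2 * (t - 1) := by
    refine hcard _ fun A hA => ?_
    obtain ⟨x, x', y₁, y₂, rfl, hxx, -⟩ := hs A hA
    refine (Finset.card_le_card (t := {y₁, y₂}) fun z hz => ?_).trans Finset.card_le_two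
    simp only [Finset.mem_inter, Finset.mem_insert, Finset.mem_singleton] at hz ⊢
    obtain ⟨rfl | rfl | h | h, hzY⟩ := hz
    · exact (Finset.disjoint_left.1 hNY (left_mem_hubNbrs hxx) hzY).elim
    · exact (Finset.disjoint_left.1 hNY (right_mem_hubNbrs hxx) hzY).elim
    · exact Or.inl h
    · exact Or.inr h
  have hWN : (W ∩ hubNbrs t H S).card ≤ 2 * (t - 1) := by
    refine hcard _ fun A hA => ?_
    obtain ⟨x, x', y₁, y₂, rfl, -, h1, h2, -⟩ := hs A hA
    refine (Finset.card_le_card (t := {x, x'}) fun z hz => ?_).trans Finset.card_le_two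
    simp only [Finset.mem_inter, Finset.mem_insert, Finset.mem_singleton] at hz ⊢
    obtain ⟨h | h | rfl | rfl, hzN⟩ := hz
    · exact Or.inl h
    · exact Or.inr h
    · exact (Finset.disjoint_left.1 hNY hzN h1).elim
    · exact (Finset.disjoint_left.1 hNY hzN h2).elim
  by_cases hx₀ : ∃ x₀ ∈ hubNbrs t H S, x₀ ∉ W ∧
      ((hubNbrs t H S).filter fun x' => apex t H x₀ x' ≠ S).card ≤ g ∧
      ∃ y₁ ∈ nonNbrs t H S, y₁ ∉ W ∧ ({y, x₀, y₁} : Finset V) ∈ H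
  · obtain ⟨x₀, hx₀, hx₀W, hx₀g, y₁, hy₁, hy₁W, he₁⟩ := hx₀
    refine ⟨insert y₁ (W ∩ nonNbrs t H S), (Finset.card_insert_le _ _).trans (by omega), ?_⟩
    refine (Finset.card_le_card (t := (W ∩ hubNbrs t H S) ∪
      (hubNbrs t H S).filter fun x' => apex t H x₀ x' ≠ S) fun x hx => ?_).trans
      ((Finset.card_union_le _ _).trans (by omega))
    obtain ⟨hxN, y', hy', hy'U, he'⟩ := Finset.mem_filter.1 hx
    simp only [Finset.mem_insert, Finset.mem_inter, hy', and_true, not_or] at hy'U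
    simp only [Finset.mem_union, Finset.mem_inter, Finset.mem_filter, hxN, and_true, true_and]
    by_contra! hcon
    refine hit {x₀, x, y₁, y'} ⟨x₀, x, y₁, y', rfl, mem_apexPairs.2 hcon.2, hy₁, hy',
      Ne.symm hy'U.1, he₁, he'⟩ ?_
    simp [hx₀W, hcon.1, hy₁W, hy'U.2]
  · push Not at hx₀
    refine ⟨W ∩ nonNbrs t H S, by omega, ?_⟩
    refine (Finset.card_le_card (t := (W ∩ hubNbrs t H S) ∪ (hubNbrs t H S).filter fun x =>
      g < ((hubNbrs t H S).filter fun x' => apex t H x x' ≠ S).card) fun x hx => ?_).trans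
      ((Finset.card_union_le _ _).trans (by omega))
    obtain ⟨hxN, y', hy', hy'U, he'⟩ := Finset.mem_filter.1 hx
    simp only [Finset.mem_inter, hy', and_true] at hy'U
    simp only [Finset.mem_union, Finset.mem_inter, Finset.mem_filter, hxN, and_true, true_and]
    by_contra! hcon
    exact hx₀ x hxN hcon.1 hcon.2 y' hy' hy'U he'

end Cross

section CrossCount

variable {V : Type*} [Fintype V] [DecidableEq V] {H : Finset (Finset V)} {t : ℕ}

open scoped Classical in
/-- Hyperedges with one vertex in `N` and two in `Y` are few when, for each `y ∈ Y`, all but few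
link edges of `y` between `N` and `Y` end in a small set `U y`. -/
theorem two_mul_card_cross_le (hH : ∀ e ∈ H, e.card = 3) (hfree : ¬ ContainsFanExp t H)
    {N Y : Finset V} {U R : V → Finset V} {u r : ℕ} (hU : ∀ y ∈ Y, (U y).card ≤ u)
    (hr : ∀ y ∈ Y, (R y).card ≤ r)
    (hR : ∀ x ∈ N, ∀ y ∈ Y, ∀ y' ∈ Y, ({y, x, y'} : Finset V) ∈ H → y' ∉ U y → x ∈ R y) :
    2 * (H.filter fun e => ∃ y ∈ Y, ∃ x ∈ N, ∃ y' ∈ Y, e = {y, x, y'}).card ≤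
      Y.card * (u * N.card) + 2 * (Y.card * (u * r)) +
        2 * ((5 * t + 7) * (Y.card * r + Y.card ^ 2)) := by
  set A := H.filter fun e => ∃ y ∈ Y, ∃ x ∈ N, ∃ y' ∈ Y, y' ∈ U y ∧ y ∈ U y' ∧ e = {y, x, y'}
    with hA
  set B := H.filter fun e => ∃ y ∈ Y, ∃ y' ∈ Y, ∃ x, y' ∈ U y ∧ x ∈ R y' ∧ e = {y, x, y'} with hB
  set E := H.filter fun e => ∃ y ∈ Y, ∃ y' ∈ Y, ∃ x, x ∈ R y ∧ x ∈ R y' ∧ e = {y, x, y'} with hE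
  have hsub : (H.filter fun e => ∃ y ∈ Y, ∃ x ∈ N, ∃ y' ∈ Y, e = {y, x, y'}) ⊆ A ∪ (B ∪ E) := by
    intro e he
    obtain ⟨heH, y, hy, x, hx, y', hy', rfl⟩ := Finset.mem_filter.1 he
    have heH' : ({y', x, y} : Finset V) ∈ H := by rwa [triple_reverse]
    have h1 := hR x hx y hy y' hy' heH
    have h2 := hR x hx y' hy' y hy heH'
    simp only [hA, hB, hE, Finset.mem_union, Finset.mem_filter, heH, true_and]
    by_cases c1 : y' ∈ U y <;> by_cases c2 : y ∈ U y'
    · exact Or.inl ⟨y, hy, x, hx, y', hy', c1, c2, rfl⟩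
    · exact Or.inr (Or.inl ⟨y, hy, y', hy', x, c1, h2 c2, rfl⟩)
    · exact Or.inr (Or.inl ⟨y', hy', y, hy, x, c2, h1 c1, triple_reverse _ _ _⟩)
    · exact Or.inr (Or.inr ⟨y, hy, y', hy', x, h1 c1, h2 c2, rfl⟩)
  have hcA : 2 * A.card ≤ Y.card * (u * N.card) := by
    set Q := (Y.sigma fun y => ((U y).filter fun y' => y' ∈ Y ∧ y ∈ U y') ×ˢ N).filter fun q =>
      ({q.1, q.2.2, q.2.1} : Finset V) ∈ H with hQ
    have h1 : Q.card ≤ Y.card * (u * N.card) := by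
      refine (Finset.card_filter_le _ _).trans ?_
      rw [Finset.card_sigma, ← smul_eq_mul]
      refine Finset.sum_le_card_nsmul _ _ _ fun y hy => ?_
      rw [Finset.card_product]
      exact Nat.mul_le_mul_right _ ((Finset.card_filter_le _ _).trans (hU y hy))
    refine le_trans ?_ h1
    rw [Finset.card_eq_sum_card_fiberwise (s := Q) (t := A)
      (f := fun q => {q.1, q.2.2, q.2.1}) ?_, mul_comm, ← smul_eq_mul]
    · refine Finset.card_nsmul_le_sum _ _ _ fun e he => ?_
      obtain ⟨heH, y, hy, x, hx, y', hy', h1, h2, rfl⟩ := Finset.mem_filter.1 he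
      refine Finset.one_lt_card.2 ⟨⟨y, y', x⟩, ?_, ⟨y', y, x⟩, ?_, ?_⟩
      · simp [hQ, hy, hy', hx, h1, h2, heH]
      · simp [hQ, hy, hy', hx, h1, h2, triple_reverse y' x y, heH]
      · intro h
        exact (ne_of_triple hH heH).2.1 (Sigma.mk.inj_iff.1 h).1
    · intro q hq
      simp only [hQ, Finset.coe_filter, Set.mem_ofPred_eq, Finset.mem_sigma, Finset.mem_product,
        Finset.mem_filter] at hq
      simp only [hA, Finset.coe_filter, Set.mem_ofPred_eq]
      exact ⟨hq.2, q.1, hq.1.1, q.2.2, hq.1.2.2, q.2.1, hq.1.2.1.2.1, hq.1.2.1.1,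
        hq.1.2.1.2.2, rfl⟩
  have hcB : B.card ≤ Y.card * (u * r) := by
    have hBsub : B ⊆ Y.biUnion fun y => ((U y).filter fun y' => y' ∈ Y).biUnion fun y' =>
        (R y').image fun x => {y, x, y'} := by
      intro e he
      obtain ⟨-, y, hy, y', hy', x, h1, h2, rfl⟩ := Finset.mem_filter.1 he
      simp only [Finset.mem_biUnion, Finset.mem_filter, Finset.mem_image]
      exact ⟨y, hy, y', ⟨h1, hy'⟩, x, h2, rfl⟩
    refine (Finset.card_le_card hBsub).trans (Finset.card_biUnion_le_card_mul _ _ _ fun y hy => ?_)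
    refine (Finset.card_biUnion_le_card_mul _ _ r fun y' hy' => ?_).trans
      (Nat.mul_le_mul_right _ ((Finset.card_filter_le _ _).trans (hU y hy)))
    exact Finset.card_image_le.trans (hr y' (Finset.mem_filter.1 hy').2)
  have hcE : E.card ≤ (5 * t + 7) * (Y.card * r + Y.card ^ 2) := by
    have hEH : E ⊆ H := Finset.filter_subset _ _
    refine (card_le_shadow (fun e he => hH e (hEH he)) (fun h => hfree (h.mono hEH))
      ((Y.biUnion fun y => (R y).image fun x => {y, x}) ∪
        (Y ×ˢ Y).image fun p => {p.1, p.2}) ?_).trans ?_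
    · intro e he a ha b hb hab
      obtain ⟨-, y, hy, y', hy', x, h1, h2, rfl⟩ := Finset.mem_filter.1 he
      simp only [Finset.mem_union, Finset.mem_biUnion, Finset.mem_image, Finset.mem_product,
        Prod.exists]
      simp only [Finset.mem_insert, Finset.mem_singleton] at ha hb
      rcases ha with rfl | rfl | rfl <;> rcases hb with rfl | rfl | rfl
      · exact (hab rfl).elim
      · exact Or.inl ⟨_, hy, _, h1, rfl⟩
      · exact Or.inr ⟨_, _, ⟨hy, hy'⟩, rfl⟩
      · exact Or.inl ⟨_, hy, _, h1, Finset.pair_comm _ _⟩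
      · exact (hab rfl).elim
      · exact Or.inl ⟨_, hy', _, h2, Finset.pair_comm _ _⟩
      · exact Or.inr ⟨_, _, ⟨hy', hy⟩, rfl⟩
      · exact Or.inl ⟨_, hy', _, h2, rfl⟩
      · exact (hab rfl).elim
    · refine Nat.mul_le_mul_left _ ((Finset.card_union_le _ _).trans (Nat.add_le_add ?_ ?_))
      · exact Finset.card_biUnion_le_card_mul _ _ _ fun y hy =>
          Finset.card_image_le.trans (hr y hy)
      · refine Finset.card_image_le.trans ?_
        rw [Finset.card_product, sq]
  have h1 := Finset.card_le_card hsub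
  have h2 := Finset.card_union_le A (B ∪ E)
  have h3 := Finset.card_union_le B E
  omega

theorem card_inner_le (hH : ∀ e ∈ H, e.card = 3) (hfree : ¬ ContainsFanExp t H) (Y : Finset V) :
    (H.filter fun e => e ⊆ Y).card ≤ (5 * t + 7) * Y.card ^ 2 := by
  have hEH := Finset.filter_subset (fun e => e ⊆ Y) H
  refine (card_le_shadow (fun e he => hH e (hEH he)) (fun h => hfree (h.mono hEH))
    ((Y ×ˢ Y).image fun p => {p.1, p.2}) ?_).trans ?_
  · intro e he a ha b hb hab
    have heY := (Finset.mem_filter.1 he).2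
    exact Finset.mem_image.2 ⟨(a, b), Finset.mem_product.2 ⟨heY ha, heY hb⟩, rfl⟩
  · refine Nat.mul_le_mul_left _ (Finset.card_image_le.trans ?_)
    rw [Finset.card_product, sq]

end CrossCount

theorem le_missing_of_bounds {t D a b m r E E₁ E₂ M : ℕ} (ht : 2 ≤ t) (hab : a ≤ b)
    (hm : 2 * t * D + 4 * D * b + 2 * (2 * t + D) * r ≤ m) (hE : E ≤ E₁ + E₂)
    (h₁ : E₁ ≤ D * b ^ 2)
    (h₂ : 2 * E₂ ≤ a * ((2 * t - 1) * m) + 2 * (a * ((2 * t - 1) * r)) +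
      2 * (D * (a * r + a ^ 2)))
    (hM : (b + (t - 1) * a) * (m - D) ≤ M) : E ≤ M := by
  have hDm : D + D * b ≤ m := by
    have h : D * 1 ≤ D * (2 * t) := Nat.mul_le_mul_left _ (by omega)
    nlinarith [Nat.zero_le (D * b), Nat.zero_le ((2 * t + D) * r)]
  have hDm' : D ≤ m := le_of_add_le_left hDm
  zify [hDm', (by omega : 1 ≤ t), (by omega : 1 ≤ 2 * t)] at *
  have h1 : 0 ≤ (b - a : ℤ) * (m - (D + D * b)) := mul_nonneg (by linarith) (by linarith)
  have h2 : 0 ≤ (a : ℤ) * (m - (2 * t * D + 4 * D * b + 2 * (2 * t + D) * r)) :=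
    mul_nonneg (Int.natCast_nonneg a) (by linarith)
  have h3 : 0 ≤ (a : ℤ) * (2 * D * (b - a) + 2 * r) := by
    have : (0 : ℤ) ≤ b - a := by linarith
    positivity
  nlinarith

open scoped Classical in
theorem card_exceptional_le {V : Type*} {N : Finset V} {Q : V → V → Prop} [DecidableRel Q]
    {γ : ℝ} (hγ : 0 < γ) {n : ℕ}
    (hn : 0 < n) (h : (((N ×ˢ N).filter fun p => Q p.1 p.2).card : ℝ) ≤ γ ^ 2 * (n : ℝ) ^ 2) :
    (N.filter fun x => ⌊γ * n⌋₊ < (N.filter fun x' => Q x x').card).card ≤ ⌊γ * n⌋₊ := by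
  set X := N.filter fun x => ⌊γ * n⌋₊ < (N.filter fun x' => Q x x').card with hX
  have h1 : X.card * (⌊γ * n⌋₊ + 1) ≤ ((N ×ˢ N).filter fun p => Q p.1 p.2).card := by
    rw [← sum_card_filter_eq N N Q]
    refine le_trans ?_ (Finset.sum_le_sum_of_subset (Finset.filter_subset _ N : X ⊆ N))
    rw [← smul_eq_mul]
    exact Finset.card_nsmul_le_sum _ _ _ fun x hx => (Finset.mem_filter.1 hx).2
  have hpos : 0 < γ * n := by positivity
  have h2 : (X.card : ℝ) * (⌊γ * n⌋₊ + 1) ≤ γ ^ 2 * (n : ℝ) ^ 2 :=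
    le_trans (by exact_mod_cast h1) h
  refine Nat.le_floor (le_of_mul_le_mul_right ?_ hpos)
  calc (X.card : ℝ) * (γ * n) ≤ X.card * (⌊γ * n⌋₊ + 1) := by
        gcongr; exact (Nat.lt_floor_add_one _).le
    _ ≤ _ := h2
    _ = _ := by ring

section Final

variable {V : Type*} [Fintype V] [DecidableEq V] {H : Finset (Finset V)} {t : ℕ} {S : Finset V}

open scoped Classical in
theorem filter_disjoint_subset (hH : ∀ e ∈ H, e.card = 3) (hfree : ¬ ContainsFanExp t H)
    (hS : S.card = t) (hpairs : 2 * Fintype.card V * (2 * t + 3) < (apexPairs t H S).card) :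
    (H.filter fun e => Disjoint e S) ⊆ (H.filter fun e => e ⊆ (S ∪ hubNbrs t H S)ᶜ) ∪
      H.filter fun e => ∃ y ∈ nonNbrs t H S, ∃ x ∈ hubNbrs t H S, ∃ y' ∈ nonNbrs t H S,
        e = {y, x, y'} := by
  intro e he
  obtain ⟨heH, hd⟩ := Finset.mem_filter.1 he
  simp only [Finset.mem_union, Finset.mem_filter, heH, true_and]
  by_cases hx : ∃ x ∈ e, x ∈ hubNbrs t H S
  · right
    obtain ⟨x, hxe, hxN⟩ := hx
    obtain ⟨b, c, rfl, hxb, hxc, -⟩ := exists_eq_triple_of_mem_single (hH e heH) hxe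
    have hnon : ∀ z ∈ ({x, b, c} : Finset V), x ≠ z → z ∈ nonNbrs t H S := fun z hz hxz =>
      mem_nonNbrs.2 ⟨Finset.disjoint_left.1 hd hz, fun s hs =>
        not_thick_of_disjoint hH hfree hS hpairs heH hd hxe hz hxz hs (mem_hubNbrs.1 hxN s hs)⟩
    exact ⟨b, hnon b (by simp) hxb, x, hxN, c, hnon c (by simp) hxc, triple_swap_left _ _ _⟩
  · left
    push Not at hx
    intro z hz
    simp only [Finset.mem_compl, Finset.mem_union, not_or]
    exact ⟨Finset.disjoint_left.1 hd hz, hx z hz⟩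

open scoped Classical in
theorem card_disjoint_le_missing (hH : ∀ e ∈ H, e.card = 3) (hfree : ¬ ContainsFanExp t H)
    (ht : 2 ≤ t) (hS : S.card = t)
    (hpairs : 2 * Fintype.card V * (2 * t + 3) < (apexPairs t H S).card) {g : ℕ}
    (hg : ((hubNbrs t H S).filter fun x =>
      g < ((hubNbrs t H S).filter fun x' => apex t H x x' ≠ S).card).card ≤ g)
    (hN : 2 * t * (5 * t + 7) + 4 * (5 * t + 7) * (S ∪ hubNbrs t H S)ᶜ.card +
      2 * (2 * t + (5 * t + 7)) * (2 * t + g) ≤ (hubNbrs t H S).card) :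
    (H.filter fun e => Disjoint e S).card ≤
      ((Finset.univ.powersetCard 3).filter fun e => ¬ Disjoint e S ∧ e ∉ H).card := by
  have hne : S.Nonempty := Finset.card_pos.1 (by omega)
  choose! U hU hR using fun (y : V) => fun hy : y ∈ nonNbrs t H S =>
    exists_link_cover hH hfree ht hS hg hy
  have hcross := two_mul_card_cross_le hH hfree (N := hubNbrs t H S) hU hR
    fun x hx y _ y' hy' he hyU => Finset.mem_filter.2 ⟨hx, y', hy', hyU, he⟩
  have hinner := card_inner_le hH hfree (S ∪ hubNbrs t H S)ᶜ
  have hsplit := (Finset.card_le_card (filter_disjoint_subset hH hfree hS hpairs)).trans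
    (Finset.card_union_le _ _)
  have hmiss := card_missing_ge (S := S) (t := t) hH
  have hthin := card_not_thick_ge (H := H) hS (by omega)
  have hYY := Finset.card_le_card (nonNbrs_subset (t := t) (H := H) hne)
  have hmiss' := (Nat.mul_le_mul_right ((hubNbrs t H S).card - (5 * t + 7)) hthin).trans hmiss
  exact le_missing_of_bounds ht hYY hN hsplit hinner hcross hmiss'

open scoped Classical in
theorem card_meeting (S : Finset V) :
    ((Finset.univ.powersetCard 3).filter fun e : Finset V => ¬ Disjoint e S).card =
      (Fintype.card V).choose 3 - (Fintype.card V - S.card).choose 3 := by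
  have h1 := Finset.card_filter_add_card_filter_not (s := Finset.univ.powersetCard 3)
    fun e : Finset V => Disjoint e S
  have h2 : ((Finset.univ.powersetCard 3).filter fun e : Finset V => Disjoint e S) =
      Sᶜ.powersetCard 3 := by
    ext e
    simp only [Finset.mem_filter, Finset.mem_powersetCard, Finset.subset_univ, true_and]
    rw [and_comm, Finset.subset_compl_iff_disjoint_right]
  rw [h2, Finset.card_powersetCard, Finset.card_powersetCard, Finset.card_compl,
    Finset.card_univ] at h1
  omega

open scoped Classical in
theorem card_le_of_disjoint_le_missing (hH : ∀ e ∈ H, e.card = 3) (S : Finset V)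
    (h : (H.filter fun e => Disjoint e S).card ≤
      ((Finset.univ.powersetCard 3).filter fun e => ¬ Disjoint e S ∧ e ∉ H).card) :
    H.card ≤ (Fintype.card V).choose 3 - (Fintype.card V - S.card).choose 3 := by
  rw [← card_meeting S]
  have h1 := Finset.card_filter_add_card_filter_not (s := H) fun e => Disjoint e S
  have h2 := Finset.card_filter_add_card_filter_not
    (s := (Finset.univ.powersetCard 3).filter fun e : Finset V => ¬ Disjoint e S) fun e => e ∉ H
  rw [Finset.filter_filter, Finset.filter_filter] at h2
  have h3 : ((Finset.univ.powersetCard 3).filter fun e : Finset V => ¬ Disjoint e S ∧ ¬ e ∉ H) =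
      H.filter fun e => ¬ Disjoint e S := by
    ext e
    simp only [Finset.mem_filter, Finset.mem_powersetCard, Finset.subset_univ, true_and, not_not]
    exact ⟨fun h => ⟨h.2.2, h.2.1⟩, fun h => ⟨hH e h.1, h.2, h.1⟩⟩
  rw [h3] at h2
  omega

end Final

open scoped Classical in
theorem card_le_of_nearly_extremal (t : ℕ) (ht : 2 ≤ t) (C₁ : ℕ) :
    ∃ N : ℕ, ∀ (V : Type) [Fintype V] [DecidableEq V] (H : Finset (Finset V)),
      N ≤ Fintype.card V → (∀ e ∈ H, e.card = 3) → ¬ ContainsFanExp t H →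
      t * Fintype.card V ^ 2 ≤ 2 * H.card + C₁ * Fintype.card V →
      H.card ≤ (Fintype.card V).choose 3 - (Fintype.card V - t).choose 3 := by
  have ht' : (2 : ℝ) ≤ t := by exact_mod_cast ht
  obtain ⟨D, hD⟩ : ∃ D, D = 5 * t + 7 := ⟨_, rfl⟩
  have hD' : (17 : ℝ) ≤ D := by exact_mod_cast (by omega : 17 ≤ D)
  obtain ⟨γ, hγ⟩ : ∃ γ : ℝ, γ = 1 / (2 * (4 * t + 7 * D)) := ⟨_, rfl⟩
  have hγ0 : 0 < γ := by rw [hγ]; positivity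
  have hγ1 : (4 * t + 7 * D) * γ = 1 / 2 := by rw [hγ]; field_simp
  have hγ2 : γ ≤ 1 / 8 := by nlinarith
  have hγγ : γ ^ 2 ≤ γ := by nlinarith
  have hγ8 : γ ^ 2 ≤ 1 / 8 := by linarith
  obtain ⟨N₁, hN₁⟩ := exists_hub_set t ht C₁ (κ := γ ^ 2) (by positivity)
  obtain ⟨K, hK⟩ : ∃ K, K = 2 * (2 * t * D + 4 * t * (2 * t + D) + t) + 16 * (2 * t + 3) + 1 :=
    ⟨_, rfl⟩
  refine ⟨N₁ + K, fun V _ _ H hn hH hfree hcard => ?_⟩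
  obtain ⟨S, hS, hO, hbad⟩ := hN₁ V H (by omega) hH hfree hcard
  have hcompl : (S ∪ hubNbrs t H S)ᶜ.card + (t + (hubNbrs t H S).card) = Fintype.card V := by
    rw [← hS, ← Finset.card_union_of_disjoint (disjoint_hubNbrs hH)]
    exact Finset.card_compl_add_card _
  have hcompl' : ((S ∪ hubNbrs t H S)ᶜ.card : ℝ) + (t + (hubNbrs t H S).card) =
    Fintype.card V := by exact_mod_cast hcompl
  have hnK : (K : ℝ) ≤ Fintype.card V := Nat.cast_le.2 (by omega)
  have hpairsR : ((hubNbrs t H S).card : ℝ) ^ 2 ≤ (apexPairs t H S).card +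
      γ ^ 2 * (Fintype.card V : ℝ) ^ 2 := by
    have h1 : (hubNbrs t H S).card ^ 2 ≤ (apexPairs t H S).card +
        ((hubNbrs t H S ×ˢ hubNbrs t H S).filter fun p => apex t H p.1 p.2 ≠ S).card := by
      rw [sq, ← Finset.card_product]
      refine (Finset.card_le_card fun p hp => ?_).trans (Finset.card_union_le _ _)
      simp only [Finset.mem_union, mem_apexPairs, Finset.mem_filter, hp, true_and]
      exact em _
    refine le_trans (by exact_mod_cast Nat.cast_le (α := ℝ).2 h1) (add_le_add_right hbad _)
  have hexc := card_exceptional_le (N := hubNbrs t H S) (Q := fun x x' => apex t H x x' ≠ S) hγ0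
    (show 0 < Fintype.card V by omega) hbad
  have hgle : (⌊γ * Fintype.card V⌋₊ : ℝ) ≤ γ * Fintype.card V := Nat.floor_le (by positivity)
  have hK' : (K : ℝ) = 2 * (2 * t * D + 4 * t * (2 * t + D) + t) + 16 * (2 * t + 3) + 1 := by
    rw [hK]; push_cast; ring
  have hn0 : (0 : ℝ) < Fintype.card V := Nat.cast_pos.2 (by omega)
  have hOγ : ((S ∪ hubNbrs t H S)ᶜ.card : ℝ) ≤ γ * Fintype.card V :=
    hO.trans (mul_le_mul_of_nonneg_right hγγ hn0.le)
  rw [← hS]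
  refine card_le_of_disjoint_le_missing hH S (card_disjoint_le_missing hH hfree ht hS ?_ hexc ?_)
  · rify
    have h1 : (Fintype.card V : ℝ) / 2 ≤ (hubNbrs t H S).card := by nlinarith
    have h2 : ((Fintype.card V : ℝ) / 2) ^ 2 ≤ ((hubNbrs t H S).card : ℝ) ^ 2 := by gcongr
    have h3 : γ ^ 2 * (Fintype.card V : ℝ) ^ 2 ≤ 1 / 8 * (Fintype.card V : ℝ) ^ 2 := by
      gcongr
    have h4 : (16 * (2 * t + 3) : ℝ) < Fintype.card V := by nlinarith
    nlinarith
  · rw [← hD]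
    rify
    generalize (⌊γ * Fintype.card V⌋₊ : ℝ) = g at *
    generalize ((S ∪ hubNbrs t H S)ᶜ.card : ℝ) = b at *
    generalize (Fintype.card V : ℝ) = n at *
    have h1 : (4 * D + 1) * b ≤ (4 * D + 1) * (γ * n) := by gcongr
    have h2 : 2 * (2 * t + D) * g ≤ 2 * (2 * t + D) * (γ * n) := by gcongr
    have h3 : (4 * D + 1 + 2 * (2 * t + D)) * (γ * n) ≤ (4 * t + 7 * D) * (γ * n) :=
      mul_le_mul_of_nonneg_right (by linarith) (by positivity)
    have h4 : (4 * t + 7 * D) * (γ * n) = 1 / 2 * n := by rw [← mul_assoc, hγ1]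
    nlinarith

theorem choose_three_add_mul_le (m t : ℕ) : m.choose 3 + t * m.choose 2 ≤ (m + t).choose 3 := by
  induction t with
  | zero => simp
  | succ t ih =>
    have h1 : m.choose 2 ≤ (m + t).choose 2 := Nat.choose_le_choose 2 (Nat.le_add_right _ _)
    have h2 : (m + t + 1).choose 3 = (m + t).choose 2 + (m + t).choose 3 :=
      Nat.choose_succ_succ' (m + t) 2
    rw [← add_assoc, h2, add_mul]
    omega

theorem mul_sq_le_choose_sub {t n : ℕ} (h : t ≤ n) :
    t * n ^ 2 ≤ 2 * (n.choose 3 - (n - t).choose 3) + t * (2 * t + 1) * n := by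
  obtain ⟨m, rfl⟩ := Nat.exists_eq_add_of_le' h
  have h1 := choose_three_add_mul_le m t
  have h2 : 2 * m.choose 2 + m = m * m := by
    cases m with
    | zero => simp
    | succ m =>
      have := Nat.triangle_succ m
      rw [Nat.choose_two_right, Nat.add_sub_cancel,
        Nat.mul_div_cancel' (by simpa [mul_comm] using (Nat.even_mul_succ_self m).two_dvd)]
      ring
  rw [Nat.add_sub_cancel]
  have h3 : t * m.choose 2 ≤ (m + t).choose 3 - m.choose 3 := by omega
  nlinarith [Nat.zero_le (t * t), Nat.zero_le (t * t * t), Nat.zero_le (t * t * m),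
    Nat.zero_le (t * m)]

theorem not_containsFanExp_of_hitting {V : Type*} [DecidableEq V] {H : Finset (Finset V)}
    {S : Finset V} {t : ℕ} (ht : 0 < t) (hS : S.card ≤ t) (hH : ∀ e ∈ H, ¬ Disjoint e S) :
    ¬ ContainsFanExp t H := by
  rintro ⟨f, hf, hfH⟩
  have key : ∀ (k : Fin t → Fin 5) (z : Unit ⊕ Fin 5 × Fin t), f z ∈ S →
      (∀ i, f (Sum.inr (k i, i)) ∈ S) → (∀ i, z ≠ Sum.inr (k i, i)) → False := by
    intro k z hz hk hne
    have h1 : (Finset.univ.image fun i => f (Sum.inr (k i, i))).card = t := by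
      rw [Finset.card_image_of_injective _ fun i j hij => (Prod.mk.inj (Sum.inr.inj (hf hij))).2,
        Finset.card_univ, Fintype.card_fin]
    have h2 : insert (f z) (Finset.univ.image fun i => f (Sum.inr (k i, i))) ⊆ S := by
      simp [Finset.subset_iff, hz, hk]
    have h3 : f z ∉ Finset.univ.image fun i => f (Sum.inr (k i, i)) := by
      simp only [Finset.mem_image, Finset.mem_univ, true_and, not_exists]
      exact fun i hi => hne i (hf hi).symm
    have h4 := Finset.card_le_card h2
    rw [Finset.card_insert_of_notMem h3, h1] at h4
    omega
  have hmeet : ∀ a b c, ({a, b, c} : Finset V) ∈ H → a ∈ S ∨ b ∈ S ∨ c ∈ S := by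
    intro a b c h
    have := hH _ h
    by_contra! hcon
    exact this (by simp [hcon])
  by_cases hc : f (Sum.inl ()) ∈ S
  · have : ∀ i, ∃ k : Fin 5, f (Sum.inr (k, i)) ∈ S := fun i => by
      rcases hmeet _ _ _ (hfH i).2.2 with h | h | h <;> exact ⟨_, h⟩
    choose k hk using this
    exact key k _ hc hk fun i => by simp
  · have : ∀ i, ∃ k : Fin 5, (k = 1 ∨ k = 3) ∧ f (Sum.inr (k, i)) ∈ S := fun i => by
      rcases hmeet _ _ _ (hfH i).2.1 with h | h | h
      · exact (hc h).elim
      · exact ⟨1, by simp, h⟩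
      · exact ⟨3, by simp, h⟩
    choose k hk hkS using this
    rcases hmeet _ _ _ (hfH ⟨0, ht⟩).1 with h | h | h
    · exact hc h
    · refine key k _ h hkS fun i hi => ?_
      rcases hk i with h' | h' <;> simp [h'] at hi
    · refine key k _ h hkS fun i hi => ?_
      rcases hk i with h' | h' <;> simp [h'] at hi

theorem turan_fan_expansion (t : ℕ) (ht : 1 < t) :
    ∃ N : ℕ, ∀ n ≥ N, exFan3 t n = n.choose 3 - (n - t).choose 3 := by
  classical
  obtain ⟨N, hN⟩ := card_le_of_nearly_extremal t ht (t * (2 * t + 1))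
  refine ⟨N + t, fun n hn => IsGreatest.csSup_eq ⟨?_, ?_⟩⟩
  · obtain ⟨S, -, hS⟩ := Finset.exists_subset_card_eq
      (show t ≤ (Finset.univ : Finset (Fin n)).card by
        rw [Finset.card_univ, Fintype.card_fin]; omega)
    refine ⟨(Finset.univ.powersetCard 3).filter fun e => ¬ Disjoint e S, fun e he => ?_,
      not_containsFanExp_of_hitting (by omega) hS.le fun e he => (Finset.mem_filter.1 he).2, ?_⟩
    · exact (Finset.mem_powersetCard.1 (Finset.mem_filter.1 he).1).2
    · rw [← hS]
      convert card_meeting S <;> rw [Fintype.card_fin]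
  · rintro _ ⟨H, hH, hfree, rfl⟩
    have hlow := mul_sq_le_choose_sub (show t ≤ n by omega)
    by_cases hc : t * n ^ 2 ≤ 2 * H.card + t * (2 * t + 1) * n
    · have := hN (Fin n) H (by rw [Fintype.card_fin]; omega) hH hfree
        (by rwa [Fintype.card_fin])
      rwa [Fintype.card_fin] at this
    · omega
end

section
/- Let t > 1, let V be an n-vertex set and U ⊆ V a set of t vertices, and let H be the 3-graph on V whose hyperedges are all 3-element subsets of V that intersect U. Then H is F_t^3-free; consequently ex_3(n, F_t^3) ≥ C(n,3) − C(n−t,3). -/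
/-- If all hyperedges meet `U`, a copy of `F_t^3` forces `U` to have more than `t` vertices. -/
theorem not_containsFanExp_of_forall_inter_nonempty {V : Type*} [DecidableEq V] {t : ℕ}
    (ht : 0 < t) {U : Finset V} (hU : U.card ≤ t) {H : Finset (Finset V)}
    (hH : ∀ e ∈ H, (e ∩ U).Nonempty) : ¬ ContainsFanExp t H := by
  rintro ⟨f, hf, h⟩
  have mem_of_edge : ∀ a b c, ({f a, f b, f c} : Finset V) ∈ H → f a ∈ U ∨ f b ∈ U ∨ f c ∈ U := by
    intro a b c he
    obtain ⟨v, hv⟩ := hH _ he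
    simp only [Finset.mem_inter, Finset.mem_insert, Finset.mem_singleton] at hv
    rcases hv with ⟨rfl | rfl | rfl, hv⟩ <;> simp [hv]
  have outer : ∀ i : Fin t, ∃ x : Fin 5, (x = 0 ∨ x = 1 ∨ x = 4) ∧ f (Sum.inr (x, i)) ∈ U := by
    intro i
    rcases mem_of_edge _ _ _ (h i).2.2 with h | h | h
    exacts [⟨0, by simp, h⟩, ⟨1, by simp, h⟩, ⟨4, by simp, h⟩]
  choose x hx hxU using outer
  obtain ⟨y, hy, hyU⟩ : ∃ y, (∀ i, y ≠ Sum.inr (x i, i)) ∧ f y ∈ U := by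
    let o : Fin t := ⟨0, ht⟩
    have avoid : ∀ z : Fin 5, z ≠ x o → ∀ i, (Sum.inr (z, o) : Unit ⊕ Fin 5 × Fin t) ≠
        Sum.inr (x i, i) := by
      intro z hz i he
      simp only [Sum.inr.injEq, Prod.mk.injEq] at he
      obtain ⟨he, rfl⟩ := he
      exact hz he
    by_cases h0 : x o = 0
    · rcases mem_of_edge _ _ _ (h o).2.1 with h | h | h
      exacts [⟨_, by simp, h⟩, ⟨_, avoid 1 (by simp [h0]), h⟩, ⟨_, avoid 3 (by simp [h0]), h⟩]
    · rcases mem_of_edge _ _ _ (h o).1 with h | h | h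
      exacts [⟨_, by simp, h⟩, ⟨_, avoid 0 (Ne.symm h0), h⟩,
        ⟨_, avoid 2 (by rcases hx o with h | h | h <;> simp [h]), h⟩]
  let g : Option (Fin t) → Unit ⊕ Fin 5 × Fin t := fun o => o.elim y fun i => Sum.inr (x i, i)
  have hg : Function.Injective g := by
    rintro (_ | i) (_ | j) hij
    · rfl
    · exact absurd hij (hy j)
    · exact absurd hij.symm (hy i)
    · simp only [g, Option.elim_some, Sum.inr.injEq, Prod.mk.injEq] at hij
      rw [hij.2]
  have hgU : ∀ o ∈ (Finset.univ : Finset (Option (Fin t))), f (g o) ∈ U := by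
    rintro (_ | i) -
    exacts [hyU, hxU i]
  have hcard := Finset.card_le_card_of_injOn (f ∘ g) hgU (hf.comp hg).injOn
  simp only [Finset.card_univ, Fintype.card_option, Fintype.card_fin] at hcard
  omega

theorem card_powersetCard_filter_inter_nonempty {V : Type*} [Fintype V] [DecidableEq V]
    (k : ℕ) (U : Finset V) :
    ((Finset.univ.powersetCard k).filter fun e => (e ∩ U).Nonempty).card =
      (Fintype.card V).choose k - (Fintype.card V - U.card).choose k := by
  have hcompl : ((Finset.univ.powersetCard k).filter fun e => ¬ (e ∩ U).Nonempty) =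
      Uᶜ.powersetCard k := by
    ext e
    rw [Finset.mem_filter, Finset.mem_powersetCard, Finset.mem_powersetCard,
      Finset.not_nonempty_iff_eq_empty, ← Finset.disjoint_iff_inter_eq_empty,
      ← Finset.subset_compl_iff_disjoint_right]
    simp [and_comm]
  have hsum := Finset.card_filter_add_card_filter_not (s := Finset.univ.powersetCard k)
    fun e : Finset V => (e ∩ U).Nonempty
  rw [hcompl, Finset.card_powersetCard, Finset.card_powersetCard, Finset.card_compl,
    Finset.card_univ] at hsum
  omega

theorem card_le_exFan3 {t n : ℕ} {H : Finset (Finset (Fin n))} (h3 : ∀ e ∈ H, e.card = 3)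
    (hfree : ¬ ContainsFanExp t H) : H.card ≤ exFan3 t n := by
  refine le_csSup ⟨Fintype.card (Finset (Fin n)), ?_⟩ ⟨H, h3, hfree, rfl⟩
  rintro m ⟨H', -, -, rfl⟩
  exact Finset.card_le_univ H'

theorem fan_expansion_lower_bound (t n : ℕ) (ht : 1 < t)
    (V : Type*) [Fintype V] [DecidableEq V] (hV : Fintype.card V = n)
    (U : Finset V) (hU : U.card = t)
    (H : Finset (Finset V))
    (hH : H = (Finset.univ.powersetCard 3).filter fun e => (e ∩ U).Nonempty) :
    ¬ ContainsFanExp t H ∧ n.choose 3 - (n - t).choose 3 ≤ exFan3 t n := by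
  have ht0 : 0 < t := by omega
  refine ⟨not_containsFanExp_of_forall_inter_nonempty ht0 hU.le fun e he => ?_, ?_⟩
  · rw [hH] at he
    exact (Finset.mem_filter.1 he).2
  · have htn : t ≤ (Finset.univ : Finset (Fin n)).card := by
      rw [Finset.card_univ, Fintype.card_fin, ← hU, ← hV]
      exact Finset.card_le_univ U
    obtain ⟨W, -, hW⟩ := Finset.exists_subset_card_eq htn
    have hcard := card_powersetCard_filter_inter_nonempty 3 W
    rw [Fintype.card_fin, hW] at hcard
    rw [← hcard]
    exact card_le_exFan3
      (fun e he => (Finset.mem_powersetCard.1 (Finset.mem_filter.1 he).1).2)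
      (not_containsFanExp_of_forall_inter_nonempty ht0 hW.le fun e he =>
        (Finset.mem_filter.1 he).2)
end
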